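/- Let U be an open neighborhood of the origin in ℝⁿ and let f : U → ℝ be C^∞ with f(0)=0, ∇f(0)=0 and Γ₊(f) ≠ ∅, satisfying condition (C). If the support of φ is contained in a sufficiently small neighborhood of the origin, then the functions Z_±(s;φ) and Z(s;φ), holomorphic on Re(s) > 0, extend to the complex plane as meromorphic functions whose poles are contained in the set {−(⟨a⟩+ν)/l(a) : ν ∈ ℤ₊, a ∈ Σ̃^(1)} ∪ (−ℕ). Moreover the largest element of the first set equals −1/d(f), and when Z_±(s;φ) or Z(s;φ) has a pole at s = −1/d(f), its order is at most m(f) if 1/d(f) is not an integer, and at most min{m(f)+1, n} otherwise. -/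

import Mathlib

open scoped BigOperators Topology
open Filter MeasureTheory Set

namespace KN

variable {n : ℕ}

/-- The standard inner product on `ℝⁿ`. -/
def dot (a x : Fin n → ℝ) : ℝ := ∑ i, a i * x i

/-- The hyperplane `H(a,l) = {x | ⟨a,x⟩ = l}`. -/
def Hplane (a : Fin n → ℝ) (l : ℝ) : Set (Fin n → ℝ) := {x | dot a x = l}

/-- The closed half-space `H⁺(a,l) = {x | ⟨a,x⟩ ≥ l}`. -/
def Hhalf (a : Fin n → ℝ) (l : ℝ) : Set (Fin n → ℝ) := {x | l ≤ dot a x}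

/-- View an integer vector as a real vector. -/
def intPt (a : Fin n → ℤ) : Fin n → ℝ := fun i => (a i : ℝ)

/-- View a vector of naturals as a real vector. -/
def natPt (a : Fin n → ℕ) : Fin n → ℝ := fun i => (a i : ℝ)

/-- The nonnegative octant `ℝ₊ⁿ`. -/
def octant (n : ℕ) : Set (Fin n → ℝ) := {x | ∀ i, 0 ≤ x i}

/-- A (convex rational) polyhedron: a finite intersection of closed half-spaces with
integral data. -/
def IsPolyhedron (P : Set (Fin n → ℝ)) : Prop :=
  ∃ (N : ℕ) (a : Fin N → Fin n → ℤ) (l : Fin N → ℤ),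
    P = ⋂ j, Hhalf (intPt (a j)) ((l j : ℝ))

/-- `(a,l) ∈ ℤⁿ × ℤ` is valid for `P` if `P ⊆ H⁺(a,l)`. -/
def ValidPair (P : Set (Fin n → ℝ)) (a : Fin n → ℤ) (l : ℤ) : Prop :=
  P ⊆ Hhalf (intPt a) (l : ℝ)

/-- A face of a polyhedron `P`: a set of the form `P ∩ H(a,l)` with `(a,l)` valid for `P`. -/
def IsFaceOf (P F : Set (Fin n → ℝ)) : Prop :=
  ∃ (a : Fin n → ℤ) (l : ℤ), ValidPair P a l ∧ F = P ∩ Hplane (intPt a) (l : ℝ)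

/-- Dimension of a subset of `ℝⁿ`: the dimension of its affine hull. -/
noncomputable def setDim (s : Set (Fin n → ℝ)) : ℕ :=
  Module.finrank ℝ (affineSpan ℝ s).direction

/-- First-order partial derivative in the `i`-th coordinate direction. -/
noncomputable def pderiv1 (i : Fin n) (f : (Fin n → ℝ) → ℝ) : (Fin n → ℝ) → ℝ :=
  fun x => fderiv ℝ f x (Pi.single i 1)

/-- Iterated partial derivative `∂^α` for a multi-index `α ∈ ℤ₊ⁿ`. -/
noncomputable def mderiv (α : Fin n → ℕ) (f : (Fin n → ℝ) → ℝ) : (Fin n → ℝ) → ℝ :=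
  (List.finRange n).foldr (fun i g => (pderiv1 i)^[α i] g) f

/-- Taylor coefficient `c_α = ∂^α f(0)/α!`. -/
noncomputable def taylorCoeff (f : (Fin n → ℝ) → ℝ) (α : Fin n → ℕ) : ℝ :=
  mderiv α f 0 / ((∏ i, Nat.factorial (α i) : ℕ) : ℝ)

/-- The Newton polyhedron `Γ₊(f)`: the convex hull of `⋃ {α + ℝ₊ⁿ : c_α ≠ 0}`. -/
def NewtonPolyhedron (f : (Fin n → ℝ) → ℝ) : Set (Fin n → ℝ) :=
  convexHull ℝ {x | ∃ α : Fin n → ℕ, taylorCoeff f α ≠ 0 ∧ ∀ i, (α i : ℝ) ≤ x i}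

/-- The pair `(a,l) ∈ ℤ₊ⁿ × ℤ₊` is valid for `P` and defines the face `γ = P ∩ H(a,l)`. -/
def DefinesFace (P : Set (Fin n → ℝ)) (a : Fin n → ℕ) (l : ℕ) (γ : Set (Fin n → ℝ)) : Prop :=
  P ⊆ Hhalf (natPt a) (l : ℝ) ∧ γ = P ∩ Hplane (natPt a) (l : ℝ)

/-- The anisotropic dilation `x ↦ (t^{a₁}x₁, …, t^{aₙ}xₙ)`. -/
def scaleAction (a : Fin n → ℕ) (t : ℝ) (x : Fin n → ℝ) : Fin n → ℝ :=
  fun i => t ^ (a i) * x i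

/-- `f` admits the `γ`-part on `U` (w.r.t. the polyhedron `P`): for every `x ∈ U` the limit
`lim_{t→0⁺} f(t^{a₁}x₁,…,t^{aₙ}xₙ)/t^l` exists for all valid pairs `(a,l) ∈ ℤ₊ⁿ×ℤ₊`
defining `γ`. -/
def AdmitsGammaPartOn (f : (Fin n → ℝ) → ℝ) (U P γ : Set (Fin n → ℝ)) : Prop :=
  ∀ x ∈ U, ∀ (a : Fin n → ℕ) (l : ℕ), DefinesFace P a l γ →
    ∃ c : ℝ, Filter.Tendsto (fun t : ℝ => f (scaleAction a t x) / t ^ l) (𝓝[>] (0:ℝ)) (𝓝 c)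

/-- Membership in the class `Ê[P](U)`. -/
def MemEhatP (P U : Set (Fin n → ℝ)) (f : (Fin n → ℝ) → ℝ) : Prop :=
  ContDiffOn ℝ (⊤ : ℕ∞) f U ∧ NewtonPolyhedron f ⊆ P ∧
    ∀ γ, IsFaceOf P γ → AdmitsGammaPartOn f U P γ

/-- Membership in the class `Ê(U) = {f : f ∈ Ê[Γ₊(f)](U)}`, where `Ê[∅](U) = {0}`. -/
def MemEhat (U : Set (Fin n → ℝ)) (f : (Fin n → ℝ) → ℝ) : Prop :=
  (NewtonPolyhedron f = ∅ ∧ ∀ x ∈ U, f x = 0) ∨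
  (NewtonPolyhedron f ≠ ∅ ∧ MemEhatP (NewtonPolyhedron f) U f)

/-- The polynomial `γ`-part `Σ_{α ∈ γ ∩ ℤ₊ⁿ} c_α x^α`. -/
noncomputable def gammaPartPoly (f : (Fin n → ℝ) → ℝ) (γ : Set (Fin n → ℝ))
    (x : Fin n → ℝ) : ℝ :=
  ∑' α : {α : Fin n → ℕ // natPt α ∈ γ}, taylorCoeff f α.1 * ∏ i, x i ^ (α.1 i)

/-- `V(γ) = {k : γ + ℝ₊ e_k ⊆ γ}`. -/
def Vset (γ : Set (Fin n → ℝ)) : Set (Fin n) :=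
  {k | ∀ x ∈ γ, ∀ r : ℝ, 0 ≤ r → x + r • (Pi.single k (1:ℝ) : Fin n → ℝ) ∈ γ}

/-- `W(γ) = {1,…,n} \ V(γ)`. -/
def Wset (γ : Set (Fin n → ℝ)) : Set (Fin n) := (Vset γ)ᶜ

open Classical in
/-- `T_I` replaces the coordinates indexed by `I` with `0`. -/
noncomputable def TI (I : Set (Fin n)) (x : Fin n → ℝ) : Fin n → ℝ :=
  fun i => if i ∈ I then 0 else x i

open Classical in
/-- `T_I^r` replaces the coordinates indexed by `I` with `r`. -/
noncomputable def TIr (I : Set (Fin n)) (r : ℝ) (x : Fin n → ℝ) : Fin n → ℝ :=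
  fun i => if i ∈ I then r else x i

/-- The canonical `γ`-part function
`f_γ(x) = Σ_{α ∈ γ_V} (1/α!) (∂^α f)(T_{W(γ)}(x)) x^α`, with `γ_V = T_{V(γ)}(γ) ∩ ℤ₊ⁿ`. -/
noncomputable def gammaFn (f : (Fin n → ℝ) → ℝ) (γ : Set (Fin n → ℝ)) (x : Fin n → ℝ) : ℝ :=
  ∑' α : {α : Fin n → ℕ // natPt α ∈ TI (Vset γ) '' γ},
    mderiv α.1 f (TI (Wset γ) x) * (∏ i, x i ^ (α.1 i)) /
      ((∏ i, Nat.factorial (α.1 i) : ℕ) : ℝ)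

/-- `f` is nondegenerate over `ℝ` w.r.t. its Newton polyhedron: for every nonempty compact
face `γ` of `Γ₊(f)` the gradient of the polynomial `f_γ` does not vanish on
`U ∩ (ℝ \ {0})ⁿ`. -/
def Nondegenerate (f : (Fin n → ℝ) → ℝ) (U : Set (Fin n → ℝ)) : Prop :=
  ∀ γ, IsFaceOf (NewtonPolyhedron f) γ → γ.Nonempty → IsCompact γ →
    ∀ x ∈ U, (∀ i, x i ≠ 0) → fderiv ℝ (gammaPartPoly f γ) x ≠ 0

/-- Condition (C): `f ∈ Ê(U)` and `f` is nondegenerate over `ℝ` w.r.t. `Γ₊(f)`. -/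
def ConditionC (U : Set (Fin n → ℝ)) (f : (Fin n → ℝ) → ℝ) : Prop :=
  MemEhat U f ∧ Nondegenerate f U

/-- The Newton distance `d(f)`: the coordinate of the point where the diagonal meets
the boundary of `Γ₊(f)`. -/
noncomputable def newtonDist (f : (Fin n → ℝ) → ℝ) : ℝ :=
  sInf {t : ℝ | (fun _ : Fin n => t) ∈ NewtonPolyhedron f}

/-- `τ` is the principal face of `Γ₊(f)`: its relative interior contains
`q_* = (d(f),…,d(f))`. -/
def IsPrincipalFace (f : (Fin n → ℝ) → ℝ) (τ : Set (Fin n → ℝ)) : Prop :=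
  IsFaceOf (NewtonPolyhedron f) τ ∧
    (fun _ : Fin n => newtonDist f) ∈ intrinsicInterior ℝ τ

/-- The oscillatory integral `I(t;φ) = ∫ e^{itf(x)} φ(x) dx`. -/
noncomputable def oscInt (f : (Fin n → ℝ) → ℝ) (φ : (Fin n → ℝ) → ℂ) (t : ℝ) : ℂ :=
  ∫ x : Fin n → ℝ, Complex.exp (Complex.I * t * f x) * φ x

/-- `Z₊(s;φ) = ∫ f(x)₊^s φ(x) dx`. -/
noncomputable def zetaPlus (f : (Fin n → ℝ) → ℝ) (φ : (Fin n → ℝ) → ℂ) (s : ℂ) : ℂ :=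
  ∫ x : Fin n → ℝ, ((max (f x) 0 : ℝ) : ℂ) ^ s * φ x

/-- `Z₋(s;φ) = ∫ f(x)₋^s φ(x) dx`. -/
noncomputable def zetaMinus (f : (Fin n → ℝ) → ℝ) (φ : (Fin n → ℝ) → ℂ) (s : ℂ) : ℂ :=
  ∫ x : Fin n → ℝ, ((max (-f x) 0 : ℝ) : ℂ) ^ s * φ x

/-- The local zeta function `Z(s;φ) = ∫ |f(x)|^s φ(x) dx`. -/
noncomputable def zetaAbs (f : (Fin n → ℝ) → ℝ) (φ : (Fin n → ℝ) → ℂ) (s : ℂ) : ℂ :=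
  ∫ x : Fin n → ℝ, ((|f x| : ℝ) : ℂ) ^ s * φ x

/-- An amplitude: a `C^∞` function with compact support contained in `U ∩ V`. -/
def IsAmplitude (U V : Set (Fin n → ℝ)) (φ : (Fin n → ℝ) → ℂ) : Prop :=
  ContDiff ℝ (⊤ : ℕ∞) φ ∧ HasCompactSupport φ ∧ tsupport φ ⊆ U ∩ V

/-- Partial sum `Σ_{α ∈ E, α ≥ -M} Σ_{k=1}^n C_{αk} t^α (log t)^{k-1}`. -/
noncomputable def partialSum (n : ℕ) (E : Set ℝ) (C : ℝ → ℕ → ℂ) (M t : ℝ) : ℂ :=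
  ∑ᶠ α ∈ {β ∈ E | -M ≤ β}, ∑ k ∈ Finset.Icc 1 n,
    C α k * ((t ^ α : ℝ) : ℂ) * (((Real.log t) ^ (k - 1) : ℝ) : ℂ)

/-- `g(t)` admits the asymptotic expansion `Σ_{α ∈ E} Σ_{k=1}^n C_{αk} t^α (log t)^{k-1}`
as `t → +∞`. -/
def HasAsympExpansion (n : ℕ) (g : ℝ → ℂ) (E : Set ℝ) (C : ℝ → ℕ → ℂ) : Prop :=
  (∀ α k, C α k ≠ 0 → α ∈ E ∧ 1 ≤ k ∧ k ≤ n) ∧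
  ∀ M : ℝ, ∃ K : ℝ, ∀ t : ℝ, 2 ≤ t →
    ‖g t - partialSum n E C M t‖ ≤ K * t ^ (-M)

/-- A set of exponents consisting of negative numbers, finite above any `-M`. -/
def LocallyFiniteBelow (E : Set ℝ) : Prop :=
  E ⊆ Set.Iio 0 ∧ ∀ M : ℝ, {β ∈ E | -M ≤ β}.Finite

/-- The set `S(f)` of pairs `(α,k)` appearing with a nonzero coefficient in the asymptotic
expansion of `I(t;φ)` for amplitudes `φ` supported arbitrarily close to the origin. -/
def OscSet (U : Set (Fin n → ℝ)) (f : (Fin n → ℝ) → ℝ) : Set (ℝ × ℕ) :=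
  {p | ∀ V ∈ 𝓝 (0 : Fin n → ℝ), ∃ φ : (Fin n → ℝ) → ℂ, IsAmplitude U V φ ∧
      ∃ E C, LocallyFiniteBelow E ∧ HasAsympExpansion n (oscInt f φ) E C ∧ C p.1 p.2 ≠ 0}

/-- The cone spanned by the vectors `g j`, `j ∈ s`. -/
def coneSpanSub (g : Fin n → (Fin n → ℝ)) (s : Finset (Fin n)) : Set (Fin n → ℝ) :=
  {x | ∃ c : Fin n → ℝ, (∀ j, 0 ≤ c j) ∧ (∀ j ∉ s, c j = 0) ∧ x = ∑ j, c j • g j}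

/-- The cone spanned by all the vectors `g j`. -/
def coneSpan (g : Fin n → (Fin n → ℝ)) : Set (Fin n → ℝ) := coneSpanSub g Finset.univ

/-- `l(a) = min {⟨a,α⟩ : α ∈ Γ}`. -/
noncomputable def lval (Γ : Set (Fin n → ℝ)) (a : Fin n → ℝ) : ℝ := sInf (dot a '' Γ)

/-- Real matrix of skeleton vectors. -/
def genR (a : Fin n → (Fin n → ℕ)) : Fin n → (Fin n → ℝ) := fun j => natPt (a j)

/-- A simplicial subdivision `Σ` of the fan `Σ₀` associated with `Γ`, presented via the
skeletons of its `n`-dimensional cones: each maximal cone is unimodular (its skeleton can be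
completed to a basis of the lattice `ℤⁿ`), the cones cover `ℝ₊ⁿ`, each cone lies in a cone
`closure(γ*)` of the fan `Σ₀`, and two cones intersect in a common face. -/
structure SimplicialSubdivision (n : ℕ) (Γ : Set (Fin n → ℝ)) where
  ι : Type
  fin : Fintype ι
  gen : ι → Fin n → (Fin n → ℕ)
  unimodular : ∀ σ, (Matrix.det (Matrix.of fun j k => (gen σ j k : ℤ))).natAbs = 1
  covers : ∀ x ∈ octant n, ∃ σ, x ∈ coneSpan (genR (gen σ))
  subordinate : ∀ σ, ∃ γ, IsFaceOf Γ γ ∧ γ.Nonempty ∧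
      ∀ j, ∀ y ∈ γ, dot (natPt (gen σ j)) y = lval Γ (natPt (gen σ j))
  compatible : ∀ σ τ, ∃ s : Finset (Fin n),
      (∀ j ∈ s, gen σ j ∈ Set.range (gen τ)) ∧
      coneSpan (genR (gen σ)) ∩ coneSpan (genR (gen τ)) = coneSpanSub (genR (gen σ)) s

/-- The set `Σ^{(1)}` of primitive generators of the one-dimensional cones of `Σ`. -/
def sigma1 {n : ℕ} {Γ : Set (Fin n → ℝ)} (S : SimplicialSubdivision n Γ) :
    Set (Fin n → ℕ) :=
  {a | ∃ σ j, S.gen σ j = a}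

/-- The set `{-(⟨a⟩+ν)/l(a) : ν ∈ ℤ₊, a ∈ Σ̃^{(1)}}`. -/
noncomputable def expSetMain {n : ℕ} (Γ : Set (Fin n → ℝ))
    (S : SimplicialSubdivision n Γ) : Set ℝ :=
  {r | ∃ a ∈ sigma1 S, 0 < lval Γ (natPt a) ∧
        ∃ ν : ℕ, r = -((∑ i, (a i : ℝ)) + (ν : ℝ)) / lval Γ (natPt a)}

/-- The full candidate set `{-(⟨a⟩+ν)/l(a)} ∪ (-ℕ)`. -/
noncomputable def expSet {n : ℕ} (Γ : Set (Fin n → ℝ))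
    (S : SimplicialSubdivision n Γ) : Set ℝ :=
  expSetMain Γ S ∪ {r | ∃ m : ℕ, r = -((m : ℝ) + 1)}

/-- `G` has at `s₀` a pole of order at most `m` (in particular `G` may be analytic there). -/
def PoleOrderAtMost (G : ℂ → ℂ) (s₀ : ℂ) (m : ℕ) : Prop :=
  ∃ h : ℂ → ℂ, AnalyticAt ℂ h s₀ ∧ ∀ᶠ s in 𝓝[≠] s₀, (s - s₀) ^ m * G s = h s


open Classical in
/-- `A_V(N) = {α ∈ T_V(ℤ₊ⁿ) : ⟨α⟩ < N}`. -/
noncomputable def ASetF (n : ℕ) (V : Finset (Fin n)) (N : ℕ) : Finset (Fin n → ℕ) :=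
  (Fintype.piFinset fun _ : Fin n => Finset.range (N + 1)).filter
    (fun α => (∀ j ∈ V, α j = 0) ∧ ∑ i, α i < N)

open Classical in
/-- `B_V(N) = {α ∈ T_V(ℤ₊ⁿ) : ⟨α⟩ = N}`. -/
noncomputable def BSetF (n : ℕ) (V : Finset (Fin n)) (N : ℕ) : Finset (Fin n → ℕ) :=
  (Fintype.piFinset fun _ : Fin n => Finset.range (N + 1)).filter
    (fun α => (∀ j ∈ V, α j = 0) ∧ ∑ i, α i = N)

/-- `v` is a vertex (0-dimensional face) of `P`. -/
def IsVertex (P : Set (Fin n → ℝ)) (v : Fin n → ℝ) : Prop := IsFaceOf P {v}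

/-- Membership in the class `Ě[P](U)`: an element of `Ê[P](U)` expressible as
`Σ_{p∈S} x^p ψ_p(x)` with `S ⊆ P ∩ ℤ₊ⁿ` finite containing all vertices of `P`, and
`ψ_p(0) ≠ 0` for each vertex `p`. -/
def MemEcheck (P U : Set (Fin n → ℝ)) (f : (Fin n → ℝ) → ℝ) : Prop :=
  MemEhatP P U f ∧
  ∃ S : Finset (Fin n → ℕ), (∀ p ∈ S, natPt p ∈ P) ∧
    (∀ v, IsVertex P v → ∃ p ∈ S, natPt p = v) ∧
    ∃ ψ : (Fin n → ℕ) → (Fin n → ℝ) → ℝ,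
      (∀ p ∈ S, ContDiffOn ℝ (⊤ : ℕ∞) (ψ p) U) ∧
      (∀ p ∈ S, IsVertex P (natPt p) → ψ p 0 ≠ 0) ∧
      ∀ x ∈ U, f x = ∑ p ∈ S, (∏ i, x i ^ p i) * ψ p x

/-- Membership in the class `Ẽ(U)`: functions of the form `Σ_{p∈S} x^p ψ_p(x)` with
`ψ_p(0) ≠ 0` for all `p ∈ S`. -/
def MemEtilde (U : Set (Fin n → ℝ)) (f : (Fin n → ℝ) → ℝ) : Prop :=
  ∃ S : Finset (Fin n → ℕ), ∃ ψ : (Fin n → ℕ) → (Fin n → ℝ) → ℝ,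
    (∀ p ∈ S, ContDiffOn ℝ (⊤ : ℕ∞) (ψ p) U) ∧ (∀ p ∈ S, ψ p 0 ≠ 0) ∧
    ∀ x ∈ U, f x = ∑ p ∈ S, (∏ i, x i ^ p i) * ψ p x

/-- Membership in the Denjoy–Carleman class `ℰ_M(U)`. -/
def MemDC (M : ℕ → ℝ) (U : Set (Fin n → ℝ)) (f : (Fin n → ℝ) → ℝ) : Prop :=
  ContDiffOn ℝ (⊤ : ℕ∞) f U ∧
  ∀ K : Set (Fin n → ℝ), K ⊆ U → IsCompact K →
    ∃ A B : ℝ, 0 < A ∧ 0 < B ∧ ∀ x ∈ K, ∀ α : Fin n → ℕ,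
      |mderiv α f x| ≤ A * B ^ (∑ i, α i) * ((∏ i, Nat.factorial (α i) : ℕ) : ℝ) *
        M (∑ i, α i)

open Classical in
/-- The multi-index `α - 1` from the proof of Proposition 9.5:
`(α-1)_j = l_jλ - m_j` for `j ∈ B_λ`, `(α-1)_n = λ - 1`, and `0` otherwise. -/
noncomputable def alphaIdx (n lam : ℕ) (l m : Fin n → ℕ) (Bl : Finset (Fin n)) :
    Fin (n+1) → ℕ :=
  fun i => if h : i = Fin.last n then lam - 1
    else if i.castPred h ∈ Bl then l (i.castPred h) * lam - m (i.castPred h) else 0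

open Classical in
/-- The constant `C_λ` of Proposition 9.5. -/
noncomputable def Cval (n lam : ℕ) (l m : Fin n → ℕ) (Bl : Finset (Fin n))
    (η : (Fin (n+1) → ℝ) → ℝ) : ℝ :=
  (1 / (Nat.factorial (lam - 1) : ℝ)) *
  (∏ j ∈ Bl, ((l j : ℝ) *
      ∏ ν ∈ Finset.Icc 1 (l j * lam - m j),
        (((l j * lam : ℕ) : ℝ) - (m j : ℝ) + 1 - (ν : ℝ)))⁻¹) *
  (if Bl = Finset.univ then mderiv (alphaIdx n lam l m Bl) η 0
   else ∫ z : {j : Fin n // j ∉ Bl} → ℝ in {z | ∀ j, 0 ≤ z j},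
     mderiv (alphaIdx n lam l m Bl) η
       (fun i => if h : i = Fin.last n then 0
         else if hj : i.castPred h ∈ Bl then 0 else z ⟨i.castPred h, hj⟩))


/-- The complex power `x₊ˢ` of the positive part of a real number. -/
noncomputable def posPow (s : ℂ) (x : ℝ) : ℂ := ((max x 0 : ℝ) : ℂ) ^ s

theorem posPow_of_pos {x : ℝ} (hx : 0 < x) (s : ℂ) : posPow s x = (x : ℂ) ^ s := by
  simp [posPow, max_eq_left hx.le]

theorem posPow_of_nonpos {x : ℝ} (hx : x ≤ 0) {s : ℂ} (hs : s ≠ 0) : posPow s x = 0 := by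
  simp [posPow, max_eq_right hx, hs]

theorem ne_zero_of_re_pos {s : ℂ} (hs : 0 < s.re) : s ≠ 0 := by
  rintro rfl; simp at hs

theorem norm_posPow {s : ℂ} (hs : 0 < s.re) (x : ℝ) : ‖posPow s x‖ = (max x 0) ^ s.re := by
  rcases lt_or_ge 0 x with hx | hx
  · rw [posPow_of_pos hx, Complex.norm_cpow_eq_rpow_re_of_pos hx, max_eq_left hx.le]
  · rw [posPow_of_nonpos hx (ne_zero_of_re_pos hs), max_eq_right hx, norm_zero,
      Real.zero_rpow hs.ne']

theorem continuous_posPow {s : ℂ} (hs : 0 < s.re) : Continuous (posPow s) := by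
  have h : Continuous fun x : ℝ => (x : ℂ) ^ s := Complex.continuous_ofReal_cpow_const hs
  exact h.comp (continuous_id.max continuous_const)

theorem norm_posPow_le {s : ℂ} (hs : 0 < s.re) {x R N : ℝ} (hR : 1 ≤ R) (hx : |x| ≤ R)
    (hN : s.re ≤ N) : ‖posPow s x‖ ≤ R ^ N := by
  rw [norm_posPow hs]
  have h1 : max x 0 ≤ R := max_le ((le_abs_self x).trans hx) (by linarith)
  calc (max x 0) ^ s.re ≤ R ^ s.re := Real.rpow_le_rpow (le_max_right _ _) h1 hs.le
    _ ≤ R ^ N := Real.rpow_le_rpow_of_exponent_le hR hN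

theorem posPow_mul {c : ℝ} (hc : 0 < c) (s : ℂ) (x : ℝ) :
    posPow s (c * x) = (c : ℂ) ^ s * posPow s x := by
  have : max (c * x) 0 = c * max x 0 := by
    rw [mul_max_of_nonneg _ _ hc.le, mul_zero]
  rw [posPow, this, Complex.ofReal_mul, Complex.mul_cpow_ofReal_nonneg hc.le (le_max_right _ _),
    posPow]

theorem posPow_add_natCast {s : ℂ} (hs : 0 < s.re) (K : ℕ) (x : ℝ) :
    posPow (s + K) x = (x : ℂ) ^ K * posPow s x := by
  rcases lt_or_ge 0 x with hx | hx
  · have : (x : ℂ) ≠ 0 := by exact_mod_cast hx.ne'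
    rw [posPow_of_pos hx, posPow_of_pos hx, Complex.cpow_add _ _ this, Complex.cpow_natCast,
      mul_comm]
  · rw [posPow_of_nonpos hx (ne_zero_of_re_pos hs), posPow_of_nonpos hx (ne_zero_of_re_pos ?_),
      mul_zero]
    simp only [Complex.add_re, Complex.natCast_re]
    positivity

theorem hasDerivAt_posPow {s : ℂ} (hs : 0 < s.re) (x : ℝ) :
    HasDerivAt (posPow (s + 1)) ((s + 1) * posPow s x) x := by
  have hs1 : 0 < (s + 1).re := by simp; linarith
  rcases lt_trichotomy x 0 with hx | rfl | hx
  · rw [posPow_of_nonpos hx.le (ne_zero_of_re_pos hs), mul_zero]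
    refine (hasDerivAt_const x (0 : ℂ)).congr_of_eventuallyEq ?_
    filter_upwards [Iio_mem_nhds hx] with y hy
    exact posPow_of_nonpos (le_of_lt hy) (ne_zero_of_re_pos hs1)
  · rw [posPow_of_nonpos le_rfl (ne_zero_of_re_pos hs), mul_zero]
    have h0 : posPow s 0 = 0 := posPow_of_nonpos le_rfl (ne_zero_of_re_pos hs)
    rw [hasDerivAt_iff_isLittleO_nhds_zero]
    have h1 : ∀ h : ℝ, posPow (s + 1) h = (h : ℂ) * posPow s h := fun h => by
      simpa using posPow_add_natCast hs 1 h
    simp only [zero_add, smul_zero, sub_zero, h1, Complex.ofReal_zero, zero_mul]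
    have h2 : Tendsto (posPow s) (𝓝 0) (𝓝 0) := by
      simpa [h0] using (continuous_posPow hs).tendsto 0
    have h3 : (fun h : ℝ => (h : ℂ)) =O[𝓝 0] (fun h : ℝ => h) :=
      Asymptotics.IsBigO.of_bound 1 (by simp)
    simpa using h3.mul_isLittleO ((Asymptotics.isLittleO_one_iff ℝ).2 h2)
  · have := hasDerivAt_ofReal_cpow_const hx.ne' (ne_zero_of_re_pos hs1)
    rw [add_sub_cancel_right] at this
    rw [posPow_of_pos hx]
    refine this.congr_of_eventuallyEq ?_
    filter_upwards [Ioi_mem_nhds hx] with y hy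
    exact posPow_of_pos hy _

theorem differentiableOn_posPow (x : ℝ) :
    DifferentiableOn ℂ (fun s => posPow s x) {s | 0 < s.re} := by
  rcases lt_or_ge 0 x with hx | hx
  · have : (x : ℂ) ≠ 0 := by exact_mod_cast hx.ne'
    simp only [posPow_of_pos hx]
    exact (differentiable_id.const_cpow (Or.inl this)).differentiableOn
  · refine (differentiableOn_const (0 : ℂ)).congr fun s hs => ?_
    exact posPow_of_nonpos hx (ne_zero_of_re_pos hs)

/-- Holomorphic dependence of a parametric integral, under local domination. -/
theorem differentiableOn_integral_of_dominated {α : Type*} [MeasurableSpace α] {μ : Measure α}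
    {F : ℂ → α → ℂ} {D : Set ℂ} (hD : IsOpen D)
    (hmeas : ∀ s ∈ D, AEStronglyMeasurable (F s) μ)
    (hdiff : ∀ᵐ a ∂μ, DifferentiableOn ℂ (fun s => F s a) D)
    (hbound : ∀ s₀ ∈ D, ∃ bound : α → ℝ, Integrable bound μ ∧ ∃ u ∈ 𝓝 s₀,
      ∀ᵐ a ∂μ, ∀ s ∈ u, ‖F s a‖ ≤ bound a) :
    DifferentiableOn ℂ (fun s => ∫ a, F s a ∂μ) D := by
  intro s₀ hs₀
  obtain ⟨bound, hint, u, hu, hub⟩ := hbound s₀ hs₀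
  obtain ⟨r, hr, hrs⟩ := Metric.mem_nhds_iff.1 (inter_mem hu (hD.mem_nhds hs₀))
  have hsub : ∀ s ∈ Metric.ball s₀ (r / 2), Metric.closedBall s (r / 4) ⊆ u ∩ D := by
    intro s hs z hz
    apply hrs
    rw [Metric.mem_ball] at *
    rw [Metric.mem_closedBall] at hz
    linarith [dist_triangle z s s₀]
  have hball : Metric.ball s₀ (r / 2) ∈ 𝓝 s₀ := Metric.ball_mem_nhds _ (by positivity)
  have hderiv : ∀ᵐ a ∂μ, ∀ s ∈ Metric.ball s₀ (r / 2),
      HasDerivAt (fun s => F s a) (deriv (fun s => F s a) s) s := by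
    filter_upwards [hdiff] with a ha s hs
    exact (ha.differentiableAt (hD.mem_nhds
      (hsub s hs (Metric.mem_closedBall_self (by positivity))).2)).hasDerivAt
  have hle : ∀ᵐ a ∂μ, ∀ s ∈ Metric.ball s₀ (r / 2),
      ‖deriv (fun s => F s a) s‖ ≤ bound a / (r / 4) := by
    filter_upwards [hdiff, hub] with a ha hb s hs
    refine Complex.norm_deriv_le_of_forall_mem_sphere_norm_le (by positivity) ?_ ?_
    · refine DifferentiableOn.diffContOnCl_ball (U := D) ha fun z hz => (hsub s hs hz).2
    · exact fun z hz => hb z (hsub s hs (Metric.sphere_subset_closedBall hz)).1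
  have hmeas' : AEStronglyMeasurable (fun a => deriv (fun s => F s a) s₀) μ := by
    have hlim : Tendsto (fun k : ℕ => s₀ + ((r / 4 / (k + 1) : ℝ) : ℂ)) atTop (𝓝[≠] s₀) := by
      rw [tendsto_nhdsWithin_iff]
      constructor
      · have h1 : Tendsto (fun k : ℕ => r / 4 * (1 / ((k : ℝ) + 1))) atTop (𝓝 (r / 4 * 0)) :=
          tendsto_one_div_add_atTop_nhds_zero_nat.const_mul _
        have h2 := (Complex.continuous_ofReal.tendsto _).comp h1
        have h3 := h2.const_add s₀
        simp only [mul_zero, Complex.ofReal_zero, add_zero] at h3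
        refine h3.congr fun k => ?_
        simp only [Function.comp]
        congr 2
        ring
      · refine Eventually.of_forall fun k => ?_
        have : r / 4 / ((k : ℝ) + 1) ≠ 0 := by positivity
        rw [mem_compl_iff, mem_singleton_iff, add_eq_left]
        exact_mod_cast this
    refine aestronglyMeasurable_of_tendsto_ae atTop
      (f := fun (k : ℕ) a => slope (fun s => F s a) s₀ (s₀ + ((r / 4 / (k + 1) : ℝ) : ℂ))) ?_ ?_
    · intro k
      have hmem : s₀ + ((r / 4 / (k + 1) : ℝ) : ℂ) ∈ D := by
        refine (hsub s₀ (Metric.mem_ball_self (by positivity)) ?_).2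
        rw [Metric.mem_closedBall, dist_eq_norm, add_sub_cancel_left, Complex.norm_real,
          Real.norm_of_nonneg (by positivity)]
        exact div_le_self (by positivity) (by linarith [Nat.cast_nonneg (α := ℝ) k])
      simp only [slope_def_module]
      have h := ((hmeas _ hmem).sub (hmeas _ hs₀)).const_smul
        ((s₀ + ((r / 4 / (k + 1) : ℝ) : ℂ) - s₀)⁻¹)
      exact h
    · filter_upwards [hderiv] with a ha
      exact (hasDerivAt_iff_tendsto_slope.1 (ha s₀ (Metric.mem_ball_self (by positivity)))).comp hlim
  have hint0 : Integrable (F s₀) μ :=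
    hint.mono' (hmeas _ hs₀) (hub.mono fun a ha => ha s₀ (mem_of_mem_nhds hu))
  exact (hasDerivAt_integral_of_dominated_loc_of_deriv_le hball
    ((hD.eventually_mem hs₀).mono fun s hs => hmeas s hs) hint0 hmeas' hle
    (hint.div_const _) hderiv).2.differentiableAt.differentiableWithinAt

/-- The half-open unit cube `(0,1]ⁿ`. -/
def box (n : ℕ) : Set (Fin n → ℝ) := Set.pi univ fun _ => Ioc (0 : ℝ) 1

/-- Lebesgue measure on the unit cube times Lebesgue measure on `ℝⁿ`. -/
noncomputable def chartMeasure (n : ℕ) : Measure ((Fin n → ℝ) × (Fin n → ℝ)) :=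
  ((volume : Measure (Fin n → ℝ)).restrict (box n)).prod volume

theorem measurableSet_box (n : ℕ) : MeasurableSet (box n) :=
  MeasurableSet.univ_pi fun _ => measurableSet_Ioc

theorem volume_restrict_box (n : ℕ) : (volume : Measure (Fin n → ℝ)).restrict (box n) =
    Measure.pi fun _ => (volume : Measure ℝ).restrict (Ioc 0 1) :=
  Measure.restrict_pi_pi _ _

instance isProbabilityMeasure_restrict_Ioc :
    IsProbabilityMeasure ((volume : Measure ℝ).restrict (Ioc 0 1)) := ⟨by simp⟩

instance isProbabilityMeasure_restrict_box (n : ℕ) :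
    IsProbabilityMeasure ((volume : Measure (Fin n → ℝ)).restrict (box n)) := by
  rw [volume_restrict_box]; infer_instance

instance isFiniteMeasureOnCompacts_chartMeasure (n : ℕ) :
    IsFiniteMeasureOnCompacts (chartMeasure n) := by
  unfold chartMeasure; infer_instance

theorem ae_mem_box (n : ℕ) : ∀ᵐ p ∂(chartMeasure n), p.1 ∈ box n := by
  have h : ∀ᵐ y ∂((volume : Measure (Fin n → ℝ)).restrict (box n)), y ∈ box n :=
    ae_restrict_mem (measurableSet_box n)
  exact Measure.quasiMeasurePreserving_fst.ae h

/-- The monomial weight `∏ y_j ^ (l_j s + b_j - 1)`. -/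
noncomputable def monWeight (l b : Fin n → ℕ) (s : ℂ) (y : Fin n → ℝ) : ℂ :=
  ∏ j, (y j : ℂ) ^ ((l j : ℂ) * s + (b j : ℂ) - 1)

theorem measurable_monWeight (l b : Fin n → ℕ) (s : ℂ) : Measurable (monWeight l b s) := by
  unfold monWeight
  fun_prop

theorem norm_monWeight_le {l b : Fin n → ℕ} {M : ℕ} (hb : ∀ j, l j * M + 1 ≤ b j) {s : ℂ}
    (hs : -(M : ℝ) < s.re) {y : Fin n → ℝ} (hy : y ∈ box n) : ‖monWeight l b s y‖ ≤ 1 := by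
  rw [monWeight, norm_prod]
  refine Finset.prod_le_one (fun _ _ => norm_nonneg _) fun j _ => ?_
  have hj := hy j (mem_univ j)
  rw [Complex.norm_cpow_eq_rpow_re_of_pos hj.1]
  refine Real.rpow_le_one hj.1.le hj.2 ?_
  have h1 : ((l j * M + 1 : ℕ) : ℝ) ≤ b j := by exact_mod_cast hb j
  have h2 : (l j : ℝ) * -(M : ℝ) ≤ l j * s.re := mul_le_mul_of_nonneg_left hs.le (by positivity)
  push_cast at h1
  simp
  linarith

theorem differentiable_monWeight (l b : Fin n → ℕ) {y : Fin n → ℝ} (hy : y ∈ box n) :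
    Differentiable ℂ fun s => monWeight l b s y := by
  unfold monWeight
  refine Differentiable.fun_finsetProd fun j _ => ?_
  have : (y j : ℂ) ≠ 0 := by exact_mod_cast (hy j (mem_univ j)).1.ne'
  exact Differentiable.const_cpow (by fun_prop) (Or.inl this)

/-- The local zeta integral in a monomial chart. -/
noncomputable def chartInt (g : (Fin n → ℝ) × (Fin n → ℝ) → ℝ) (l b : Fin n → ℕ) (k : ℕ)
    (Θ : (Fin n → ℝ) × (Fin n → ℝ) → ℂ) (s : ℂ) : ℂ :=
  ∫ p, monWeight l b s p.1 * (posPow (s + k) (g p) * Θ p) ∂(chartMeasure n)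

/-- Smooth amplitudes with compact support in `Ω`. -/
def IsAmp (Ω : Set ((Fin n → ℝ) × (Fin n → ℝ))) (Θ : (Fin n → ℝ) × (Fin n → ℝ) → ℂ) : Prop :=
  ContDiff ℝ (⊤ : ℕ∞) Θ ∧ HasCompactSupport Θ ∧ tsupport Θ ⊆ Ω

theorem integrable_monWeight_mul {l b : Fin n → ℕ} {M : ℕ} (hb : ∀ j, l j * M + 1 ≤ b j) {s : ℂ}
    (hs : -(M : ℝ) < s.re) {G : (Fin n → ℝ) × (Fin n → ℝ) → ℂ} (hG : Continuous G)
    (hGc : HasCompactSupport G) :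
    Integrable (fun p => monWeight l b s p.1 * G p) (chartMeasure n) := by
  refine (hG.integrable_of_hasCompactSupport hGc).bdd_mul (c := 1) ?_ ?_
  · exact ((measurable_monWeight l b s).comp measurable_fst).aestronglyMeasurable
  · filter_upwards [ae_mem_box n] with p hp
    exact norm_monWeight_le hb hs hp

section Analytic

variable {g : (Fin n → ℝ) × (Fin n → ℝ) → ℝ} {Θ : (Fin n → ℝ) × (Fin n → ℝ) → ℂ}

theorem continuous_posPow_mul (hg : Continuous g) (hΘ : Continuous Θ) {s : ℂ} (hs : 0 < s.re) :
    Continuous fun p => posPow s (g p) * Θ p :=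
  ((continuous_posPow hs).comp hg).mul hΘ

theorem differentiableOn_chartInt (hg : Continuous g) (hΘ : Continuous Θ)
    (hΘc : HasCompactSupport Θ) {l b : Fin n → ℕ} {M k : ℕ} (hb : ∀ j, l j * M + 1 ≤ b j)
    (hk : M ≤ k) : DifferentiableOn ℂ (chartInt g l b k Θ) {s | -(M : ℝ) < s.re} := by
  have hkM : (M : ℝ) ≤ k := by exact_mod_cast hk
  have hre : ∀ s : ℂ, -(M : ℝ) < s.re → 0 < (s + k).re := fun s hs => by
    simp; linarith
  have hD : IsOpen {s : ℂ | -(M : ℝ) < s.re} := isOpen_lt continuous_const Complex.continuous_re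
  refine differentiableOn_integral_of_dominated hD (fun s hs => ?_) ?_ fun s₀ hs₀ => ?_
  · exact (integrable_monWeight_mul hb hs (continuous_posPow_mul hg hΘ (hre s hs))
      hΘc.mul_left).aestronglyMeasurable
  · filter_upwards [ae_mem_box n] with p hp
    refine (differentiable_monWeight l b hp).differentiableOn.mul (DifferentiableOn.mul ?_ ?_)
    · refine (differentiableOn_posPow (g p)).comp (t := {s | 0 < s.re}) ?_ fun s hs => hre s hs
      exact (differentiable_id.add_const _).differentiableOn
    · exact differentiableOn_const _
  · obtain ⟨R, hR⟩ := hΘc.isCompact.exists_bound_of_continuousOn hg.continuousOn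
    refine ⟨fun p => (max R 1) ^ (s₀.re + 1 + k) * ‖Θ p‖, ?_, {s | -(M : ℝ) < s.re} ∩
      {s | s.re < s₀.re + 1}, ?_, ?_⟩
    · exact ((hΘ.integrable_of_hasCompactSupport hΘc).norm).const_mul _
    · exact inter_mem (hD.mem_nhds hs₀)
        ((isOpen_lt Complex.continuous_re continuous_const).mem_nhds (by simp))
    · filter_upwards [ae_mem_box n] with p hp s hs
      rw [norm_mul, norm_mul]
      by_cases hpΘ : Θ p = 0
      · simp [hpΘ]
      have hgp : |g p| ≤ max R 1 := (hR p (subset_tsupport _ hpΘ)).trans (le_max_left _ _)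
      have h1 := norm_posPow_le (hre s hs.1) (le_max_right R 1) hgp (N := s₀.re + 1 + k)
        (by simpa using (show s.re < s₀.re + 1 from hs.2).le)
      have h2 := norm_monWeight_le hb hs.1 hp
      calc _ ≤ 1 * ((max R 1) ^ (s₀.re + 1 + k) * ‖Θ p‖) := by gcongr
        _ = _ := one_mul _

end Analytic

section Parts

/-- Integration by parts against a power of one variable on the unit interval. -/
theorem integral_cpow_mul_by_parts {c : ℂ} (hc : 1 ≤ c.re) {G G' : ℝ → ℂ} (hG : Continuous G)
    (hG' : Continuous G') (hd : ∀ t, HasDerivAt G (G' t) t) :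
    c * ∫ t in Ioc (0 : ℝ) 1, (t : ℂ) ^ (c - 1) * G t =
      (∫ t in Ioc (0 : ℝ) 1, (G t + t * G' t)) - ∫ t in Ioc (0 : ℝ) 1, (t : ℂ) ^ c * G' t := by
  have hc0 : 0 < c.re := by linarith
  have hcont : Continuous fun t : ℝ => (t : ℂ) ^ c := Complex.continuous_ofReal_cpow_const hc0
  simp only [← intervalIntegral.integral_of_le (zero_le_one' ℝ)]
  have hi1 : IntervalIntegrable (fun t : ℝ => (t : ℂ) ^ (c - 1)) volume 0 1 :=
    intervalIntegral.intervalIntegrable_cpow' (by simp; linarith)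
  have hi2 : IntervalIntegrable (fun t : ℝ => (t : ℂ) ^ (c - 1) * G t) volume 0 1 :=
    hi1.mul_continuousOn hG.continuousOn
  have hi3 : IntervalIntegrable (fun t : ℝ => (t : ℂ) ^ c * G' t) volume 0 1 :=
    (hcont.mul hG').intervalIntegrable _ _
  have h1 : ∫ t in (0 : ℝ)..1, (c * ((t : ℂ) ^ (c - 1) * G t) + (t : ℂ) ^ c * G' t) = G 1 := by
    have := intervalIntegral.integral_eq_sub_of_hasDerivAt_of_le (zero_le_one' ℝ)
      (f := fun t : ℝ => (t : ℂ) ^ c * G t) (hcont.mul hG).continuousOn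
      (f' := fun t : ℝ => c * ((t : ℂ) ^ (c - 1) * G t) + (t : ℂ) ^ c * G' t)
      (fun t ht => by
        have h := (hasDerivAt_ofReal_cpow_const ht.1.ne'
          (ne_zero_of_re_pos hc0)).mul (hd t)
        rwa [mul_assoc] at h) ((hi2.const_mul c).add hi3)
    rw [this]
    simp [Complex.zero_cpow (ne_zero_of_re_pos hc0)]
  have h2 : ∫ t in (0 : ℝ)..1, (G t + t * G' t) = G 1 := by
    have := intervalIntegral.integral_eq_sub_of_hasDerivAt
      (f := fun t : ℝ => (t : ℂ) * G t) (f' := fun t : ℝ => G t + t * G' t) (a := 0) (b := 1)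
      (fun t _ => by
        have h := (Complex.ofRealCLM.hasDerivAt (x := t)).mul (hd t)
        exact h.congr_deriv (by simp))
      (Continuous.intervalIntegrable (by fun_prop) _ _)
    rw [this]
    simp
  rw [intervalIntegral.integral_add (hi2.const_mul c) hi3,
    intervalIntegral.integral_const_mul] at h1
  rw [h2, ← h1]
  ring

theorem measurePreserving_update (j : Fin n) :
    MeasurePreserving (fun q : (Fin n → ℝ) × ℝ => Function.update q.1 j q.2)
      (((volume : Measure (Fin n → ℝ)).restrict (box n)).prod
        ((volume : Measure ℝ).restrict (Ioc 0 1)))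
      ((volume : Measure (Fin n → ℝ)).restrict (box n)) := by
  have hmeas : Measurable fun q : (Fin n → ℝ) × ℝ => Function.update q.1 j q.2 := by
    rw [measurable_pi_iff]
    intro i
    rcases eq_or_ne i j with rfl | h
    · simpa using measurable_snd
    · simp only [Function.update_of_ne h]; fun_prop
  refine ⟨hmeas, ?_⟩
  rw [volume_restrict_box]
  symm
  refine Measure.pi_eq fun s hs => ?_
  rw [Measure.map_apply hmeas (MeasurableSet.univ_pi hs)]
  have : (fun q : (Fin n → ℝ) × ℝ => Function.update q.1 j q.2) ⁻¹' (Set.pi univ s) =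
      (Set.pi univ (Function.update s j univ)) ×ˢ s j := by
    ext ⟨y, t⟩
    simp only [mem_preimage, Set.mem_pi, mem_univ, true_implies, mem_prod]
    constructor
    · intro h
      refine ⟨fun i => ?_, by simpa using h j⟩
      rcases eq_or_ne i j with rfl | hij
      · simp
      · simpa [Function.update_of_ne hij] using h i
    · rintro ⟨h1, h2⟩ i
      rcases eq_or_ne i j with rfl | hij
      · simpa using h2
      · simpa [Function.update_of_ne hij] using h1 i
  rw [this, Measure.prod_prod, Measure.pi_pi, ← Finset.prod_erase_mul _ _ (Finset.mem_univ j),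
    ← Finset.prod_erase_mul (Finset.univ) (fun i => (volume.restrict (Ioc (0 : ℝ) 1)) (s i))
      (Finset.mem_univ j)]
  simp only [Function.update_self]
  rw [show (volume.restrict (Ioc (0 : ℝ) 1)) univ = 1 from measure_univ, mul_one]
  congr 1
  refine Finset.prod_congr rfl fun i hi => ?_
  rw [Function.update_of_ne (Finset.ne_of_mem_erase hi)]

theorem integral_chartMeasure_slice (j : Fin n) {F : (Fin n → ℝ) × (Fin n → ℝ) → ℂ}
    (hF : Integrable F (chartMeasure n)) :
    ∫ p, F p ∂(chartMeasure n) = ∫ w, ∫ y in box n, ∫ t in Ioc (0 : ℝ) 1,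
      F (Function.update y j t, w) := by
  unfold chartMeasure at *
  rw [integral_prod_symm F hF]
  refine integral_congr_ae ?_
  filter_upwards [hF.prod_left_ae] with w hw
  have hmp := measurePreserving_update j
  have hw' := hw
  rw [← hmp.map_eq] at hw
  have h1 := integral_map hmp.aemeasurable hw.aestronglyMeasurable
  rw [hmp.map_eq] at h1
  rw [h1]
  exact integral_prod _ (hmp.integrable_comp_of_integrable hw')

theorem monWeight_update (l b : Fin n → ℕ) (s : ℂ) (y : Fin n → ℝ) (j : Fin n) (t : ℝ) :
    monWeight l b s (Function.update y j t) = (t : ℂ) ^ ((l j : ℂ) * s + b j - 1) *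
      monWeight (Function.update l j 0) (Function.update b j 1) s y := by
  unfold monWeight
  rw [← Finset.mul_prod_erase _ _ (Finset.mem_univ j),
    ← Finset.mul_prod_erase Finset.univ
      (fun i => (y i : ℂ) ^ ((Function.update l j 0 i : ℂ) * s + (Function.update b j 1 i : ℂ) - 1))
      (Finset.mem_univ j)]
  simp only [Function.update_self]
  rw [show ((0 : ℕ) : ℂ) * s + ((1 : ℕ) : ℂ) - 1 = 0 by push_cast; ring, Complex.cpow_zero, one_mul]
  congr 1
  refine Finset.prod_congr rfl fun i hi => ?_
  have := Finset.ne_of_mem_erase hi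
  simp [Function.update_of_ne this]

theorem re_exponent_ge_one (a : ℕ) {b : ℕ} (hb : 1 ≤ b) {s : ℂ} (hs : 0 < s.re) :
    1 ≤ ((a : ℂ) * s + b).re := by
  have h1 : (1 : ℝ) ≤ b := by exact_mod_cast hb
  have : 0 ≤ (a : ℝ) * s.re := by positivity
  simp
  linarith

theorem monWeight_parts_slice (j : Fin n) {l b : Fin n → ℕ} (hb : 1 ≤ b j) {s : ℂ}
    (hs : 0 < s.re) {G G' : (Fin n → ℝ) → ℂ} (hG : Continuous G) (hG' : Continuous G')
    (y : Fin n → ℝ)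
    (hd : ∀ t, HasDerivAt (fun t => G (Function.update y j t)) (G' (Function.update y j t)) t) :
    ∫ t in Ioc (0 : ℝ) 1, ((l j : ℂ) * s + b j) *
      (monWeight l b s (Function.update y j t) * G (Function.update y j t)) =
      ∫ t in Ioc (0 : ℝ) 1, (monWeight (Function.update l j 0) (Function.update b j 1) s
        (Function.update y j t) * (G (Function.update y j t) +
          (Function.update y j t j : ℝ) * G' (Function.update y j t)) -
      monWeight l (Function.update b j (b j + 1)) s (Function.update y j t) *
        G' (Function.update y j t)) := by
  have hu : Continuous fun t : ℝ => Function.update y j t := continuous_const.update j continuous_id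
  have hre := re_exponent_ge_one (l j) hb hs
  have key := integral_cpow_mul_by_parts hre (hG.comp hu) (hG'.comp hu) hd
  simp only [Function.comp_apply] at key
  have hcu : Continuous fun t : ℝ => G (Function.update y j t) := hG.comp hu
  have hcu' : Continuous fun t : ℝ => G' (Function.update y j t) := hG'.comp hu
  have hc1 : Continuous fun t : ℝ => G (Function.update y j t) +
      (t : ℂ) * G' (Function.update y j t) := hcu.add (Complex.continuous_ofReal.mul hcu')
  have hc2 : Continuous fun t : ℝ => (t : ℂ) ^ ((l j : ℂ) * s + b j) *
      G' (Function.update y j t) :=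
    (Complex.continuous_ofReal_cpow_const (by linarith)).mul hcu'
  rw [← integral_sub (hc1.integrableOn_Icc.mono_set Ioc_subset_Icc_self)
    (hc2.integrableOn_Icc.mono_set Ioc_subset_Icc_self)] at key
  simp only [monWeight_update, Function.update_self, Function.update_idem]
  generalize monWeight (Function.update l j 0) (Function.update b j 1) s y = W
  have e1 : ∀ t : ℝ, ((l j : ℂ) * s + b j) *
      ((t : ℂ) ^ ((l j : ℂ) * s + b j - 1) * W * G (Function.update y j t)) =
      W * (((l j : ℂ) * s + b j) *
        ((t : ℂ) ^ ((l j : ℂ) * s + b j - 1) * G (Function.update y j t))) := fun t => by ring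
  have e2 : ∀ t : ℝ, (t : ℂ) ^ (((0 : ℕ) : ℂ) * s + ((1 : ℕ) : ℂ) - 1) * W *
      (G (Function.update y j t) + t * G' (Function.update y j t)) -
      (t : ℂ) ^ ((l j : ℂ) * s + ((b j + 1 : ℕ) : ℂ) - 1) * W * G' (Function.update y j t) =
      W * ((G (Function.update y j t) + t * G' (Function.update y j t)) -
        (t : ℂ) ^ ((l j : ℂ) * s + b j) * G' (Function.update y j t)) := fun t => by
    rw [show ((0 : ℕ) : ℂ) * s + ((1 : ℕ) : ℂ) - 1 = 0 by push_cast; ring, Complex.cpow_zero,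
      show (l j : ℂ) * s + ((b j + 1 : ℕ) : ℂ) - 1 = l j * s + b j by push_cast; ring]
    ring
  simp only [e1, e2, integral_const_mul]
  rw [key]

theorem monWeight_parts (j : Fin n) {l b : Fin n → ℕ} (hb : ∀ j, 1 ≤ b j) {s : ℂ}
    (hs : 0 < s.re) {G G' : (Fin n → ℝ) × (Fin n → ℝ) → ℂ} (hG : Continuous G)
    (hGc : HasCompactSupport G) (hG' : Continuous G') (hGc' : HasCompactSupport G')
    (hd : ∀ y w t, HasDerivAt (fun t => G (Function.update y j t, w))
      (G' (Function.update y j t, w)) t) :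
    ((l j : ℂ) * s + b j) * ∫ p, monWeight l b s p.1 * G p ∂(chartMeasure n) =
      (∫ p, monWeight (Function.update l j 0) (Function.update b j 1) s p.1 *
        (G p + (p.1 j : ℝ) * G' p) ∂(chartMeasure n)) -
      ∫ p, monWeight l (Function.update b j (b j + 1)) s p.1 * G' p ∂(chartMeasure n) := by
  have hs0 : -((0 : ℕ) : ℝ) < s.re := by simpa using hs
  have hup : ∀ c, 1 ≤ c → ∀ i, 1 ≤ Function.update b j c i := by
    intro c hc i
    rcases eq_or_ne i j with rfl | h
    · simpa using hc
    · simpa [Function.update_of_ne h] using hb i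
  have i1 := integrable_monWeight_mul (M := 0) (l := l) (b := b) (by simpa using hb) hs0 hG hGc
  have hy : Continuous fun p : (Fin n → ℝ) × (Fin n → ℝ) => ((p.1 j : ℝ) : ℂ) := by fun_prop
  have hG2 : Continuous fun p => G p + (p.1 j : ℝ) * G' p := hG.add (hy.mul hG')
  have hG2c : HasCompactSupport fun p => G p + (p.1 j : ℝ) * G' p :=
    HasCompactSupport.add hGc (HasCompactSupport.mul_left
      (f := fun p : (Fin n → ℝ) × (Fin n → ℝ) => ((p.1 j : ℝ) : ℂ)) hGc')
  have i2 := integrable_monWeight_mul (M := 0) (l := Function.update l j 0)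
    (b := Function.update b j 1) (fun i => by rw [mul_zero]; exact hup 1 le_rfl i) hs0 hG2 hG2c
  have i3 := integrable_monWeight_mul (M := 0) (l := l) (b := Function.update b j (b j + 1))
    (fun i => by rw [mul_zero]; exact hup (b j + 1) (by omega) i) hs0 hG' hGc'
  rw [← integral_sub i2 i3, ← integral_const_mul, integral_chartMeasure_slice j (i1.const_mul _)]
  refine Eq.trans ?_ (integral_chartMeasure_slice j (i2.sub i3)).symm
  refine integral_congr_ae (Eventually.of_forall fun w => ?_)
  refine integral_congr_ae (Eventually.of_forall fun y => ?_)
  have hw : Continuous fun y : Fin n → ℝ => (y, w) := by fun_prop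
  exact monWeight_parts_slice j (hb j) hs (hG.comp hw) (hG'.comp hw) y (hd y w)

end Parts

section Dir

variable {E F : Type*} [NormedAddCommGroup E] [NormedSpace ℝ E] [NormedAddCommGroup F]
  [NormedSpace ℝ F]

/-- The directional derivative of `f` in direction `v`. -/
noncomputable def dirD (v : E) (f : E → F) (x : E) : F := fderiv ℝ f x v

theorem contDiff_dirD {f : E → F} (hf : ContDiff ℝ (⊤ : ℕ∞) f) (v : E) :
    ContDiff ℝ (⊤ : ℕ∞) (dirD v f) := by
  have h : ContDiff ℝ (⊤ : ℕ∞) (fderiv ℝ f) := hf.fderiv_right (by norm_cast)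
  exact h.clm_apply contDiff_const

theorem hasLineDerivAt_dirD {f : E → F} (hf : ContDiff ℝ (⊤ : ℕ∞) f) (v x : E) :
    HasLineDerivAt ℝ f (dirD v f x) x v :=
  ((hf.differentiable (by simp)) x).hasFDerivAt.hasLineDerivAt v

theorem contDiff_of_tsupport' {f : E → F} {k : WithTop ℕ∞}
    (h : ∀ x ∈ tsupport f, ContDiffAt ℝ k f x) : ContDiff ℝ k f := by
  rw [contDiff_iff_contDiffAt]
  intro x
  by_cases hx : x ∈ tsupport f
  · exact h x hx
  · exact contDiffAt_const.congr_of_eventuallyEq (notMem_tsupport_iff_eventuallyEq.1 hx)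

end Dir

section Amp

variable {Ω : Set ((Fin n → ℝ) × (Fin n → ℝ))} {Θ Θ' : (Fin n → ℝ) × (Fin n → ℝ) → ℂ}
  {g : (Fin n → ℝ) × (Fin n → ℝ) → ℝ}

theorem IsAmp.ofReal_mul {u : (Fin n → ℝ) × (Fin n → ℝ) → ℝ} (hΘ : IsAmp Ω Θ)
    (hu : ∀ p ∈ Ω, ContDiffAt ℝ (⊤ : ℕ∞) u p) : IsAmp Ω fun p => (u p : ℂ) * Θ p := by
  have hsub : tsupport (fun p => (u p : ℂ) * Θ p) ⊆ tsupport Θ :=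
    tsupport_mul_subset_right
  refine ⟨contDiff_of_tsupport' fun p hp => ?_, hΘ.2.1.mul_left, hsub.trans hΘ.2.2⟩
  have h1 := hu p (hΘ.2.2 (hsub hp))
  exact (Complex.ofRealCLM.contDiff.contDiffAt.comp p h1).mul hΘ.1.contDiffAt

theorem IsAmp.ofReal_mul' {u : (Fin n → ℝ) × (Fin n → ℝ) → ℝ} (hΘ : IsAmp Ω Θ)
    (hu : ContDiff ℝ (⊤ : ℕ∞) u) : IsAmp Ω fun p => (u p : ℂ) * Θ p :=
  hΘ.ofReal_mul fun _ _ => hu.contDiffAt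

theorem IsAmp.add (hΘ : IsAmp Ω Θ) (hΘ' : IsAmp Ω Θ') : IsAmp Ω fun p => Θ p + Θ' p :=
  ⟨hΘ.1.add hΘ'.1, hΘ.2.1.add hΘ'.2.1,
    (tsupport_add Θ Θ').trans (union_subset hΘ.2.2 hΘ'.2.2)⟩

theorem IsAmp.zero : IsAmp Ω fun _ => 0 :=
  ⟨contDiff_const, HasCompactSupport.zero, by
    rw [show tsupport (fun _ : (Fin n → ℝ) × (Fin n → ℝ) => (0 : ℂ)) = ∅ from
      tsupport_eq_empty_iff.2 rfl]; exact empty_subset _⟩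

theorem IsAmp.sum {ι : Type*} {Θ : ι → (Fin n → ℝ) × (Fin n → ℝ) → ℂ} (t : Finset ι)
    (h : ∀ i ∈ t, IsAmp Ω (Θ i)) : IsAmp Ω fun p => ∑ i ∈ t, Θ i p := by
  classical
  induction t using Finset.induction_on with
  | empty => simpa using IsAmp.zero
  | insert a t ha ih =>
    simp only [Finset.sum_insert ha]
    exact (h a (Finset.mem_insert_self _ _)).add
      (ih fun i hi => h i (Finset.mem_insert_of_mem hi))

theorem IsAmp.dirD (hΘ : IsAmp Ω Θ) (v : (Fin n → ℝ) × (Fin n → ℝ)) : IsAmp Ω (dirD v Θ) :=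
  ⟨contDiff_dirD hΘ.1 v, hΘ.2.1.fderiv_apply ℝ v,
    (tsupport_fderiv_apply_subset ℝ v).trans hΘ.2.2⟩

theorem hasLineDerivAt_posPow_mul (hg : ContDiff ℝ (⊤ : ℕ∞) g) (hΘ : ContDiff ℝ (⊤ : ℕ∞) Θ)
    {s : ℂ} (hs : 0 < s.re) (v p : (Fin n → ℝ) × (Fin n → ℝ)) :
    HasLineDerivAt ℝ (fun p => posPow (s + 1) (g p) * Θ p)
      ((s + 1) * (posPow s (g p) * (((dirD v g p : ℝ) : ℂ) * Θ p)) +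
        posPow (s + 1) (g p) * dirD v Θ p) p v := by
  have h1 : HasDerivAt (fun t : ℝ => g (p + t • v)) (dirD v g p) 0 := hasLineDerivAt_dirD hg v p
  have h2 : HasDerivAt (fun t : ℝ => Θ (p + t • v)) (dirD v Θ p) 0 := hasLineDerivAt_dirD hΘ v p
  have h3 := HasDerivAt.scomp (0 : ℝ) (hasDerivAt_posPow hs (g (p + (0 : ℝ) • v))) h1
  have h4 := h3.mul h2
  refine HasDerivAt.congr_deriv h4 ?_
  simp
  ring

theorem hasDerivAt_update_of_hasLineDerivAt {G G' : (Fin n → ℝ) × (Fin n → ℝ) → ℂ} (j : Fin n)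
    (h : ∀ p, HasLineDerivAt ℝ G (G' p) p (Pi.single j 1, 0)) (y w : Fin n → ℝ) (t : ℝ) :
    HasDerivAt (fun t => G (Function.update y j t, w)) (G' (Function.update y j t, w)) t := by
  have h1 : HasDerivAt (fun u : ℝ => G ((Function.update y j t, w) + u • (Pi.single j 1, 0)))
    (G' (Function.update y j t, w)) (t - t) := by rw [sub_self]; exact h _
  have h2 := HasDerivAt.comp_sub_const t t h1
  refine h2.congr_of_eventuallyEq (Eventually.of_forall fun u => ?_)
  simp only
  congr 1
  ext i
  · rcases eq_or_ne i j with rfl | hij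
    · simp
    · simp [Function.update_of_ne hij, Pi.single_eq_of_ne hij]
  · simp

theorem integral_monWeight_lineDeriv_eq_zero {l b : Fin n → ℕ} (hb : ∀ j, 1 ≤ b j) {s : ℂ}
    (hs : 0 < s.re) {v : Fin n → ℝ} {G G' : (Fin n → ℝ) × (Fin n → ℝ) → ℂ} (hG : Continuous G)
    (hGc : HasCompactSupport G) (hG' : Continuous G') (hGc' : HasCompactSupport G')
    (hd : ∀ p, HasLineDerivAt ℝ G (G' p) p (0, v)) :
    ∫ p, monWeight l b s p.1 * G' p ∂(chartMeasure n) = 0 := by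
  have hs0 : -((0 : ℕ) : ℝ) < s.re := by simpa using hs
  have i1 := integrable_monWeight_mul (M := 0) (l := l) (b := b) (by simpa using hb) hs0 hG' hGc'
  unfold chartMeasure at *
  rw [integral_prod _ i1]
  refine integral_eq_zero_of_ae (Eventually.of_forall fun y => ?_)
  simp only [integral_const_mul]
  have hcl : Topology.IsClosedEmbedding fun w : Fin n → ℝ => (y, w) :=
    ⟨isEmbedding_prodMkRight y, by
      rw [show range (fun w : Fin n → ℝ => (y, w)) = {y} ×ˢ univ by ext ⟨a, c⟩; simp [eq_comm]]
      exact isClosed_singleton.prod isClosed_univ⟩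
  have hw : Continuous fun w : Fin n → ℝ => (y, w) := hcl.continuous
  have j1 : Integrable (fun w => G (y, w)) :=
    (hG.comp hw).integrable_of_hasCompactSupport (hGc.comp_isClosedEmbedding hcl)
  have j2 : Integrable (fun w => G' (y, w)) :=
    (hG'.comp hw).integrable_of_hasCompactSupport (hGc'.comp_isClosedEmbedding hcl)
  have := integral_bilinear_hasLineDerivAt_right_eq_neg_left_of_integrable
    (μ := (volume : Measure (Fin n → ℝ))) (f := fun w => G (y, w)) (f' := fun w => G' (y, w))
    (g := fun _ => (1 : ℂ)) (g' := fun _ => (0 : ℂ)) (v := v) (B := ContinuousLinearMap.mul ℝ ℂ)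
    (by simpa using j2) (by simp) (by simpa using j1) (fun w _ => ?_)
    (fun w _ => hasDerivAt_const _ _)
  · simp only [ContinuousLinearMap.mul_apply', mul_zero, mul_one, integral_zero] at this
    rw [neg_eq_zero.1 this.symm, mul_zero]; rfl
  · have h := hd (y, w)
    unfold HasLineDerivAt at *
    simpa using h

/-- The set where the gradient in the second variable does not vanish. -/
def regularSet (g : (Fin n → ℝ) × (Fin n → ℝ) → ℝ) : Set ((Fin n → ℝ) × (Fin n → ℝ)) :=
  {p | ∃ i, dirD ((0 : Fin n → ℝ), (Pi.single i 1 : Fin n → ℝ)) g p ≠ 0}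

/-- The squared norm of the gradient in the second variable. -/
noncomputable def gradSq (g : (Fin n → ℝ) × (Fin n → ℝ) → ℝ) (p : (Fin n → ℝ) × (Fin n → ℝ)) : ℝ :=
  ∑ i, (dirD ((0 : Fin n → ℝ), (Pi.single i 1 : Fin n → ℝ)) g p) ^ 2

theorem gradSq_ne_zero {p : (Fin n → ℝ) × (Fin n → ℝ)} (hp : p ∈ regularSet g) :
    gradSq g p ≠ 0 := by
  obtain ⟨i, hi⟩ := hp
  have : 0 < gradSq g p :=
    Finset.sum_pos' (fun _ _ => sq_nonneg _) ⟨i, Finset.mem_univ _, by positivity⟩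
  exact this.ne'

theorem contDiff_gradSq (hg : ContDiff ℝ (⊤ : ℕ∞) g) : ContDiff ℝ (⊤ : ℕ∞) (gradSq g) :=
  ContDiff.sum fun _ _ => (contDiff_dirD hg _).pow 2

/-- The transposed vector field used to integrate by parts in the second variable. -/
noncomputable def adjField (g : (Fin n → ℝ) × (Fin n → ℝ) → ℝ)
    (Θ : (Fin n → ℝ) × (Fin n → ℝ) → ℂ) (p : (Fin n → ℝ) × (Fin n → ℝ)) : ℂ :=
  ∑ i, dirD ((0 : Fin n → ℝ), (Pi.single i 1 : Fin n → ℝ)) (fun p =>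
    ((-(dirD ((0 : Fin n → ℝ), (Pi.single i 1 : Fin n → ℝ)) g p / gradSq g p) : ℝ) : ℂ) * Θ p) p

theorem IsAmp.adjField_summand (hg : ContDiff ℝ (⊤ : ℕ∞) g) (hΘ : IsAmp (regularSet g) Θ)
    (i : Fin n) : IsAmp (regularSet g) fun p =>
      ((-(KN.dirD ((0 : Fin n → ℝ), (Pi.single i 1 : Fin n → ℝ)) g p / gradSq g p) : ℝ) : ℂ) *
        Θ p :=
  hΘ.ofReal_mul fun _ hp => ((contDiff_dirD hg _).contDiffAt.div
    (contDiff_gradSq hg).contDiffAt (gradSq_ne_zero hp)).neg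

theorem IsAmp.adjField (hg : ContDiff ℝ (⊤ : ℕ∞) g) (hΘ : IsAmp (regularSet g) Θ) :
    IsAmp (regularSet g) (adjField g Θ) :=
  IsAmp.sum _ fun i _ => (hΘ.adjField_summand hg i).dirD _

theorem IsAmp.integrable (hg : ContDiff ℝ (⊤ : ℕ∞) g) (hΘ : IsAmp Ω Θ) {l b : Fin n → ℕ}
    (hb : ∀ j, 1 ≤ b j) {s : ℂ} (hs : 0 < s.re) {z : ℂ} (hz : 0 < z.re) :
    Integrable (fun p => monWeight l b s p.1 * (posPow z (g p) * Θ p)) (chartMeasure n) :=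
  integrable_monWeight_mul (M := 0) (by simpa using hb) (by simpa using hs)
    (continuous_posPow_mul hg.continuous hΘ.1.continuous hz) hΘ.2.1.mul_left

theorem re_add_nat_pos {s : ℂ} (hs : 0 < s.re) (k : ℕ) : 0 < (s + k).re := by
  simp; positivity

theorem chartInt_gradient_parts (hg : ContDiff ℝ (⊤ : ℕ∞) g) (hΘ : IsAmp (regularSet g) Θ)
    {l b : Fin n → ℕ} (hb : ∀ j, 1 ≤ b j) (k : ℕ) {s : ℂ} (hs : 0 < s.re) :
    (s + (k + 1 : ℕ)) * chartInt g l b k Θ s = chartInt g l b (k + 1) (adjField g Θ) s := by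
  have hk := re_add_nat_pos hs k
  have hk1 := re_add_nat_pos hs (k + 1)
  have hcast : s + ((k + 1 : ℕ) : ℂ) = s + k + 1 := by push_cast; ring
  set A : Fin n → (Fin n → ℝ) × (Fin n → ℝ) → ℂ := fun i p =>
      ((-(dirD ((0 : Fin n → ℝ), (Pi.single i 1 : Fin n → ℝ)) g p / gradSq g p) : ℝ) : ℂ) * Θ p
    with hA
  have hAamp : ∀ i, IsAmp (regularSet g) (A i) := hΘ.adjField_summand hg
  set v : Fin n → (Fin n → ℝ) × (Fin n → ℝ) := fun i => (0, Pi.single i 1) with hv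
  have hB : ∀ i, IsAmp (regularSet g) fun p => ((dirD (v i) g p : ℝ) : ℂ) * A i p := fun i =>
    (hAamp i).ofReal_mul' (contDiff_dirD hg _)
  have hzero : ∀ i, (s + (k + 1 : ℕ)) * (∫ p, monWeight l b s p.1 *
      (posPow (s + k) (g p) * (((dirD (v i) g p : ℝ) : ℂ) * A i p)) ∂(chartMeasure n)) +
      (∫ p, monWeight l b s p.1 * (posPow (s + (k + 1 : ℕ)) (g p) * dirD (v i) (A i) p)
        ∂(chartMeasure n)) = 0 := by
    intro i
    rw [← integral_const_mul, ← integral_add (((hB i).integrable hg hb hs hk).const_mul _)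
      (((hAamp i).dirD (v i)).integrable hg hb hs hk1), hcast]
    refine Eq.trans ?_ (integral_monWeight_lineDeriv_eq_zero (l := l) hb hs
      (G := fun p => posPow (s + k + 1) (g p) * A i p)
      (G' := fun p => (s + k + 1) * (posPow (s + k) (g p) * (((dirD (v i) g p : ℝ) : ℂ) * A i p)) +
        posPow (s + k + 1) (g p) * dirD (v i) (A i) p) ?_ ?_ ?_ ?_
      (hasLineDerivAt_posPow_mul hg (hAamp i).1 hk (v i)))
    · congr 1
      ext p
      ring
    · exact continuous_posPow_mul hg.continuous (hAamp i).1.continuous (hcast ▸ hk1)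
    · exact (hAamp i).2.1.mul_left
    · exact (continuous_const.mul (continuous_posPow_mul hg.continuous (hB i).1.continuous hk)).add
        (continuous_posPow_mul hg.continuous ((hAamp i).dirD (v i)).1.continuous (hcast ▸ hk1))
    · exact HasCompactSupport.add (HasCompactSupport.mul_left (HasCompactSupport.mul_left
        (hB i).2.1)) (HasCompactSupport.mul_left ((hAamp i).dirD (v i)).2.1)
  have hsum := Finset.sum_eq_zero (s := Finset.univ) fun i _ => hzero i
  rw [Finset.sum_add_distrib, ← Finset.mul_sum,
    ← integral_finsetSum _ (fun i _ => (hB i).integrable hg hb hs hk),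
    ← integral_finsetSum _ (fun i _ => ((hAamp i).dirD (v i)).integrable hg hb hs hk1)] at hsum
  have e1 : ∀ p, ∑ i, monWeight l b s p.1 *
      (posPow (s + k) (g p) * (((dirD (v i) g p : ℝ) : ℂ) * A i p)) =
      -(monWeight l b s p.1 * (posPow (s + k) (g p) * Θ p)) := by
    intro p
    rw [← Finset.mul_sum, ← Finset.mul_sum]
    have : ∑ i, ((dirD (v i) g p : ℝ) : ℂ) * A i p = -Θ p := by
      by_cases hp : Θ p = 0
      · simp [hA, hp]
      have hQ := gradSq_ne_zero (hΘ.2.2 (subset_tsupport _ hp))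
      have : ∀ i, ((dirD (v i) g p : ℝ) : ℂ) * A i p =
          ((dirD (v i) g p ^ 2 : ℝ) : ℂ) * (-(Θ p) / (gradSq g p : ℂ)) := fun i => by
        simp only [hA, hv]; push_cast; ring
      simp only [this]
      rw [← Finset.sum_mul, ← Complex.ofReal_sum]
      have hQ' : (gradSq g p : ℂ) ≠ 0 := by exact_mod_cast hQ
      rw [show ∑ i, dirD (v i) g p ^ 2 = gradSq g p from rfl]
      field_simp
    rw [this]; ring
  have e2 : ∀ p, ∑ i, monWeight l b s p.1 *
      (posPow (s + (k + 1 : ℕ)) (g p) * dirD (v i) (A i) p) =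
      monWeight l b s p.1 * (posPow (s + (k + 1 : ℕ)) (g p) * adjField g Θ p) := by
    intro p
    rw [← Finset.mul_sum, ← Finset.mul_sum]
    rfl
  simp only [e1, e2, integral_neg] at hsum
  unfold chartInt
  linear_combination -hsum

theorem chartInt_monomial_parts (hg : ContDiff ℝ (⊤ : ℕ∞) g) (hΘ : IsAmp Ω Θ)
    {l b : Fin n → ℕ} (hb : ∀ j, 1 ≤ b j) (j : Fin n) (k : ℕ) {s : ℂ} (hs : 0 < s.re) :
    ((l j : ℂ) * s + b j) * chartInt g l b (k + 1) Θ s =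
      (chartInt g (Function.update l j 0) (Function.update b j 1) (k + 1)
        (fun p => Θ p + (p.1 j : ℝ) * dirD (Pi.single j 1, 0) Θ p) s +
      (s + (k + 1 : ℕ)) * chartInt g (Function.update l j 0) (Function.update b j 1) k
        (fun p => (p.1 j : ℝ) * ((dirD (Pi.single j 1, 0) g p : ℝ) * Θ p)) s) -
      (chartInt g l (Function.update b j (b j + 1)) (k + 1) (dirD (Pi.single j 1, 0) Θ) s +
      (s + (k + 1 : ℕ)) * chartInt g l (Function.update b j (b j + 1)) k
        (fun p => (dirD (Pi.single j 1, 0) g p : ℝ) * Θ p) s) := by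
  have hk := re_add_nat_pos hs k
  have hk1 := re_add_nat_pos hs (k + 1)
  have hcast : s + ((k + 1 : ℕ) : ℂ) = s + k + 1 := by push_cast; ring
  set v : (Fin n → ℝ) × (Fin n → ℝ) := (Pi.single j 1, 0) with hv
  have hup : ∀ c, 1 ≤ c → ∀ i, 1 ≤ Function.update b j c i := by
    intro c hc i
    rcases eq_or_ne i j with rfl | h
    · simpa using hc
    · simpa [Function.update_of_ne h] using hb i
  have hy : ContDiff ℝ (⊤ : ℕ∞) fun p : (Fin n → ℝ) × (Fin n → ℝ) => p.1 j := by fun_prop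
  have hg1 : IsAmp Ω fun p => ((dirD v g p : ℝ) : ℂ) * Θ p := hΘ.ofReal_mul' (contDiff_dirD hg _)
  have hg2 : IsAmp Ω fun p => ((p.1 j : ℝ) : ℂ) * (((dirD v g p : ℝ) : ℂ) * Θ p) :=
    hg1.ofReal_mul' hy
  have hd1 : IsAmp Ω (dirD v Θ) := hΘ.dirD v
  have hd2 : IsAmp Ω fun p => Θ p + ((p.1 j : ℝ) : ℂ) * dirD v Θ p := hΘ.add (hd1.ofReal_mul' hy)
  have key := monWeight_parts j (l := l) hb hs
    (G := fun p => posPow (s + k + 1) (g p) * Θ p)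
    (G' := fun p => (s + k + 1) * (posPow (s + k) (g p) * (((dirD v g p : ℝ) : ℂ) * Θ p)) +
        posPow (s + k + 1) (g p) * dirD v Θ p)
    (continuous_posPow_mul hg.continuous hΘ.1.continuous (hcast ▸ hk1)) hΘ.2.1.mul_left
    ((continuous_const.mul (continuous_posPow_mul hg.continuous hg1.1.continuous hk)).add
      (continuous_posPow_mul hg.continuous hd1.1.continuous (hcast ▸ hk1)))
    (HasCompactSupport.add (HasCompactSupport.mul_left (HasCompactSupport.mul_left hg1.2.1))
      (HasCompactSupport.mul_left hd1.2.1))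
    (hasDerivAt_update_of_hasLineDerivAt j (hasLineDerivAt_posPow_mul hg hΘ.1 hk v))
  unfold chartInt
  rw [hcast, key]
  rw [← hcast]
  congr 1
  · rw [← integral_const_mul, ← integral_add (hd2.integrable hg (hup 1 le_rfl) hs hk1)
      ((hg2.integrable hg (hup 1 le_rfl) hs hk).const_mul _)]
    congr 1
    ext p
    ring
  · rw [← integral_const_mul, ← integral_add (hd1.integrable hg (hup (b j + 1) (by omega)) hs hk1)
      ((hg1.integrable hg (hup (b j + 1) (by omega)) hs hk).const_mul _)]
    congr 1
    ext p
    ring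

end Amp

/-- The half plane `Re s > -M`. -/
def halfPlane (M : ℕ) : Set ℂ := {s | -(M : ℝ) < s.re}

theorem isOpen_halfPlane (M : ℕ) : IsOpen (halfPlane M) :=
  isOpen_lt continuous_const Complex.continuous_re

theorem pos_mem_halfPlane (M : ℕ) {s : ℂ} (hs : 0 < s.re) : s ∈ halfPlane M :=
  lt_of_le_of_lt (by simp) hs

/-- `D * F` extends from `Re s > 0` to a holomorphic function on `Re s > -M`. -/
def ExtBy (M : ℕ) (D F : ℂ → ℂ) : Prop :=
  ∃ h, DifferentiableOn ℂ h (halfPlane M) ∧ ∀ s : ℂ, 0 < s.re → D s * F s = h s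

theorem ExtBy.add {M : ℕ} {D F₁ F₂ : ℂ → ℂ} (h₁ : ExtBy M D F₁) (h₂ : ExtBy M D F₂) :
    ExtBy M D fun s => F₁ s + F₂ s := by
  obtain ⟨a, ha, ha'⟩ := h₁
  obtain ⟨b, hb, hb'⟩ := h₂
  exact ⟨fun s => a s + b s, ha.add hb, fun s hs => by
    simp only [mul_add, ha' s hs, hb' s hs]⟩

theorem ExtBy.mul {M : ℕ} {D F u : ℂ → ℂ} (h : ExtBy M D F) (hu : Differentiable ℂ u) :
    ExtBy M D fun s => u s * F s := by
  obtain ⟨a, ha, ha'⟩ := h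
  exact ⟨fun s => u s * a s, hu.differentiableOn.mul ha, fun s hs => by
    simp only [← ha' s hs]; ring⟩

theorem ExtBy.mul_left {M : ℕ} {D F u : ℂ → ℂ} (h : ExtBy M D F) (hu : Differentiable ℂ u) :
    ExtBy M (fun s => u s * D s) F := by
  obtain ⟨a, ha, ha'⟩ := h
  exact ⟨fun s => u s * a s, hu.differentiableOn.mul ha, fun s hs => by
    simp only [← ha' s hs]; ring⟩

/-- The product of the linear factors produced by integrating by parts in the monomial
variables. -/
noncomputable def polarProd (M : ℕ) (l b : Fin n → ℕ) (s : ℂ) : ℂ :=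
  ∏ j, ∏ c ∈ Finset.Ico (b j) (l j * M + 1), ((l j : ℂ) * s + c)

theorem differentiable_polarFactor (M a b : ℕ) :
    Differentiable ℂ fun s => ∏ c ∈ Finset.Ico b (a * M + 1), ((a : ℂ) * s + c) :=
  Differentiable.fun_finsetProd fun c _ => by fun_prop

theorem polarProd_eq_mul_erase (M : ℕ) (l b : Fin n → ℕ) (j : Fin n) (s : ℂ) :
    polarProd M l b s = (∏ c ∈ Finset.Ico (b j) (l j * M + 1), ((l j : ℂ) * s + c)) *
      polarProd M (Function.update l j 0) (Function.update b j 1) s := by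
  unfold polarProd
  rw [← Finset.mul_prod_erase _ _ (Finset.mem_univ j),
    ← Finset.mul_prod_erase Finset.univ (fun i => ∏ c ∈ Finset.Ico (Function.update b j 1 i)
      (Function.update l j 0 i * M + 1), ((Function.update l j 0 i : ℂ) * s + c))
      (Finset.mem_univ j)]
  simp only [Function.update_self, zero_mul, zero_add, Finset.Ico_self, Finset.prod_empty, one_mul]
  congr 1
  refine Finset.prod_congr rfl fun i hi => ?_
  have := Finset.ne_of_mem_erase hi
  simp only [Function.update_of_ne this]

theorem polarProd_eq_mul_succ (M : ℕ) (l b : Fin n → ℕ) (j : Fin n) (h : b j < l j * M + 1)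
    (s : ℂ) : polarProd M l b s = ((l j : ℂ) * s + b j) *
      polarProd M l (Function.update b j (b j + 1)) s := by
  rw [polarProd_eq_mul_erase M l b j, polarProd_eq_mul_erase M l (Function.update b j (b j + 1)) j,
    Finset.prod_eq_prod_Ico_succ_bot h]
  simp only [Function.update_self, Function.update_idem]
  ring

/-- Number of integrations by parts needed to reach the half plane `Re s > -M`. -/
def deficiency (M : ℕ) (l b : Fin n → ℕ) : ℕ := ∑ j, (l j * M + 1 - b j)

theorem deficiency_update_lt (M : ℕ) (l b : Fin n → ℕ) (j : Fin n) (h : b j < l j * M + 1)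
    (l' b' : ℕ) (h' : l' * M + 1 - b' < l j * M + 1 - b j) :
    deficiency M (Function.update l j l') (Function.update b j b') < deficiency M l b := by
  refine Finset.sum_lt_sum (fun i _ => ?_) ⟨j, Finset.mem_univ _, by simpa using h'⟩
  rcases eq_or_ne i j with rfl | hi
  · simpa using h'.le
  · simp [Function.update_of_ne hi]

section Claims

variable {Ω : Set ((Fin n → ℝ) × (Fin n → ℝ))} {g : (Fin n → ℝ) × (Fin n → ℝ) → ℝ}

theorem one_le_update {b : Fin n → ℕ} (hb : ∀ j, 1 ≤ b j) (j : Fin n) {c : ℕ} (hc : 1 ≤ c)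
    (i : Fin n) : 1 ≤ Function.update b j c i := by
  rcases eq_or_ne i j with rfl | h
  · simpa using hc
  · simpa [Function.update_of_ne h] using hb i

theorem extBy_chartInt (hg : ContDiff ℝ (⊤ : ℕ∞) g) (M t : ℕ) :
    ∀ (l b : Fin n → ℕ) (k : ℕ) (Θ : (Fin n → ℝ) × (Fin n → ℝ) → ℂ), (∀ j, 1 ≤ b j) →
      deficiency M l b ≤ t → M + t ≤ k → IsAmp Ω Θ →
      ExtBy M (polarProd M l b) (chartInt g l b k Θ) := by
  induction t with
  | zero =>
    intro l b k Θ hb hdef hk hΘ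
    have hb' : ∀ j, l j * M + 1 ≤ b j := by
      intro j
      have := Finset.sum_eq_zero_iff.1 (Nat.le_zero.1 hdef) j (Finset.mem_univ j)
      omega
    refine ⟨chartInt g l b k Θ, differentiableOn_chartInt hg.continuous hΘ.1.continuous hΘ.2.1 hb'
      hk, fun s _ => ?_⟩
    have : polarProd M l b s = 1 := by
      refine Finset.prod_eq_one fun j _ => ?_
      rw [Finset.Ico_eq_empty (by have := hb' j; omega), Finset.prod_empty]
    rw [this, one_mul]
  | succ t ih =>
    intro l b k Θ hb hdef hk hΘ
    by_cases hd : deficiency M l b ≤ t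
    · exact ih l b k Θ hb hd (by omega) hΘ
    obtain ⟨j, hj⟩ : ∃ j, b j < l j * M + 1 := by
      by_contra! hcon
      apply hd
      have : deficiency M l b = 0 := Finset.sum_eq_zero fun j _ => by have := hcon j; omega
      omega
    obtain ⟨k, rfl⟩ : ∃ k', k = k' + 1 := ⟨k - 1, by omega⟩
    have hy : ContDiff ℝ (⊤ : ℕ∞) fun p : (Fin n → ℝ) × (Fin n → ℝ) => p.1 j := by fun_prop
    set v : (Fin n → ℝ) × (Fin n → ℝ) := (Pi.single j 1, 0) with hv
    have hg1 : IsAmp Ω fun p => ((dirD v g p : ℝ) : ℂ) * Θ p :=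
      hΘ.ofReal_mul' (contDiff_dirD hg _)
    have hg2 : IsAmp Ω fun p => ((p.1 j : ℝ) : ℂ) * (((dirD v g p : ℝ) : ℂ) * Θ p) :=
      hg1.ofReal_mul' hy
    have hd1 : IsAmp Ω (dirD v Θ) := hΘ.dirD v
    have hd2 : IsAmp Ω fun p => Θ p + ((p.1 j : ℝ) : ℂ) * dirD v Θ p :=
      hΘ.add (hd1.ofReal_mul' hy)
    have hdef1 := deficiency_update_lt M l b j hj 0 1 (by omega)
    have hdef2 := deficiency_update_lt M l b j hj (l j) (b j + 1) (by omega)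
    rw [Function.update_eq_self] at hdef2
    have hb1 := one_le_update hb j le_rfl
    have hb2 := one_le_update hb j (c := b j + 1) (by omega)
    have A1 := ih (Function.update l j 0) _ (k + 1) _ hb1 (by omega) (by omega) hd2
    have A2 := ih (Function.update l j 0) _ k _ hb1 (by omega) (by omega) hg2
    have A3 := ih l _ (k + 1) _ hb2 (by omega) (by omega) hd1
    have A4 := ih l _ k _ hb2 (by omega) (by omega) hg1
    have hlin : Differentiable ℂ fun s : ℂ => s + ((k + 1 : ℕ) : ℂ) := by fun_prop
    have B1 := (A1.add (A2.mul hlin)).mul_left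
      (differentiable_polarFactor M (l j) (b j + 1))
    have B2 := (A3.add (A4.mul hlin)).mul (u := fun _ => -1) (differentiable_const _)
    have e : ∀ s, polarProd M l (Function.update b j (b j + 1)) s =
        (∏ c ∈ Finset.Ico (b j + 1) (l j * M + 1), ((l j : ℂ) * s + c)) *
        polarProd M (Function.update l j 0) (Function.update b j 1) s := fun s => by
      rw [polarProd_eq_mul_erase M l _ j]
      simp only [Function.update_self, Function.update_idem]
    simp only [← e] at B1
    obtain ⟨h, hh, hh'⟩ := B1.add B2
    refine ⟨h, hh, fun s hs => ?_⟩
    rw [← hh' s hs, polarProd_eq_mul_succ M l b j hj, mul_comm (_ * s + _), mul_assoc,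
      chartInt_monomial_parts hg hΘ hb j k hs]
    ring

theorem chartInt_gradient_parts_iterate (hg : ContDiff ℝ (⊤ : ℕ∞) g) {l b : Fin n → ℕ}
    (hb : ∀ j, 1 ≤ b j) (K : ℕ) {Θ : (Fin n → ℝ) × (Fin n → ℝ) → ℂ}
    (hΘ : IsAmp (regularSet g) Θ) : ∃ Θ', IsAmp (regularSet g) Θ' ∧ ∀ s : ℂ, 0 < s.re →
      (∏ i ∈ Finset.range K, (s + ((i + 1 : ℕ) : ℂ))) * chartInt g l b 0 Θ s =
        chartInt g l b K Θ' s := by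
  induction K with
  | zero => exact ⟨Θ, hΘ, fun s _ => by simp⟩
  | succ K ih =>
    obtain ⟨Θ', h1, h2⟩ := ih
    refine ⟨adjField g Θ', h1.adjField hg, fun s hs => ?_⟩
    rw [← chartInt_gradient_parts hg h1 hb K hs, ← h2 s hs, Finset.prod_range_succ]
    ring

theorem extBy_chartInt_zero (hg : ContDiff ℝ (⊤ : ℕ∞) g) (M : ℕ) {l b : Fin n → ℕ}
    (hb : ∀ j, 1 ≤ b j) {Θ : (Fin n → ℝ) × (Fin n → ℝ) → ℂ} (hΘ : IsAmp (regularSet g) Θ) :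
    ExtBy M (fun s => polarProd M l b s *
      ∏ i ∈ Finset.range (M + deficiency M l b), (s + ((i + 1 : ℕ) : ℂ))) (chartInt g l b 0 Θ) := by
  obtain ⟨Θ', h1, h2⟩ := chartInt_gradient_parts_iterate hg hb (M + deficiency M l b) hΘ
  obtain ⟨h, hh, hh'⟩ := extBy_chartInt hg M _ l b _ Θ' hb le_rfl le_rfl h1
  exact ⟨h, hh, fun s hs => by rw [mul_assoc, h2 s hs, hh' s hs]⟩

end Claims

section Pole

theorem PoleOrderAtMost.mono {G : ℂ → ℂ} {s₀ : ℂ} {p q : ℕ} (h : PoleOrderAtMost G s₀ p)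
    (hpq : p ≤ q) : PoleOrderAtMost G s₀ q := by
  obtain ⟨a, ha, ha'⟩ := h
  refine ⟨fun s => (s - s₀) ^ (q - p) * a s, by fun_prop, ?_⟩
  filter_upwards [ha'] with s hs
  rw [← hs, ← mul_assoc, ← pow_add, Nat.sub_add_cancel hpq]

theorem PoleOrderAtMost.add {G₁ G₂ : ℂ → ℂ} {s₀ : ℂ} {p : ℕ} (h₁ : PoleOrderAtMost G₁ s₀ p)
    (h₂ : PoleOrderAtMost G₂ s₀ p) : PoleOrderAtMost (fun s => G₁ s + G₂ s) s₀ p := by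
  obtain ⟨a, ha, ha'⟩ := h₁
  obtain ⟨b, hb, hb'⟩ := h₂
  refine ⟨fun s => a s + b s, ha.add hb, ?_⟩
  filter_upwards [ha', hb'] with s h1 h2
  rw [mul_add, h1, h2]

theorem PoleOrderAtMost.const_mul {G : ℂ → ℂ} {s₀ : ℂ} {p : ℕ} (h : PoleOrderAtMost G s₀ p)
    (c : ℂ) : PoleOrderAtMost (fun s => c * G s) s₀ p := by
  obtain ⟨a, ha, ha'⟩ := h
  refine ⟨fun s => c * a s, analyticAt_const.mul ha, ?_⟩
  filter_upwards [ha'] with s hs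
  rw [← hs]; ring

theorem PoleOrderAtMost.congr {G₁ G₂ : ℂ → ℂ} {s₀ : ℂ} {p : ℕ} (h : PoleOrderAtMost G₁ s₀ p)
    (he : G₁ =ᶠ[𝓝[≠] s₀] G₂) : PoleOrderAtMost G₂ s₀ p := by
  obtain ⟨a, ha, ha'⟩ := h
  refine ⟨a, ha, ?_⟩
  filter_upwards [ha', he] with s h1 h2
  rw [← h2, h1]

theorem PoleOrderAtMost.of_analyticAt {G : ℂ → ℂ} {s₀ : ℂ} (h : AnalyticAt ℂ G s₀) :
    PoleOrderAtMost G s₀ 0 := ⟨G, h, by simp⟩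

open Classical in
/-- Dividing by linear factors raises the pole order by at most the number of factors that
vanish. -/
theorem PoleOrderAtMost.div_prod {ι : Type*} (I : Finset ι) (α c : ι → ℂ)
    {G : ℂ → ℂ} {s₀ : ℂ} {p : ℕ} (h : PoleOrderAtMost G s₀ p)
    (hne : ∀ i ∈ I, α i * s₀ + c i = 0 → α i ≠ 0) :
    PoleOrderAtMost (fun s => G s / ∏ i ∈ I, (α i * s + c i)) s₀
      (p + (I.filter fun i => α i * s₀ + c i = 0).card) := by
  induction I using Finset.induction_on with
  | empty => simpa using h
  | insert i I hi ih =>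
    obtain ⟨a, ha, ha'⟩ := ih fun k hk => hne k (Finset.mem_insert_of_mem hk)
    by_cases hz : α i * s₀ + c i = 0
    · have hα := hne i (Finset.mem_insert_self _ _) hz
      rw [Finset.filter_insert, if_pos hz, Finset.card_insert_of_notMem (by simp [hi])]
      refine ⟨fun s => (α i)⁻¹ * a s, analyticAt_const.mul ha, ?_⟩
      filter_upwards [ha', self_mem_nhdsWithin] with s hs hs₀
      have hs₀' : s - s₀ ≠ 0 := sub_ne_zero.2 hs₀
      rw [← hs, Finset.prod_insert hi, show α i * s + c i = α i * (s - s₀) by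
        linear_combination hz, ← add_assoc, pow_succ]
      field_simp
    · rw [Finset.filter_insert, if_neg hz]
      refine ⟨fun s => (α i * s + c i)⁻¹ * a s, AnalyticAt.mul (AnalyticAt.inv (by fun_prop) hz) ha,
        ?_⟩
      filter_upwards [ha'] with s hs
      simp only [← hs, Finset.prod_insert hi, div_eq_mul_inv, mul_inv]
      ring

/-- `F` extends meromorphically to `Re s > -M` with poles in `P` and with pole order at most
`p` at `s₀`. -/
def MeroExt (M : ℕ) (P : Set ℂ) (s₀ : ℂ) (p : ℕ) (F : ℂ → ℂ) : Prop :=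
  ∃ G : ℂ → ℂ, MeromorphicOn G (halfPlane M) ∧ (∀ s : ℂ, 0 < s.re → G s = F s) ∧
    (∀ s ∈ halfPlane M, s ∉ P → AnalyticAt ℂ G s) ∧
    (s₀ ∈ halfPlane M → PoleOrderAtMost G s₀ p)

variable {M : ℕ} {P : Set ℂ} {s₀ : ℂ} {p : ℕ}

theorem MeroExt.add {F₁ F₂ : ℂ → ℂ} (h₁ : MeroExt M P s₀ p F₁) (h₂ : MeroExt M P s₀ p F₂) :
    MeroExt M P s₀ p fun s => F₁ s + F₂ s := by
  obtain ⟨G₁, a1, a2, a3, a4⟩ := h₁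
  obtain ⟨G₂, b1, b2, b3, b4⟩ := h₂
  exact ⟨fun s => G₁ s + G₂ s, a1.add b1, fun s hs => by
      simp only [a2 s hs, b2 s hs],
    fun s hs hP => (a3 s hs hP).add (b3 s hs hP), fun h => (a4 h).add (b4 h)⟩

theorem MeroExt.const_mul {F : ℂ → ℂ} (h : MeroExt M P s₀ p F) (c : ℂ) :
    MeroExt M P s₀ p fun s => c * F s := by
  obtain ⟨G, a1, a2, a3, a4⟩ := h
  exact ⟨fun s => c * G s, (MeromorphicOn.const c).mul a1, fun s hs => by
      simp only [a2 s hs],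
    fun s hs hP => analyticAt_const.mul (a3 s hs hP), fun h => (a4 h).const_mul c⟩

theorem MeroExt.zero : MeroExt M P s₀ p fun _ => 0 :=
  ⟨fun _ => 0, MeromorphicOn.const 0, fun _ _ => rfl, fun _ _ _ => analyticAt_const,
    fun _ => (PoleOrderAtMost.of_analyticAt analyticAt_const).mono (Nat.zero_le _)⟩

theorem MeroExt.sum {ι : Type*} (t : Finset ι) {F : ι → ℂ → ℂ}
    (h : ∀ i ∈ t, MeroExt M P s₀ p (F i)) : MeroExt M P s₀ p fun s => ∑ i ∈ t, F i s := by
  classical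
  induction t using Finset.induction_on with
  | empty => simpa using MeroExt.zero
  | insert a t ha ih =>
    simp only [Finset.sum_insert ha]
    exact (h a (Finset.mem_insert_self _ _)).add
      (ih fun i hi => h i (Finset.mem_insert_of_mem hi))

theorem MeroExt.mono {F : ℂ → ℂ} (h : MeroExt M P s₀ p F) {q : ℕ} (hpq : p ≤ q) :
    MeroExt M P s₀ q F := by
  obtain ⟨G, a1, a2, a3, a4⟩ := h
  exact ⟨G, a1, a2, a3, fun h => (a4 h).mono hpq⟩

theorem MeroExt.congr {F F' : ℂ → ℂ} (h : MeroExt M P s₀ p F)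
    (he : ∀ s : ℂ, 0 < s.re → F s = F' s) : MeroExt M P s₀ p F' := by
  obtain ⟨G, a1, a2, a3, a4⟩ := h
  exact ⟨G, a1, fun s hs => by rw [a2 s hs, he s hs], a3, a4⟩

open Classical in
theorem ExtBy.meroExt {ι : Type*} {I : Finset ι} {α c : ι → ℂ} {D F : ℂ → ℂ} (h : ExtBy M D F)
    (hD : ∀ s, D s = ∏ i ∈ I, (α i * s + c i))
    (hP : ∀ i ∈ I, ∀ s, α i * s + c i = 0 → s ∈ P)
    (hα : ∀ i ∈ I, α i ≠ 0)
    (hre : ∀ i ∈ I, ∀ s : ℂ, 0 < s.re → α i * s + c i ≠ 0)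
    (hp : (I.filter fun i => α i * s₀ + c i = 0).card ≤ p) : MeroExt M P s₀ p F := by
  obtain ⟨a, ha, ha'⟩ := h
  have han : ∀ s ∈ halfPlane M, AnalyticAt ℂ a s := fun s hs =>
    ha.analyticAt ((isOpen_halfPlane M).mem_nhds hs)
  have hDan : ∀ s, AnalyticAt ℂ (fun s => ∏ i ∈ I, (α i * s + c i)) s := fun s =>
    Finset.analyticAt_fun_prod _ fun i _ => by fun_prop
  refine ⟨fun s => a s / ∏ i ∈ I, (α i * s + c i), ?_, ?_, ?_, ?_⟩
  · intro s hs
    exact (han s hs).meromorphicAt.div (hDan s).meromorphicAt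
  · intro s hs
    have : ∏ i ∈ I, (α i * s + c i) ≠ 0 := Finset.prod_ne_zero_iff.2 fun i hi => hre i hi s hs
    simp only [← ha' s hs, hD]
    rw [mul_div_cancel_left₀ _ this]
  · intro s hs hsP
    refine (han s hs).div (hDan s) (Finset.prod_ne_zero_iff.2 fun i hi h0 => hsP (hP i hi s h0))
  · intro hs₀
    have := PoleOrderAtMost.div_prod I α c (PoleOrderAtMost.of_analyticAt (han s₀ hs₀))
      fun i hi _ => hα i hi
    exact this.mono (by simpa using hp)

end Pole

section Cutoff

variable {E : Type*} [NormedAddCommGroup E] [NormedSpace ℝ E] [FiniteDimensional ℝ E]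

theorem exists_smooth_cutoff {A B : Set E} (hA : IsClosed A) (hB : IsClosed B)
    (hAB : Disjoint A B) : ∃ χ : E → ℝ, ContDiff ℝ (⊤ : ℕ∞) χ ∧
      (∀ p ∈ A, ∀ᶠ q in 𝓝 p, χ q = 1) ∧ ∀ p ∈ B, ∀ᶠ q in 𝓝 p, χ q = 0 := by
  obtain ⟨χ, h0, h1, -⟩ := exists_contMDiffMap_zero_one_nhds_of_isClosed
    (modelWithCornersSelf ℝ E) (n := (⊤ : ℕ∞)) hB hA hAB.symm
  exact ⟨χ, χ.contMDiff.contDiff, fun p hp => eventually_nhdsSet_iff_forall.1 h1 p hp,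
    fun p hp => eventually_nhdsSet_iff_forall.1 h0 p hp⟩

end Cutoff

variable {Ω : Set ((Fin n → ℝ) × (Fin n → ℝ))} {g : (Fin n → ℝ) × (Fin n → ℝ) → ℝ}
  {Θ : (Fin n → ℝ) × (Fin n → ℝ) → ℂ}

theorem IsAmp.cutoff {Ω' : Set ((Fin n → ℝ) × (Fin n → ℝ))} (hΘ : IsAmp Ω Θ)
    {χ : (Fin n → ℝ) × (Fin n → ℝ) → ℝ} (hχ : ContDiff ℝ (⊤ : ℕ∞) χ)
    (h : ∀ p ∈ tsupport Θ, p ∉ Ω' → ∀ᶠ q in 𝓝 p, χ q = 0) :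
    IsAmp (Ω ∩ Ω') fun p => (χ p : ℂ) * Θ p := by
  have h1 := hΘ.ofReal_mul' hχ
  refine ⟨h1.1, h1.2.1, fun p hp => ⟨h1.2.2 hp, ?_⟩⟩
  have hpT : p ∈ tsupport Θ := (tsupport_mul_subset_right (f := fun p => (χ p : ℂ))) hp
  by_contra hp'
  refine notMem_tsupport_iff_eventuallyEq.2 ?_ hp
  filter_upwards [h p hpT hp'] with q hq
  simp [hq]

theorem IsAmp.mono {Ω' : Set ((Fin n → ℝ) × (Fin n → ℝ))} (hΘ : IsAmp Ω Θ) (h : Ω ⊆ Ω') :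
    IsAmp Ω' Θ := ⟨hΘ.1, hΘ.2.1, hΘ.2.2.trans h⟩

section Poles

variable {P : Set ℂ} {ρ : ℝ} {l b : Fin n → ℕ} {M : ℕ} {F : ℂ → ℂ}

/-- The index set of the linear factors of `polarProd`. -/
def polarIndex (M : ℕ) (l b : Fin n → ℕ) : Finset (Σ _ : Fin n, ℕ) :=
  Finset.univ.sigma fun j => Finset.Ico (b j) (l j * M + 1)

theorem polarIndex_pos (hb : ∀ j, 1 ≤ b j) {i : Σ _ : Fin n, ℕ} (hi : i ∈ polarIndex M l b) :
    0 < l i.1 ∧ b i.1 ≤ i.2 := by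
  simp only [polarIndex, Finset.mem_sigma, Finset.mem_univ, true_and, Finset.mem_Ico] at hi
  refine ⟨Nat.pos_of_ne_zero fun h => ?_, hi.1⟩
  have := hb i.1
  rw [h] at hi
  omega

theorem polarProd_eq_prod (s : ℂ) :
    polarProd M l b s = ∏ i ∈ polarIndex M l b, ((l i.1 : ℂ) * s + (i.2 : ℂ)) := by
  unfold polarProd polarIndex
  rw [Finset.prod_sigma]

theorem polar_zero_mem (hb : ∀ j, 1 ≤ b j)
    (hP : ∀ j, 0 < l j → ∀ ν : ℕ, -((b j : ℂ) + ν) / l j ∈ P)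
    {i : Σ _ : Fin n, ℕ} (hi : i ∈ polarIndex M l b) {s : ℂ}
    (hs : (l i.1 : ℂ) * s + (i.2 : ℂ) = 0) : s ∈ P := by
  obtain ⟨h1, h2⟩ := polarIndex_pos hb hi
  have h3 : (l i.1 : ℂ) ≠ 0 := by exact_mod_cast h1.ne'
  convert hP i.1 h1 (i.2 - b i.1) using 1
  rw [Nat.cast_sub h2, eq_div_iff h3]
  linear_combination hs

theorem linear_factor_ne_zero {α c : ℕ} (hc : 0 < c) {s : ℂ} (hs : 0 < s.re) :
    (α : ℂ) * s + (c : ℂ) ≠ 0 := by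
  intro h
  have := congrArg Complex.re h
  simp only [Complex.add_re, Complex.mul_re, Complex.natCast_re, Complex.natCast_im, zero_mul,
    sub_zero, Complex.zero_re] at this
  have h1 : (0 : ℝ) < c := by exact_mod_cast hc
  have h2 : (0 : ℝ) ≤ α * s.re := by positivity
  linarith

open Classical in
theorem card_polar_filter_le (hb : ∀ j, 1 ≤ b j) (hρ : ∀ j, ρ * l j ≤ b j) :
    ((polarIndex M l b).filter fun i => (l i.1 : ℂ) * ((-ρ : ℝ) : ℂ) + (i.2 : ℂ) = 0).card ≤
      (Finset.univ.filter fun j => 0 < l j ∧ ρ * l j = b j).card := by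
  have key : ∀ i ∈ (polarIndex M l b).filter fun i =>
      (l i.1 : ℂ) * ((-ρ : ℝ) : ℂ) + (i.2 : ℂ) = 0,
      0 < l i.1 ∧ ρ * l i.1 = b i.1 ∧ i.2 = b i.1 := by
    intro i hi
    obtain ⟨hi, h0⟩ := Finset.mem_filter.1 hi
    obtain ⟨h1, h2⟩ := polarIndex_pos hb hi
    have h3 : (l i.1 : ℝ) * -ρ + i.2 = 0 := by exact_mod_cast h0
    have h4 : (b i.1 : ℝ) ≤ i.2 := by exact_mod_cast h2
    have h5 := hρ i.1
    have h6 : (i.2 : ℝ) = b i.1 := by linarith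
    exact ⟨h1, by linarith, by exact_mod_cast h6⟩
  refine Finset.card_le_card_of_injOn (fun i => i.1) (fun i hi => ?_) fun i hi k hk h => ?_
  · have := key i hi
    simpa using ⟨this.1, this.2.1⟩
  · have h1 := (key i hi).2.2
    have h2 := (key k hk).2.2
    rcases i with ⟨i, c⟩
    rcases k with ⟨k, d⟩
    simp only at h h1 h2
    subst h
    rw [h1, h2]

open Classical in
theorem ExtBy.meroExt_polarProd (h : ExtBy M (polarProd M l b) F) (hb : ∀ j, 1 ≤ b j)
    (hP : ∀ j, 0 < l j → ∀ ν : ℕ, -((b j : ℂ) + ν) / l j ∈ P)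
    (hρ : ∀ j, ρ * l j ≤ b j) :
    MeroExt M P ((-ρ : ℝ) : ℂ) (Finset.univ.filter fun j => 0 < l j ∧ ρ * l j = b j).card F := by
  refine h.meroExt (I := polarIndex M l b) polarProd_eq_prod
    (fun i hi s hs => polar_zero_mem hb hP hi hs) (fun i hi => ?_) (fun i hi s hs => ?_)
    (card_polar_filter_le hb hρ)
  · exact_mod_cast (polarIndex_pos hb hi).1.ne'
  · exact linear_factor_ne_zero ((hb i.1).trans (polarIndex_pos hb hi).2) hs

open Classical in
theorem meroExt_chartInt (hg : ContDiff ℝ (⊤ : ℕ∞) g) (M : ℕ) (hb : ∀ j, 1 ≤ b j)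
    (hΘ : IsAmp (regularSet g) Θ)
    (hP : ∀ j, 0 < l j → ∀ ν : ℕ, -((b j : ℂ) + ν) / l j ∈ P)
    (hP' : ∀ m : ℕ, -((m : ℂ) + 1) ∈ P)
    (hρ : ∀ j, ρ * l j ≤ b j) :
    MeroExt M P ((-ρ : ℝ) : ℂ) ((Finset.univ.filter fun j => 0 < l j ∧ ρ * l j = b j).card +
      if ∃ k : ℤ, ρ = k then 1 else 0) (chartInt g l b 0 Θ) := by
  have h := extBy_chartInt_zero hg M (l := l) hb hΘ
  set K := M + deficiency M l b
  refine h.meroExt (I := (polarIndex M l b).disjSum (Finset.range K))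
    (α := Sum.elim (fun i => (l i.1 : ℂ)) fun _ => 1)
    (c := Sum.elim (fun i => (i.2 : ℂ)) fun i => ((i + 1 : ℕ) : ℂ)) ?_ ?_ ?_ ?_ ?_
  · intro s
    rw [Finset.prod_disjSum, polarProd_eq_prod]
    simp
  · rintro (i | i) hi s hs
    · exact polar_zero_mem hb hP (Finset.inl_mem_disjSum.1 hi) hs
    · convert hP' i using 1
      simp only [Sum.elim_inr] at hs
      push_cast at hs
      linear_combination hs
  · rintro (i | i) hi
    · exact Nat.cast_ne_zero.2 (polarIndex_pos hb (Finset.inl_mem_disjSum.1 hi)).1.ne'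
    · simp
  · rintro (i | i) hi s hs
    · have := polarIndex_pos hb (Finset.inl_mem_disjSum.1 hi)
      exact linear_factor_ne_zero ((hb i.1).trans this.2) hs
    · simpa using linear_factor_ne_zero (α := 1) (Nat.succ_pos i) hs
  · have hsplit : ((polarIndex M l b).disjSum (Finset.range K)).filter (fun i =>
        Sum.elim (fun i : (Σ _ : Fin n, ℕ) => (l i.1 : ℂ)) (fun _ => 1) i * ((-ρ : ℝ) : ℂ) +
          Sum.elim (fun i : (Σ _ : Fin n, ℕ) => (i.2 : ℂ)) (fun i => ((i + 1 : ℕ) : ℂ)) i = 0) =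
        ((polarIndex M l b).filter
          fun i => (l i.1 : ℂ) * ((-ρ : ℝ) : ℂ) + (i.2 : ℂ) = 0).disjSum
        ((Finset.range K).filter fun i => (1 : ℂ) * ((-ρ : ℝ) : ℂ) + ((i + 1 : ℕ) : ℂ) = 0) := by
      ext (i | i) <;> simp
    rw [hsplit, Finset.card_disjSum]
    refine Nat.add_le_add (card_polar_filter_le hb hρ) ?_
    have hz : ∀ i : ℕ, (1 : ℂ) * ((-ρ : ℝ) : ℂ) + ((i + 1 : ℕ) : ℂ) = 0 → ρ = i + 1 := by
      intro i hi
      have : (1 : ℝ) * -ρ + ((i + 1 : ℕ) : ℝ) = 0 := by exact_mod_cast hi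
      push_cast at this
      linarith
    split_ifs with hk
    · refine Finset.card_le_one.2 fun i hi k hk => ?_
      have h1 := hz i (Finset.mem_filter.1 hi).2
      have h2 := hz k (Finset.mem_filter.1 hk).2
      have : (i : ℝ) = k := by linarith
      exact_mod_cast this
    · rw [Nat.le_zero, Finset.card_eq_zero, Finset.filter_eq_empty_iff]
      exact fun i _ hi => hk ⟨i + 1, by rw [hz i hi]; push_cast; ring⟩

end Poles

section Special

variable {l b : Fin n → ℕ} {M : ℕ}

/-- Away from the zero set of `g` there are no poles coming from `g`. -/
theorem extBy_chartInt_of_ne_zero (hg : ContDiff ℝ (⊤ : ℕ∞) g) (M : ℕ) (hb : ∀ j, 1 ≤ b j)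
    (hΘ : IsAmp {p | g p ≠ 0} Θ) : ExtBy M (polarProd M l b) (chartInt g l b 0 Θ) := by
  set K := M + deficiency M l b
  have hA : IsAmp {p | g p ≠ 0} fun p => (((g p ^ K)⁻¹ : ℝ) : ℂ) * Θ p :=
    hΘ.ofReal_mul fun p hp => (hg.contDiffAt.pow K).inv (pow_ne_zero _ hp)
  obtain ⟨h, hh, hh'⟩ := extBy_chartInt hg M _ l b K _ hb le_rfl le_rfl hA
  refine ⟨h, hh, fun s hs => ?_⟩
  rw [← hh' s hs]
  congr 1
  refine integral_congr_ae (Eventually.of_forall fun p => ?_)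
  simp only [posPow_add_natCast hs]
  by_cases hp : g p = 0
  · have : Θ p = 0 := by
      by_contra hne
      exact hΘ.2.2 (subset_tsupport _ hne) hp
    simp [this]
  · have : (g p : ℂ) ≠ 0 := by exact_mod_cast hp
    push_cast
    field_simp

theorem monWeight_update_succ {y : Fin n → ℝ} (hy : y ∈ box n) (j : Fin n) (s : ℂ) :
    monWeight l (Function.update b j (b j + 1)) s y = monWeight l b s y * (y j : ℂ) := by
  unfold monWeight
  rw [← Finset.mul_prod_erase _ _ (Finset.mem_univ j),
    ← Finset.mul_prod_erase _ (fun j => (y j : ℂ) ^ ((l j : ℂ) * s + (b j : ℂ) - 1))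
      (Finset.mem_univ j)]
  have hj : (y j : ℂ) ≠ 0 := by exact_mod_cast (hy j (mem_univ j)).1.ne'
  have h1 : ∏ i ∈ Finset.univ.erase j,
      (y i : ℂ) ^ ((l i : ℂ) * s + (Function.update b j (b j + 1) i : ℂ) - 1) =
      ∏ i ∈ Finset.univ.erase j, (y i : ℂ) ^ ((l i : ℂ) * s + (b i : ℂ) - 1) :=
    Finset.prod_congr rfl fun i hi => by
      rw [Function.update_of_ne (Finset.ne_of_mem_erase hi)]
  rw [h1, Function.update_self, show (l j : ℂ) * s + ((b j + 1 : ℕ) : ℂ) - 1 =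
    (l j : ℂ) * s + (b j : ℂ) - 1 + 1 by push_cast; ring, Complex.cpow_add _ _ hj,
    Complex.cpow_one]
  ring

theorem chartInt_coord_mul (j : Fin n) (k : ℕ) (s : ℂ) :
    chartInt g l b k (fun p => ((p.1 j : ℝ) : ℂ) * Θ p) s =
      chartInt g l (Function.update b j (b j + 1)) k Θ s := by
  refine integral_congr_ae ?_
  filter_upwards [ae_mem_box n] with p hp
  simp only [monWeight_update_succ hp j s]
  ring

open Classical in
/-- If all the factors vanish at `-ρ` but `g` does not vanish over the origin of the chart, then
the pole order is at most `n`. -/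
theorem meroExt_chartInt_of_all {P : Set ℂ} {ρ : ℝ} (hg : ContDiff ℝ (⊤ : ℕ∞) g) (M : ℕ)
    (hb : ∀ j, 1 ≤ b j) (hΘ : IsAmp (regularSet g) Θ)
    (hP : ∀ j, 0 < l j → ∀ ν : ℕ, -((b j : ℂ) + ν) / l j ∈ P)
    (hP' : ∀ m : ℕ, -((m : ℂ) + 1) ∈ P)
    (hρ : ∀ j, ρ * l j = b j)
    (hne : ∀ p ∈ tsupport Θ, p.1 = 0 → g p ≠ 0) :
    MeroExt M P ((-ρ : ℝ) : ℂ) n (chartInt g l b 0 Θ) := by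
  have hT : IsClosed (tsupport Θ) := isClosed_tsupport Θ
  obtain ⟨χ, hχ, h1, h0⟩ := exists_smooth_cutoff
    (A := tsupport Θ ∩ {p | p.1 = 0}) (B := tsupport Θ ∩ {p | g p = 0})
    (hT.inter (isClosed_eq continuous_fst continuous_const))
    (hT.inter (isClosed_eq hg.continuous continuous_const))
    (Set.disjoint_left.2 fun p hp hp' => hne p hp.1 hp.2 hp'.2)
  have hA : IsAmp {p | g p ≠ 0} fun p => (χ p : ℂ) * Θ p :=
    (hΘ.cutoff hχ fun p hp hp' => h0 p ⟨hp, not_not.1 hp'⟩).mono inter_subset_right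
  have hχ' : ContDiff ℝ (⊤ : ℕ∞) fun p => 1 - χ p := contDiff_const.sub hχ
  have hB : IsAmp (regularSet g ∩ {p | p.1 ≠ 0}) fun p => ((1 - χ p : ℝ) : ℂ) * Θ p :=
    hΘ.cutoff hχ' fun p hp hp' => by
      filter_upwards [h1 p ⟨hp, not_not.1 hp'⟩] with q hq
      simp [hq]
  have hsq : ∀ p : (Fin n → ℝ) × (Fin n → ℝ), p.1 ≠ 0 → ∑ j, p.1 j ^ 2 ≠ 0 := by
    intro p hp h
    apply hp
    ext j
    simpa using (Finset.sum_eq_zero_iff_of_nonneg fun j _ => sq_nonneg (p.1 j)).1 h j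
      (Finset.mem_univ j)
  set Φ : Fin n → (Fin n → ℝ) × (Fin n → ℝ) → ℂ := fun j p =>
    ((p.1 j / ∑ j, p.1 j ^ 2 : ℝ) : ℂ) * (((1 - χ p : ℝ) : ℂ) * Θ p) with hΦ
  have hC : ∀ j, IsAmp (regularSet g) (Φ j) := fun j =>
    (hB.ofReal_mul fun p hp => by
      have h1 : ContDiff ℝ (⊤ : ℕ∞) fun p : (Fin n → ℝ) × (Fin n → ℝ) => p.1 j := by fun_prop
      have h2 : ContDiff ℝ (⊤ : ℕ∞) fun p : (Fin n → ℝ) × (Fin n → ℝ) => ∑ j, p.1 j ^ 2 := by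
        fun_prop
      exact h1.contDiffAt.div h2.contDiffAt (hsq p hp.2)).mono inter_subset_left
  have hC' : ∀ j, IsAmp (regularSet g) fun p => ((p.1 j : ℝ) : ℂ) * Φ j p := fun j =>
    (hC j).ofReal_mul' (u := fun p : (Fin n → ℝ) × (Fin n → ℝ) => p.1 j) (by fun_prop)
  have hdec : ∀ p, Θ p = (χ p : ℂ) * Θ p + ∑ j, ((p.1 j : ℝ) : ℂ) * Φ j p := by
    intro p
    by_cases hp : p.1 = 0
    · by_cases hpT : p ∈ tsupport Θ
      · have := (h1 p ⟨hpT, hp⟩).self_of_nhds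
        simp [hΦ, this]
      · have : Θ p = 0 := image_eq_zero_of_notMem_tsupport hpT
        simp [hΦ, this]
    · have h2 := hsq p hp
      have h3 : ((∑ j, p.1 j ^ 2 : ℝ) : ℂ) ≠ 0 := by exact_mod_cast h2
      have : ∑ j, ((p.1 j : ℝ) : ℂ) * Φ j p =
          (∑ j, (p.1 j : ℂ) ^ 2) / ((∑ j, p.1 j ^ 2 : ℝ) : ℂ) * (((1 - χ p : ℝ) : ℂ) * Θ p) := by
        rw [Finset.sum_div, Finset.sum_mul]
        refine Finset.sum_congr rfl fun j _ => ?_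
        simp only [hΦ]
        push_cast
        ring
      rw [this, show (∑ j, (p.1 j : ℂ) ^ 2) = ((∑ j, p.1 j ^ 2 : ℝ) : ℂ) by push_cast; rfl,
        div_self h3]
      push_cast
      ring
  have hcard : ∀ b' : Fin n → ℕ,
      (Finset.univ.filter fun j => 0 < l j ∧ ρ * l j = b' j).card ≤ n := fun b' =>
    (Finset.card_filter_le _ _).trans (by simp)
  have m1 : MeroExt M P ((-ρ : ℝ) : ℂ) n (chartInt g l b 0 fun p => (χ p : ℂ) * Θ p) :=
    ((extBy_chartInt_of_ne_zero hg M hb hA).meroExt_polarProd hb hP fun j => (hρ j).le).mono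
      (hcard b)
  have m2 : ∀ j, MeroExt M P ((-ρ : ℝ) : ℂ) n
      (chartInt g l (Function.update b j (b j + 1)) 0 (Φ j)) := by
    intro j
    refine (meroExt_chartInt hg M (one_le_update hb j (c := b j + 1) (Nat.succ_pos _)) (hC j) ?_ hP'
      (ρ := ρ) ?_).mono ?_
    · intro i hi ν
      rcases eq_or_ne i j with rfl | hij
      · convert hP i hi (ν + 1) using 2
        rw [Function.update_self]
        push_cast
        ring
      · simpa [Function.update_of_ne hij] using hP i hi ν
    · intro i
      rcases eq_or_ne i j with rfl | hij
      · rw [Function.update_self, hρ]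
        push_cast
        linarith
      · rw [Function.update_of_ne hij, hρ]
    · have : (Finset.univ.filter fun i => 0 < l i ∧
          ρ * l i = (Function.update b j (b j + 1) i : ℕ)).card < n := by
        refine (Finset.card_lt_card (Finset.filter_ssubset.2 ⟨j, Finset.mem_univ _, ?_⟩)).trans_le
          (by simp)
        rw [Function.update_self, hρ]
        push_cast
        rintro ⟨-, h⟩
        linarith
      split_ifs <;> omega
  refine (m1.add (MeroExt.sum Finset.univ fun j _ => m2 j)).congr fun s hs => ?_
  simp only [← chartInt_coord_mul]
  have hs' : 0 < (s + (0 : ℕ)).re := by simpa using hs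
  unfold chartInt
  rw [← integral_finsetSum _ fun j _ => (hC' j).integrable hg (l := l) (b := b) hb hs hs',
    ← integral_add (hA.integrable hg hb hs hs')
      (integrable_finsetSum _ fun j _ => (hC' j).integrable hg hb hs hs')]
  refine integral_congr_ae (Eventually.of_forall fun p => ?_)
  simp only
  rw [← Finset.mul_sum, ← Finset.mul_sum, ← mul_add, ← mul_add, ← hdec p]

end Special

section Cones

theorem mem_coneSpan {g : Fin n → (Fin n → ℝ)} {u : Fin n → ℝ} :
    u ∈ coneSpan g ↔ ∃ c : Fin n → ℝ, (∀ j, 0 ≤ c j) ∧ u = ∑ j, c j • g j := by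
  simp [coneSpan, coneSpanSub]

/-- The coordinates of `u` in the basis `g`. -/
noncomputable def coneCoord (g : Fin n → (Fin n → ℝ)) : (Fin n → ℝ) →ₗ[ℝ] (Fin n → ℝ) :=
  Matrix.vecMulLinear (Matrix.of g)⁻¹

theorem coneCoord_sum {g : Fin n → (Fin n → ℝ)} (hg : (Matrix.of g).det ≠ 0) (c : Fin n → ℝ) :
    coneCoord g (∑ j, c j • g j) = c := by
  have : ∑ j, c j • g j = Matrix.vecMul c (Matrix.of g) := by
    rw [Matrix.vecMul_eq_sum]; rfl
  rw [this, coneCoord, Matrix.vecMulLinear_apply, Matrix.vecMul_vecMul,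
    Matrix.mul_nonsing_inv _ (isUnit_iff_ne_zero.2 hg), Matrix.vecMul_one]

theorem sum_coneCoord {g : Fin n → (Fin n → ℝ)} (hg : (Matrix.of g).det ≠ 0) (u : Fin n → ℝ) :
    ∑ j, coneCoord g u j • g j = u := by
  have : ∑ j, coneCoord g u j • g j = Matrix.vecMul (coneCoord g u) (Matrix.of g) := by
    rw [Matrix.vecMul_eq_sum]; rfl
  rw [this, coneCoord, Matrix.vecMulLinear_apply, Matrix.vecMul_vecMul,
    Matrix.nonsing_inv_mul _ (isUnit_iff_ne_zero.2 hg), Matrix.vecMul_one]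

theorem sum_mem_coneSpan_iff {g : Fin n → (Fin n → ℝ)} (hg : (Matrix.of g).det ≠ 0)
    {c : Fin n → ℝ} : ∑ j, c j • g j ∈ coneSpan g ↔ ∀ j, 0 ≤ c j := by
  refine ⟨fun h => ?_, fun h => mem_coneSpan.2 ⟨c, h, rfl⟩⟩
  obtain ⟨d, hd, he⟩ := mem_coneSpan.1 h
  have := congrArg (coneCoord g) he
  rw [coneCoord_sum hg, coneCoord_sum hg] at this
  exact this ▸ hd

theorem mem_coneSpan_iff {g : Fin n → (Fin n → ℝ)} (hg : (Matrix.of g).det ≠ 0)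
    {u : Fin n → ℝ} : u ∈ coneSpan g ↔ ∀ j, 0 ≤ coneCoord g u j := by
  conv_lhs => rw [← sum_coneCoord hg u]
  exact sum_mem_coneSpan_iff hg

theorem ae_linear_ne_zero (L : (Fin n → ℝ) →ₗ[ℝ] ℝ) (hL : L ≠ 0) :
    ∀ᵐ u : Fin n → ℝ, L u ≠ 0 := by
  have h : LinearMap.ker L ≠ ⊤ := fun h => hL (LinearMap.ker_eq_top.1 h)
  have := Measure.addHaar_submodule (volume : Measure (Fin n → ℝ)) _ h
  exact measure_mono_null (fun u hu => by simpa using hu) this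

theorem ae_coneCoord_ne_zero {g : Fin n → (Fin n → ℝ)} (hg : (Matrix.of g).det ≠ 0) :
    ∀ᵐ u : Fin n → ℝ, ∀ j, coneCoord g u j ≠ 0 := by
  refine ae_all_iff.2 fun j => ae_linear_ne_zero (LinearMap.proj j ∘ₗ coneCoord g) fun h => ?_
  have := LinearMap.congr_fun h (∑ i, (Pi.single j 1 : Fin n → ℝ) i • g i)
  rw [LinearMap.comp_apply, coneCoord_sum hg] at this
  simp at this

theorem det_update_combination {g : Fin n → (Fin n → ℝ)} {i j : Fin n} (hij : i ≠ j) (p q : ℝ) :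
    (Matrix.of (Function.update g i (p • g j + q • g i))).det = q * (Matrix.of g).det := by
  have h1 := Matrix.det_updateRow_add (Matrix.of g) i (p • g j) (q • g i)
  rw [Matrix.det_updateRow_smul, Matrix.det_updateRow_smul] at h1
  have h2 : ((Matrix.of g).updateRow i (g j)).det = 0 := Matrix.det_updateRow_eq_zero hij.symm
  have h3 : (Matrix.of g).updateRow i (g i) = Matrix.of g := Matrix.updateRow_eq_self _ _
  rw [h2, h3, mul_zero, zero_add] at h1
  exact h1

theorem sum_update_combination {g : Fin n → (Fin n → ℝ)} {i j : Fin n} (hij : i ≠ j) (p : ℝ)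
    {q : ℝ} (hq : q ≠ 0) (c : Fin n → ℝ) :
    ∑ k, Function.update (Function.update c i (c i / q)) j (c j - p * c i / q) k •
      Function.update g i (p • g j + q • g i) k = ∑ k, c k • g k := by
  have key : ∀ k, Function.update (Function.update c i (c i / q)) j (c j - p * c i / q) k •
      Function.update g i (p • g j + q • g i) k = c k • g k +
      (if k = i then (c i / q) • (p • g j + q • g i) - c i • g i else 0) -
      (if k = j then (p * c i / q) • g j else 0) := by
    intro k
    rcases eq_or_ne k j with rfl | hkj
    · simp [hij.symm, sub_smul]
    · rcases eq_or_ne k i with rfl | hki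
      · simp [hij]
      · simp [hkj, hki]
  rw [Finset.sum_congr rfl fun k _ => key k, Finset.sum_sub_distrib, Finset.sum_add_distrib,
    Finset.sum_ite_eq', Finset.sum_ite_eq']
  simp only [Finset.mem_univ, if_true]
  have : (c i / q) • (p • g j + q • g i) - c i • g i = (p * c i / q) • g j := by
    rw [smul_add, smul_smul, smul_smul, div_mul_cancel₀ _ hq, add_sub_cancel_right]
    congr 1; ring
  rw [this, add_sub_cancel_right]

theorem sum_mem_child_iff {g : Fin n → (Fin n → ℝ)} (hg : (Matrix.of g).det ≠ 0) {i j : Fin n}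
    (hij : i ≠ j) (p : ℝ) {q : ℝ} (hq : 0 < q) (c : Fin n → ℝ) :
    ∑ k, c k • g k ∈ coneSpan (Function.update g i (p • g j + q • g i)) ↔
      (∀ k, k ≠ j → 0 ≤ c k) ∧ p * c i ≤ q * c j := by
  have hdet : (Matrix.of (Function.update g i (p • g j + q • g i))).det ≠ 0 := by
    rw [det_update_combination hij]
    exact mul_ne_zero hq.ne' hg
  rw [← sum_update_combination hij p hq.ne' c, sum_mem_coneSpan_iff hdet]
  have hj : 0 ≤ c j - p * c i / q ↔ p * c i ≤ q * c j := by
    rw [sub_nonneg, div_le_iff₀ hq, mul_comm (c j)]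
  constructor
  · intro h
    refine ⟨fun k hk => ?_, ?_⟩
    · have := h k
      rw [Function.update_of_ne hk] at this
      rcases eq_or_ne k i with rfl | hki
      · rw [Function.update_self] at this
        have := mul_nonneg this hq.le
        rwa [div_mul_cancel₀ _ hq.ne'] at this
      · rwa [Function.update_of_ne hki] at this
    · have := h j
      rw [Function.update_self] at this
      exact hj.1 this
  · rintro ⟨h1, h2⟩ k
    rcases eq_or_ne k j with rfl | hkj
    · rw [Function.update_self]
      exact hj.2 h2
    · rw [Function.update_of_ne hkj]
      rcases eq_or_ne k i with rfl | hki
      · rw [Function.update_self]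
        exact div_nonneg (h1 k hkj) hq.le
      · rw [Function.update_of_ne hki]
        exact h1 k hkj

/-- The indicator function of the cone spanned by `g`. -/
noncomputable def coneInd (g : Fin n → (Fin n → ℕ)) (u : Fin n → ℝ) : ℝ :=
  (coneSpan (genR g)).indicator (fun _ => 1) u

theorem genR_update (g : Fin n → (Fin n → ℕ)) (i : Fin n) (h : Fin n → ℕ) :
    genR (Function.update g i h) = Function.update (genR g) i (natPt h) := by
  funext k
  rcases eq_or_ne k i with rfl | hk
  · simp [genR]
  · simp [genR, Function.update_of_ne hk]

theorem natPt_combination (p q : ℕ) (a b : Fin n → ℕ) :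
    natPt (p • a + q • b) = (p : ℝ) • natPt a + (q : ℝ) • natPt b := by
  funext k
  simp [natPt]

/-- The value of an integral linear form on a vector of naturals. -/
def formVal (m : Fin n → ℤ) (a : Fin n → ℕ) : ℤ := ∑ i, m i * (a i : ℤ)

theorem formVal_combination (m : Fin n → ℤ) (p q : ℕ) (a b : Fin n → ℕ) :
    formVal m (p • a + q • b) = p * formVal m a + q * formVal m b := by
  simp only [formVal, Finset.mul_sum, ← Finset.sum_add_distrib]
  refine Finset.sum_congr rfl fun i _ => ?_
  simp
  ring

/-- The form `m` has constant sign on the cone spanned by `g`. -/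
def SignConst (m : Fin n → ℤ) (g : Fin n → (Fin n → ℕ)) : Prop :=
  (∀ k, 0 ≤ formVal m (g k)) ∨ ∀ k, formVal m (g k) ≤ 0

theorem SignConst.update {m : Fin n → ℤ} {g : Fin n → (Fin n → ℕ)} (h : SignConst m g)
    (i j : Fin n) (p q : ℕ) : SignConst m (Function.update g i (p • g j + q • g i)) := by
  rcases h with h | h
  · refine Or.inl fun k => ?_
    rcases eq_or_ne k i with rfl | hk
    · rw [Function.update_self, formVal_combination]
      have := h j
      have := h k
      positivity
    · rw [Function.update_of_ne hk]
      exact h k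
  · refine Or.inr fun k => ?_
    rcases eq_or_ne k i with rfl | hk
    · rw [Function.update_self, formVal_combination]
      have h1 := mul_nonpos_of_nonneg_of_nonpos (Int.natCast_nonneg p) (h j)
      have h2 := mul_nonpos_of_nonneg_of_nonpos (Int.natCast_nonneg q) (h k)
      linarith
    · rw [Function.update_of_ne hk]
      exact h k

/-- `L` is a list of simplicial cones which subdivide the simplicial cone spanned by `g`. -/
def Refines (g : Fin n → (Fin n → ℕ)) (L : List (Fin n → (Fin n → ℕ))) : Prop :=
  (∀ h ∈ L, (Matrix.of (genR h)).det ≠ 0 ∧ ∀ m, SignConst m g → SignConst m h) ∧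
  (∀ u ∈ coneSpan (genR g), ∃ h ∈ L, u ∈ coneSpan (genR h)) ∧
  ∀ᵐ u : Fin n → ℝ, (L.map fun h => coneInd h u).sum = coneInd g u

theorem Refines.refl {g : Fin n → (Fin n → ℕ)} (hg : (Matrix.of (genR g)).det ≠ 0) :
    Refines g [g] :=
  ⟨by simpa using hg, by simp, by simp⟩

theorem Refines.flatMap {g : Fin n → (Fin n → ℕ)} {L : List (Fin n → (Fin n → ℕ))}
    (hL : Refines g L) (F : (Fin n → (Fin n → ℕ)) → List (Fin n → (Fin n → ℕ)))
    (hF : ∀ h ∈ L, Refines h (F h)) : Refines g (L.flatMap F) := by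
  obtain ⟨h1, h2, h3⟩ := hL
  refine ⟨fun k hk => ?_, fun u hu => ?_, ?_⟩
  · obtain ⟨h, hh, hk⟩ := List.mem_flatMap.1 hk
    exact ⟨((hF h hh).1 k hk).1, fun m hm => ((hF h hh).1 k hk).2 m ((h1 h hh).2 m hm)⟩
  · obtain ⟨h, hh, hu⟩ := h2 u hu
    obtain ⟨k, hk, hu⟩ := (hF h hh).2.1 u hu
    exact ⟨k, List.mem_flatMap.2 ⟨h, hh, hk⟩, hu⟩
  · clear h1 h2
    have key : ∀ᵐ u : Fin n → ℝ, ((L.flatMap F).map fun h => coneInd h u).sum =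
        (L.map fun h => coneInd h u).sum := by
      clear h3
      induction L with
      | nil => simp
      | cons a L ih =>
        filter_upwards [ih fun h hh => hF h (List.mem_cons_of_mem _ hh),
          (hF a List.mem_cons_self).2.2] with u hu1 hu2
        simp only [List.flatMap_cons, List.map_append, List.sum_append, List.map_cons,
          List.sum_cons]
        rw [hu1, hu2]
    filter_upwards [key, h3] with u hu1 hu2
    rw [hu1, hu2]

theorem Refines.split {g : Fin n → (Fin n → ℕ)} (hg : (Matrix.of (genR g)).det ≠ 0)
    {i j : Fin n} (hij : i ≠ j) {p q : ℕ} (hp : 0 < p) (hq : 0 < q) :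
    Refines g [Function.update g i (p • g j + q • g i),
      Function.update g j (q • g i + p • g j)] := by
  have hp' : (0 : ℝ) < p := by exact_mod_cast hp
  have hq' : (0 : ℝ) < q := by exact_mod_cast hq
  have e1 : genR (Function.update g i (p • g j + q • g i)) =
      Function.update (genR g) i ((p : ℝ) • genR g j + (q : ℝ) • genR g i) := by
    rw [genR_update, natPt_combination]; rfl
  have e2 : genR (Function.update g j (q • g i + p • g j)) =
      Function.update (genR g) j ((q : ℝ) • genR g i + (p : ℝ) • genR g j) := by
    rw [genR_update, natPt_combination]; rfl
  have m1 := fun c => sum_mem_child_iff hg hij (p : ℝ) hq' c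
  have m2 := fun c => sum_mem_child_iff hg hij.symm (q : ℝ) hp' c
  rw [← e1] at m1
  rw [← e2] at m2
  have m0 := fun c => sum_mem_coneSpan_iff hg (c := c)
  refine ⟨?_, fun u hu => ?_, ?_⟩
  · simp only [List.mem_cons, List.not_mem_nil, or_false, forall_eq_or_imp, forall_eq]
    refine ⟨⟨?_, fun m hm => hm.update i j p q⟩, ?_, fun m hm => hm.update j i q p⟩
    · rw [e1, det_update_combination hij]
      exact mul_ne_zero hq'.ne' hg
    · rw [e2, det_update_combination hij.symm]
      exact mul_ne_zero hp'.ne' hg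
  · rw [← sum_coneCoord hg u] at hu ⊢
    have h0 := (m0 _).1 hu
    rcases le_total (p * coneCoord (genR g) u i) (q * coneCoord (genR g) u j) with h | h
    · exact ⟨_, by simp, (m1 _).2 ⟨fun k _ => h0 k, h⟩⟩
    · exact ⟨_, List.mem_cons_of_mem _ (List.mem_singleton_self _),
        (m2 _).2 ⟨fun k _ => h0 k, h⟩⟩
  · have hL : (p : ℝ) • (LinearMap.proj i ∘ₗ coneCoord (genR g)) -
        (q : ℝ) • (LinearMap.proj j ∘ₗ coneCoord (genR g)) ≠ 0 := by
      intro h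
      have := LinearMap.congr_fun h (∑ k, (Pi.single i 1 : Fin n → ℝ) k • genR g k)
      simp only [LinearMap.sub_apply, LinearMap.smul_apply, LinearMap.comp_apply,
        coneCoord_sum hg, LinearMap.zero_apply, LinearMap.proj_apply] at this
      rw [Pi.single_eq_same, Pi.single_eq_of_ne hij.symm] at this
      simp at this
      omega
    filter_upwards [ae_linear_ne_zero _ hL] with u hu
    simp only [LinearMap.sub_apply, LinearMap.smul_apply, LinearMap.comp_apply,
      LinearMap.proj_apply, smul_eq_mul, sub_ne_zero] at hu
    simp only [List.map_cons, List.map_nil, List.sum_cons, List.sum_nil, add_zero, coneInd]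
    have hu' := sum_coneCoord hg u
    set c := coneCoord (genR g) u
    have n1 := m1 c
    have n2 := m2 c
    have n0 := m0 c
    rw [hu'] at n0 n1 n2
    classical
    simp only [Set.indicator_apply, n0, n1, n2]
    by_cases h : ∀ k, 0 ≤ c k
    · simp only [h, implies_true, true_and, if_true]
      rcases lt_or_gt_of_ne hu with h' | h'
      · rw [if_pos h'.le, if_neg (not_le.2 h'), add_zero]
      · rw [if_neg (not_le.2 h'), if_pos h'.le, zero_add]
    · rw [if_neg h, if_neg, if_neg, add_zero]
      · rintro ⟨h1, h2⟩
        refine h fun k => ?_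
        rcases eq_or_ne k i with rfl | hk
        · have := mul_nonneg hq'.le (h1 j hij.symm)
          exact nonneg_of_mul_nonneg_right (this.trans h2) hp'
        · exact h1 k hk
      · rintro ⟨h1, h2⟩
        refine h fun k => ?_
        rcases eq_or_ne k j with rfl | hk
        · have := mul_nonneg hp'.le (h1 i hij)
          exact nonneg_of_mul_nonneg_right (this.trans h2) hq'
        · exact h1 k hk

open Classical in
theorem exists_refines_signConst (m : Fin n → ℤ) (t : ℕ) : ∀ g : Fin n → (Fin n → ℕ),
    (Matrix.of (genR g)).det ≠ 0 →
    (Finset.univ.filter fun k => formVal m (g k) ≠ 0).card ≤ t →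
    ∃ L, Refines g L ∧ ∀ h ∈ L, SignConst m h := by
  induction t with
  | zero =>
    intro g hg ht
    refine ⟨[g], Refines.refl hg, ?_⟩
    simp only [List.mem_singleton, forall_eq]
    have := Finset.card_eq_zero.1 (Nat.le_zero.1 ht)
    rw [Finset.filter_eq_empty_iff] at this
    exact Or.inl fun k => (not_not.1 (this (Finset.mem_univ k))).ge
  | succ t ih =>
    intro g hg ht
    by_cases hs : SignConst m g
    · exact ⟨[g], Refines.refl hg, by simpa using hs⟩
    unfold SignConst at hs
    push Not at hs
    obtain ⟨⟨j, hj⟩, i, hi⟩ := hs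
    have hij : i ≠ j := by rintro rfl; omega
    set p := (formVal m (g i)).toNat with hp
    set q := (-formVal m (g j)).toNat with hq
    have hp0 : 0 < p := by omega
    have hq0 : 0 < q := by omega
    have hz : formVal m (p • g j + q • g i) = 0 := by
      rw [formVal_combination]
      have h1 : (p : ℤ) = formVal m (g i) := by omega
      have h2 : (q : ℤ) = -formVal m (g j) := by omega
      rw [h1, h2]; ring
    have hR := Refines.split hg hij hp0 hq0
    have hcard : ∀ k₀, formVal m (g k₀) ≠ 0 → (Finset.univ.filter fun k =>
        formVal m (Function.update g k₀ (p • g j + q • g i) k) ≠ 0).card ≤ t := by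
      intro k₀ hk₀
      refine Nat.le_of_lt_succ (lt_of_lt_of_le (Finset.card_lt_card ?_) ht)
      refine Finset.ssubset_iff_of_subset (fun k hk => ?_) |>.2 ⟨k₀, by simpa using hk₀, by simpa using hz⟩
      simp only [Finset.mem_filter, Finset.mem_univ, true_and] at hk ⊢
      rcases eq_or_ne k k₀ with rfl | hkk
      · exact hk₀
      · rwa [Function.update_of_ne hkk] at hk
    have hA : ∀ h ∈ [Function.update g i (p • g j + q • g i),
        Function.update g j (q • g i + p • g j)], ∃ L, Refines h L ∧ ∀ h ∈ L, SignConst m h := by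
      intro h hh
      refine ih h (hR.1 h hh).1 ?_
      simp only [List.mem_cons, List.not_mem_nil, or_false] at hh
      rcases hh with rfl | rfl
      · exact hcard i hi.ne'
      · rw [add_comm (q • g i)]
        exact hcard j hj.ne
    choose! F hF using hA
    refine ⟨_, hR.flatMap F fun h hh => (hF h hh).1, fun k hk => ?_⟩
    obtain ⟨h, hh, hk⟩ := List.mem_flatMap.1 hk
    exact (hF h hh).2 k hk

theorem exists_refines_forall_signConst {g : Fin n → (Fin n → ℕ)}
    (hg : (Matrix.of (genR g)).det ≠ 0) (T : Finset (Fin n → ℤ)) :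
    ∃ L, Refines g L ∧ ∀ h ∈ L, ∀ m ∈ T, SignConst m h := by
  classical
  induction T using Finset.induction_on with
  | empty => exact ⟨[g], Refines.refl hg, by simp⟩
  | insert m T hm ih =>
    obtain ⟨L, h1, h2⟩ := ih
    have hA : ∀ h ∈ L, ∃ L', Refines h L' ∧ ∀ h ∈ L', SignConst m h := fun h hh =>
      exists_refines_signConst m _ h (h1.1 h hh).1 le_rfl
    choose! F hF using hA
    refine ⟨_, h1.flatMap F fun h hh => (hF h hh).1, fun k hk m' hm' => ?_⟩
    obtain ⟨h, hh, hk⟩ := List.mem_flatMap.1 hk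
    rcases Finset.mem_insert.1 hm' with rfl | hm'
    · exact (hF h hh).2 k hk
    · exact ((hF h hh).1.1 k hk).2 m' (h2 h hh m' hm')

end Cones

section Hull

/-- The natural number valued pairing of exponents. -/
def natDot (a α : Fin n → ℕ) : ℕ := ∑ i, a i * α i

theorem dot_natPt (a α : Fin n → ℕ) : dot (natPt a) (natPt α) = (natDot a α : ℝ) := by
  simp [dot, natPt, natDot]

theorem natDot_mono (a : Fin n → ℕ) {α β : Fin n → ℕ} (h : α ≤ β) : natDot a α ≤ natDot a β :=
  Finset.sum_le_sum fun i _ => Nat.mul_le_mul_left _ (h i)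

theorem natDot_sum {ι : Type*} (t : Finset ι) (a : ι → Fin n → ℕ) (α : Fin n → ℕ) :
    natDot (∑ j ∈ t, a j) α = ∑ j ∈ t, natDot (a j) α := by
  simp only [natDot, Finset.sum_apply, Finset.sum_mul]
  exact Finset.sum_comm

/-- The upward closed convex hull of a set of exponents. -/
def upHull (A : Set (Fin n → ℕ)) : Set (Fin n → ℝ) :=
  convexHull ℝ {x | ∃ α : Fin n → ℕ, α ∈ A ∧ ∀ i, (α i : ℝ) ≤ x i}

variable {A : Set (Fin n → ℕ)}

theorem dot_add (a x y : Fin n → ℝ) : dot a (x + y) = dot a x + dot a y := by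
  simp [dot, mul_add, Finset.sum_add_distrib]

theorem dot_smul (a x : Fin n → ℝ) (c : ℝ) : dot a (c • x) = c * dot a x := by
  simp only [dot, Finset.mul_sum, Pi.smul_apply, smul_eq_mul]
  exact Finset.sum_congr rfl fun i _ => by ring

theorem isLinearMap_dot (a : Fin n → ℝ) : IsLinearMap ℝ (dot a) :=
  ⟨dot_add a, fun c x => dot_smul a x c⟩

theorem dot_le_dot {a x y : Fin n → ℝ} (ha : ∀ i, 0 ≤ a i) (h : ∀ i, x i ≤ y i) :
    dot a x ≤ dot a y :=
  Finset.sum_le_sum fun i _ => mul_le_mul_of_nonneg_left (h i) (ha i)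

theorem natPt_mem_upHull {α : Fin n → ℕ} (hα : α ∈ A) : natPt α ∈ upHull A :=
  subset_convexHull ℝ _ ⟨α, hα, fun _ => le_rfl⟩

theorem le_dot_of_mem_upHull {a : Fin n → ℝ} (ha : ∀ i, 0 ≤ a i) {c : ℝ}
    (h : ∀ α ∈ A, c ≤ dot a (natPt α)) {x : Fin n → ℝ} (hx : x ∈ upHull A) : c ≤ dot a x := by
  have : upHull A ⊆ {x | c ≤ dot a x} := by
    refine convexHull_min ?_ (convex_halfSpace_ge (isLinearMap_dot a) c)
    rintro y ⟨α, hα, hy⟩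
    exact (h α hα).trans (dot_le_dot ha hy)
  exact this hx

theorem exists_dot_le_of_mem_upHull {a : Fin n → ℝ} (ha : ∀ i, 0 ≤ a i) {x : Fin n → ℝ}
    (hx : x ∈ upHull A) : ∃ α ∈ A, dot a (natPt α) ≤ dot a x := by
  by_contra! hcon
  have : upHull A ⊆ {y | dot a x < dot a y} := by
    refine convexHull_min ?_ (convex_halfSpace_gt (isLinearMap_dot a) _)
    rintro y ⟨α, hα, hy⟩
    exact (hcon α hα).trans_le (dot_le_dot ha hy)
  exact lt_irrefl (dot a x) (this hx)

theorem nonempty_of_upHull (h : (upHull A).Nonempty) : A.Nonempty := by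
  obtain ⟨x, α, hα, -⟩ := convexHull_nonempty_iff.1 h
  exact ⟨α, hα⟩

theorem natPt_nonneg (a : Fin n → ℕ) (i : Fin n) : 0 ≤ natPt a i := Nat.cast_nonneg _

theorem lval_upHull {a v : Fin n → ℕ} (hv : v ∈ A) (h : ∀ α ∈ A, natDot a v ≤ natDot a α) :
    lval (upHull A) (natPt a) = natDot a v := by
  refine le_antisymm (csInf_le ⟨natDot a v, ?_⟩ ⟨_, natPt_mem_upHull hv, dot_natPt a v⟩)
    (le_csInf ⟨_, _, natPt_mem_upHull hv, dot_natPt a v⟩ ?_)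
  all_goals
    rintro _ ⟨x, hx, rfl⟩
    refine le_dot_of_mem_upHull (natPt_nonneg a) (fun α hα => ?_) hx
    rw [dot_natPt]
    exact_mod_cast h α hα

theorem lval_le_dot {a : Fin n → ℕ} {x : Fin n → ℝ} (hx : x ∈ upHull A) :
    lval (upHull A) (natPt a) ≤ dot (natPt a) x := by
  refine csInf_le ⟨0, ?_⟩ ⟨x, hx, rfl⟩
  rintro _ ⟨x, hx, rfl⟩
  refine le_dot_of_mem_upHull (natPt_nonneg a) (fun α hα => ?_) hx
  rw [dot_natPt]
  exact Nat.cast_nonneg _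

/-- Every set of exponents has a finite subset which dominates it. -/
theorem exists_finset_le (A : Set (Fin n → ℕ)) :
    ∃ T : Finset (Fin n → ℕ), ↑T ⊆ A ∧ ∀ α ∈ A, ∃ v ∈ T, v ≤ α := by
  have hfin : {v | Minimal (· ∈ A) v}.Finite :=
    WellQuasiOrderedLE.finite_of_isAntichain (setOfPred_minimal_antichain _)
  refine ⟨hfin.toFinset, fun v hv => ((hfin.mem_toFinset).1 hv).1, fun α hα => ?_⟩
  obtain ⟨v, hv, hmin⟩ := exists_minimal_le_of_wellFoundedLT (· ∈ A) α hα
  exact ⟨v, hfin.mem_toFinset.2 hmin, hv⟩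

end Hull

/-- A decomposition of the octant (up to null sets, with weights) into simplicial cones on each of
which one exponent of `A` is minimal. -/
structure ChartSystem (A : Set (Fin n → ℕ)) where
  ι : Type
  fin : Fintype ι
  gen : ι → Fin n → (Fin n → ℕ)
  wt : ι → ℝ
  vtx : ι → Fin n → ℕ
  det_ne : ∀ σ, (Matrix.of (genR (gen σ))).det ≠ 0
  vtx_mem : ∀ σ, vtx σ ∈ A
  vtx_le : ∀ σ j, ∀ α ∈ A, natDot (gen σ j) (vtx σ) ≤ natDot (gen σ j) α
  covers : ∀ u ∈ octant n, ∃ σ, u ∈ coneSpan (genR (gen σ))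
  ae_sum : ∀ᵐ u : Fin n → ℝ, u ∈ octant n → ∑ σ, wt σ * coneInd (gen σ) u = 1

section Exists

/-- The cone generated by the standard basis. -/
def stdGen (n : ℕ) : Fin n → (Fin n → ℕ) := fun k => Pi.single k 1

theorem genR_stdGen : genR (stdGen n) = fun k => Pi.single k 1 := by
  funext k i
  rcases eq_or_ne i k with rfl | h
  · simp [genR, stdGen, natPt]
  · simp [genR, stdGen, natPt, h]

theorem det_stdGen : (Matrix.of (genR (stdGen n))).det = 1 := by
  rw [genR_stdGen]
  have : (Matrix.of fun k : Fin n => (Pi.single k (1 : ℝ) : Fin n → ℝ)) = 1 := by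
    ext i j
    rcases eq_or_ne i j with rfl | h
    · simp
    · simp [h, h.symm]
  rw [this, Matrix.det_one]

theorem coneSpan_stdGen : coneSpan (genR (stdGen n)) = octant n := by
  have h : ∀ u : Fin n → ℝ, ∑ j, u j • genR (stdGen n) j = u := by
    intro u
    rw [genR_stdGen]
    exact (pi_eq_sum_univ' u).symm
  ext u
  rw [← h u, sum_mem_coneSpan_iff (by rw [det_stdGen]; exact one_ne_zero), h u]
  rfl

theorem formVal_sub (v w a : Fin n → ℕ) :
    formVal (fun i => (v i : ℤ) - w i) a = natDot a v - natDot a w := by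
  simp only [formVal, natDot]
  push_cast
  rw [← Finset.sum_sub_distrib]
  exact Finset.sum_congr rfl fun i _ => by ring

theorem exists_vertex {A : Set (Fin n → ℕ)} (hA : A.Nonempty) {T : Finset (Fin n → ℕ)}
    (hTA : ↑T ⊆ A) (hT : ∀ α ∈ A, ∃ v ∈ T, v ≤ α) {g : Fin n → (Fin n → ℕ)}
    (hg : ∀ v ∈ T, ∀ w ∈ T, SignConst (fun i => (v i : ℤ) - w i) g) :
    ∃ v ∈ A, ∀ j, ∀ α ∈ A, natDot (g j) v ≤ natDot (g j) α := by
  obtain ⟨α₀, hα₀⟩ := hA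
  obtain ⟨v₀, hv₀, -⟩ := hT α₀ hα₀
  obtain ⟨v, hv, hmin⟩ := T.exists_min_image (fun v => ∑ j, natDot (g j) v) ⟨v₀, hv₀⟩
  refine ⟨v, hTA hv, fun j α hα => ?_⟩
  obtain ⟨w, hw, hwα⟩ := hT α hα
  refine le_trans ?_ (natDot_mono (g j) hwα)
  rcases hg v hv w hw with h | h
  · have h' : ∀ j, natDot (g j) w ≤ natDot (g j) v := fun j => by
      have := h j
      rw [formVal_sub] at this
      omega
    have := (Finset.sum_eq_sum_iff_of_le fun j _ => h' j).1
      (le_antisymm (Finset.sum_le_sum fun j _ => h' j) (hmin w hw)) j (Finset.mem_univ _)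
    exact this.ge
  · have := h j
    rw [formVal_sub] at this
    omega

theorem nonempty_chartSystem {A : Set (Fin n → ℕ)} (hA : A.Nonempty) :
    Nonempty (ChartSystem A) := by
  obtain ⟨T, hTA, hT⟩ := exists_finset_le A
  obtain ⟨L, hL, hs⟩ := exists_refines_forall_signConst (g := stdGen n)
    (by rw [det_stdGen]; exact one_ne_zero)
    ((T ×ˢ T).image fun p i => (p.1 i : ℤ) - p.2 i)
  have hv : ∀ σ : Fin L.length, ∃ v ∈ A, ∀ j, ∀ α ∈ A,
      natDot (L[σ] j) v ≤ natDot (L[σ] j) α := fun σ =>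
    exists_vertex hA hTA hT fun v hv w hw => hs _ (List.getElem_mem _) _
      (Finset.mem_image.2 ⟨(v, w), Finset.mk_mem_product hv hw, rfl⟩)
  choose v hv1 hv2 using hv
  refine ⟨⟨Fin L.length, inferInstance, fun σ => L[σ], fun _ => 1, v,
    fun σ => (hL.1 _ (List.getElem_mem _)).1, hv1, hv2, fun u hu => ?_, ?_⟩⟩
  · obtain ⟨h, hh, hu⟩ := hL.2.1 u (coneSpan_stdGen (n := n) ▸ hu)
    obtain ⟨i, hi, rfl⟩ := List.getElem_of_mem hh
    exact ⟨⟨i, hi⟩, hu⟩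
  · filter_upwards [hL.2.2] with u hu huo
    simp only [one_mul]
    have := Fin.sum_univ_fun_getElem L fun h => coneInd h u
    refine (this.trans hu).trans ?_
    rw [coneInd, coneSpan_stdGen, Set.indicator_of_mem huo]

end Exists

section Subdivision

variable {A : Set (Fin n → ℕ)}

theorem exists_vertex_of_subordinate (S : SimplicialSubdivision n (upHull A)) (σ : S.ι) :
    ∃ v ∈ A, ∀ j, ∀ α ∈ A, natDot (S.gen σ j) v ≤ natDot (S.gen σ j) α := by
  obtain ⟨γ, ⟨m, l, hval, hγ⟩, ⟨y, hy⟩, hsub⟩ := S.subordinate σ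
  have hyΓ : y ∈ upHull A := by rw [hγ] at hy; exact hy.1
  have hlow : ∀ j, ∀ α ∈ A, lval (upHull A) (natPt (S.gen σ j)) ≤ natDot (S.gen σ j) α :=
    fun j α hα => dot_natPt (S.gen σ j) α ▸ lval_le_dot (natPt_mem_upHull hα)
  obtain ⟨v, hv, hle⟩ := exists_dot_le_of_mem_upHull (a := natPt (∑ j, S.gen σ j))
    (natPt_nonneg _) hyΓ
  have hsum : dot (natPt (∑ j, S.gen σ j)) y = ∑ j, lval (upHull A) (natPt (S.gen σ j)) := by
    have : natPt (∑ j, S.gen σ j) = ∑ j, natPt (S.gen σ j) := by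
      funext i
      simp [natPt]
    rw [this]
    simp only [dot, Finset.sum_apply, Finset.sum_mul]
    rw [Finset.sum_comm]
    exact Finset.sum_congr rfl fun j _ => hsub j y hy
  rw [hsum, dot_natPt, natDot_sum] at hle
  push_cast at hle
  have heq := (Finset.sum_eq_sum_iff_of_le fun j _ => hlow j v hv).1
    (le_antisymm (Finset.sum_le_sum fun j _ => hlow j v hv) hle)
  refine ⟨v, hv, fun j α hα => ?_⟩
  have h1 := heq j (Finset.mem_univ _)
  have h2 := hlow j α hα
  rw [h1] at h2
  exact_mod_cast h2

theorem det_gen_ne_zero {Γ : Set (Fin n → ℝ)} (S : SimplicialSubdivision n Γ) (σ : S.ι) :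
    (Matrix.of (genR (S.gen σ))).det ≠ 0 := by
  have h := S.unimodular σ
  have h1 : (Matrix.of (genR (S.gen σ))).det =
      (((Matrix.of fun j k => (S.gen σ j k : ℤ)).det : ℤ) : ℝ) := by
    rw [show (((Matrix.of fun j k => (S.gen σ j k : ℤ)).det : ℤ) : ℝ) =
      Int.castRingHom ℝ (Matrix.of fun j k => (S.gen σ j k : ℤ)).det from rfl, RingHom.map_det]
    congr 1
  rw [h1]
  intro h0
  have : (Matrix.of fun j k => (S.gen σ j k : ℤ)).det = 0 := by exact_mod_cast h0
  rw [this] at h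
  simp at h

/-- Cones which share a point with nonzero coordinates coincide. -/
theorem coneSpan_eq_of_mem {Γ : Set (Fin n → ℝ)} (S : SimplicialSubdivision n Γ) {σ τ : S.ι}
    {u : Fin n → ℝ} (hu : ∀ j, coneCoord (genR (S.gen σ)) u j ≠ 0)
    (hσ : u ∈ coneSpan (genR (S.gen σ))) (hτ : u ∈ coneSpan (genR (S.gen τ))) :
    coneSpan (genR (S.gen σ)) ⊆ coneSpan (genR (S.gen τ)) := by
  obtain ⟨s, -, hs⟩ := S.compatible σ τ
  have hmem : u ∈ coneSpanSub (genR (S.gen σ)) s := hs ▸ ⟨hσ, hτ⟩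
  obtain ⟨c, -, hc0, rfl⟩ := hmem
  rw [coneCoord_sum (det_gen_ne_zero S σ)] at hu
  have hs' : s = Finset.univ := Finset.eq_univ_iff_forall.2 fun j => by
    by_contra hj
    exact hu j (hc0 j hj)
  rw [hs'] at hs
  intro x hx
  have hx' : x ∈ coneSpan (genR (S.gen σ)) ∩ coneSpan (genR (S.gen τ)) := by
    rw [hs]
    exact hx
  exact hx'.2

open Classical in
/-- A simplicial subdivision of the fan of the Newton polyhedron gives a chart system. -/
noncomputable def chartSystemOf (S : SimplicialSubdivision n (upHull A)) : ChartSystem A where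
  ι := S.ι
  fin := S.fin
  gen := S.gen
  wt σ := let := S.fin
    ((Finset.univ.filter fun τ => coneSpan (genR (S.gen τ)) = coneSpan (genR (S.gen σ))).card : ℝ)⁻¹
  vtx σ := (exists_vertex_of_subordinate S σ).choose
  det_ne := det_gen_ne_zero S
  vtx_mem σ := (exists_vertex_of_subordinate S σ).choose_spec.1
  vtx_le σ := (exists_vertex_of_subordinate S σ).choose_spec.2
  covers := S.covers
  ae_sum := by
    let := S.fin
    have h : ∀ᵐ u : Fin n → ℝ, ∀ σ : S.ι, ∀ j, coneCoord (genR (S.gen σ)) u j ≠ 0 :=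
      ae_all_iff.2 fun σ => ae_coneCoord_ne_zero (det_gen_ne_zero S σ)
    filter_upwards [h] with u hu huo
    obtain ⟨σ, hσ⟩ := S.covers u huo
    have key : ∀ τ : S.ι, coneInd (S.gen τ) u =
        if coneSpan (genR (S.gen τ)) = coneSpan (genR (S.gen σ)) then 1 else 0 := by
      intro τ
      split_ifs with h
      · rw [coneInd, Set.indicator_of_mem (h ▸ hσ)]
      · rw [coneInd, Set.indicator_of_notMem]
        exact fun hτ => h (subset_antisymm (coneSpan_eq_of_mem S (hu τ) hτ hσ)
          (coneSpan_eq_of_mem S (hu σ) hσ hτ))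
    simp only [key, mul_ite, mul_one, mul_zero]
    rw [← Finset.sum_filter]
    have h2 : ∀ τ ∈ Finset.univ.filter fun τ =>
        coneSpan (genR (S.gen τ)) = coneSpan (genR (S.gen σ)),
        ((Finset.univ.filter fun τ' =>
          coneSpan (genR (S.gen τ')) = coneSpan (genR (S.gen τ))).card : ℝ)⁻¹ =
        ((Finset.univ.filter fun τ' =>
          coneSpan (genR (S.gen τ')) = coneSpan (genR (S.gen σ))).card : ℝ)⁻¹ := by
      intro τ hτ
      rw [(Finset.mem_filter.1 hτ).2]
    rw [Finset.sum_congr rfl h2, Finset.sum_const, nsmul_eq_mul, mul_inv_cancel₀]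
    have : 0 < (Finset.univ.filter fun τ' =>
        coneSpan (genR (S.gen τ')) = coneSpan (genR (S.gen σ))).card :=
      Finset.card_pos.2 ⟨σ, by simp⟩
    exact_mod_cast this.ne'

end Subdivision

section PartialDerivatives

variable {f g : (Fin n → ℝ) → ℝ}

theorem contDiff_pderiv1 (hf : ContDiff ℝ (⊤ : ℕ∞) f) (i : Fin n) :
    ContDiff ℝ (⊤ : ℕ∞) (pderiv1 i f) :=
  contDiff_dirD hf _

theorem contDiff_iterate_pderiv1 (hf : ContDiff ℝ (⊤ : ℕ∞) f) (i : Fin n) (k : ℕ) :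
    ContDiff ℝ (⊤ : ℕ∞) ((pderiv1 i)^[k] f) := by
  induction k with
  | zero => exact hf
  | succ k ih =>
    rw [Function.iterate_succ_apply']
    exact contDiff_pderiv1 ih i

theorem pderiv1_comm (hf : ContDiff ℝ (⊤ : ℕ∞) f) (i j : Fin n) :
    pderiv1 i (pderiv1 j f) = pderiv1 j (pderiv1 i f) := by
  have h : ∀ (v w x : Fin n → ℝ), fderiv ℝ (fun y => fderiv ℝ f y v) x w =
      fderiv ℝ (fderiv ℝ f) x w v := by
    intro v w x
    have hd : DifferentiableAt ℝ (fderiv ℝ f) x :=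
      ((hf.fderiv_right (m := (⊤ : ℕ∞)) le_rfl).differentiable (by simp)) x
    rw [fderiv_clm_apply hd (differentiableAt_const v)]
    simp
  funext x
  have hs : IsSymmSndFDerivAt ℝ f x :=
    (hf.contDiffAt (x := x)).isSymmSndFDerivAt (by
      rw [minSmoothness_of_isRCLikeNormedField]
      exact WithTop.coe_le_coe.2 (le_top : (2 : ℕ∞) ≤ ⊤))
  show fderiv ℝ (fun y => fderiv ℝ f y _) x _ = fderiv ℝ (fun y => fderiv ℝ f y _) x _
  rw [h, h]
  exact hs _ _

theorem iterate_pderiv1_comm (hf : ContDiff ℝ (⊤ : ℕ∞) f) (i j : Fin n) (k : ℕ) :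
    (pderiv1 i)^[k] (pderiv1 j f) = pderiv1 j ((pderiv1 i)^[k] f) := by
  induction k with
  | zero => rfl
  | succ k ih =>
    rw [Function.iterate_succ_apply', ih, Function.iterate_succ_apply',
      pderiv1_comm (contDiff_iterate_pderiv1 hf i k)]

theorem pderiv1_eventuallyEq {x : Fin n → ℝ} (h : f =ᶠ[𝓝 x] g) (i : Fin n) :
    pderiv1 i f =ᶠ[𝓝 x] pderiv1 i g :=
  (h.fderiv (𝕜 := ℝ)).mono fun y hy => by simp only [pderiv1, hy]

theorem mderiv_eventuallyEq {x : Fin n → ℝ} (h : f =ᶠ[𝓝 x] g) (α : Fin n → ℕ) :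
    mderiv α f =ᶠ[𝓝 x] mderiv α g := by
  have key : ∀ L : List (Fin n), L.foldr (fun i g => (pderiv1 i)^[α i] g) f =ᶠ[𝓝 x]
      L.foldr (fun i g => (pderiv1 i)^[α i] g) g := by
    intro L
    induction L with
    | nil => exact h
    | cons i L ih =>
      simp only [List.foldr_cons]
      induction α i with
      | zero => exact ih
      | succ k ihk =>
        simp only [Function.iterate_succ_apply']
        exact pderiv1_eventuallyEq ihk i
  exact key _

theorem taylorCoeff_congr (h : f =ᶠ[𝓝 0] g) (α : Fin n → ℕ) :
    taylorCoeff f α = taylorCoeff g α := by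
  rw [taylorCoeff, taylorCoeff, (mderiv_eventuallyEq h α).eq_of_nhds]

theorem contDiff_foldr_pderiv1 (hf : ContDiff ℝ (⊤ : ℕ∞) f) (α : Fin n → ℕ) (L : List (Fin n)) :
    ContDiff ℝ (⊤ : ℕ∞) (L.foldr (fun i g => (pderiv1 i)^[α i] g) f) := by
  induction L with
  | nil => exact hf
  | cons i L ih => exact contDiff_iterate_pderiv1 ih i _

theorem foldr_pderiv1_comm (hf : ContDiff ℝ (⊤ : ℕ∞) f) (α : Fin n → ℕ) (j : Fin n)
    (L : List (Fin n)) : L.foldr (fun i g => (pderiv1 i)^[α i] g) (pderiv1 j f) =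
      pderiv1 j (L.foldr (fun i g => (pderiv1 i)^[α i] g) f) := by
  induction L with
  | nil => rfl
  | cons i L ih =>
    simp only [List.foldr_cons]
    rw [ih, iterate_pderiv1_comm (contDiff_foldr_pderiv1 hf α L)]

theorem mderiv_add_single (hf : ContDiff ℝ (⊤ : ℕ∞) f) (α : Fin n → ℕ) (j : Fin n) :
    mderiv (α + Pi.single j 1) f = mderiv α (pderiv1 j f) := by
  have hnot : ∀ L : List (Fin n), j ∉ L →
      L.foldr (fun i g => (pderiv1 i)^[(α + Pi.single j 1 : Fin n → ℕ) i] g) f =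
      L.foldr (fun i g => (pderiv1 i)^[α i] g) f := by
    intro L hj
    induction L with
    | nil => rfl
    | cons i L ih =>
      simp only [List.mem_cons, not_or] at hj
      simp only [List.foldr_cons]
      rw [ih hj.2, Pi.add_apply, Pi.single_eq_of_ne (Ne.symm hj.1), add_zero]
  have key : ∀ L : List (Fin n), L.Nodup → j ∈ L →
      L.foldr (fun i g => (pderiv1 i)^[(α + Pi.single j 1 : Fin n → ℕ) i] g) f =
      L.foldr (fun i g => (pderiv1 i)^[α i] g) (pderiv1 j f) := by
    intro L hL hj
    induction L with
    | nil => simp at hj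
    | cons i L ih =>
      rw [List.nodup_cons] at hL
      simp only [List.foldr_cons]
      rcases eq_or_ne i j with rfl | hij
      · rw [hnot L hL.1, foldr_pderiv1_comm hf, Pi.add_apply, Pi.single_eq_same,
          Function.iterate_add_apply]
        rfl
      · rw [ih hL.2 ((List.mem_cons.1 hj).resolve_left hij.symm), Pi.add_apply,
          Pi.single_eq_of_ne hij, add_zero]
  exact key _ (List.nodup_finRange n) (List.mem_finRange j)

theorem mderiv_zero (f : (Fin n → ℝ) → ℝ) : mderiv 0 f = f := by
  have key : ∀ L : List (Fin n),
      L.foldr (fun i g => (pderiv1 i)^[(0 : Fin n → ℕ) i] g) f = f := by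
    intro L
    induction L with
    | nil => rfl
    | cons i L ih => exact ih
  exact key _

theorem multiIndex_induction {Q : (Fin n → ℕ) → Prop} (h0 : Q 0)
    (hs : ∀ β j, Q β → Q (β + Pi.single j 1)) (β : Fin n → ℕ) : Q β := by
  induction hk : ∑ i, β i generalizing β with
  | zero =>
    have : β = 0 := funext fun i => (Finset.sum_eq_zero_iff.1 hk) i (Finset.mem_univ i)
    exact this ▸ h0
  | succ k ih =>
    obtain ⟨j, -, hj⟩ := Finset.exists_ne_zero_of_sum_ne_zero
      (show ∑ i, β i ≠ 0 from hk.symm ▸ Nat.succ_ne_zero k)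
    have hβ : β = (β - Pi.single j 1) + Pi.single j 1 := by
      funext i
      rcases eq_or_ne i j with rfl | h
      · simp only [Pi.add_apply, Pi.sub_apply, Pi.single_eq_same]
        omega
      · simp [h]
    rw [hβ]
    refine hs _ _ (ih _ ?_)
    have : ∑ i, (Pi.single j 1 : Fin n → ℕ) i = 1 := by simp
    rw [hβ] at hk
    simp only [Pi.add_apply, Finset.sum_add_distrib, this] at hk
    exact Nat.succ_injective hk

theorem mderiv_sub (hf : ContDiff ℝ (⊤ : ℕ∞) f) (hg : ContDiff ℝ (⊤ : ℕ∞) g) (β : Fin n → ℕ) :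
    mderiv β (f - g) = mderiv β f - mderiv β g := by
  induction β using multiIndex_induction generalizing f g with
  | h0 => simp only [mderiv_zero]
  | hs β j ih =>
    rw [mderiv_add_single (f := f - g) (hf.sub hg), mderiv_add_single hf, mderiv_add_single hg,
      ← ih (contDiff_pderiv1 hf j) (contDiff_pderiv1 hg j)]
    congr 1
    funext x
    simp only [pderiv1, Pi.sub_apply]
    rw [fderiv_sub (hf.differentiable (by simp) x) (hg.differentiable (by simp) x)]
    rfl

theorem mderiv_sum {ι : Type*} (t : Finset ι) (c : ι → ℝ) {F : ι → (Fin n → ℝ) → ℝ}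
    (hF : ∀ k, ContDiff ℝ (⊤ : ℕ∞) (F k)) (β : Fin n → ℕ) :
    mderiv β (fun x => ∑ k ∈ t, c k * F k x) = fun x => ∑ k ∈ t, c k * mderiv β (F k) x := by
  induction β using multiIndex_induction generalizing F with
  | h0 => simp only [mderiv_zero]
  | hs β j ih =>
    rw [mderiv_add_single (ContDiff.sum fun k _ => contDiff_const.mul (hF k))]
    simp only [fun k => mderiv_add_single (hF k) β j]
    rw [← ih fun k => contDiff_pderiv1 (hF k) j]
    congr 1
    funext x
    have : HasFDerivAt (fun x => ∑ k ∈ t, c k * F k x) (∑ k ∈ t, c k • fderiv ℝ (F k) x) x :=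
      HasFDerivAt.fun_sum fun k _ =>
        (((hF k).differentiable (by simp) x).hasFDerivAt).const_mul (c k)
    simp only [pderiv1, this.fderiv]
    simp

end PartialDerivatives

section Monomials

/-- The monomial with exponent `α`. -/
def mon (α : Fin n → ℕ) (x : Fin n → ℝ) : ℝ := ∏ i, x i ^ α i

theorem contDiff_mon (α : Fin n → ℕ) : ContDiff ℝ (⊤ : ℕ∞) (mon α) :=
  contDiff_prod fun i _ => (contDiff_apply ℝ ℝ i).pow (α i)

theorem pderiv1_mon (α : Fin n → ℕ) (j : Fin n) :
    pderiv1 j (mon α) = fun x => (α j : ℝ) * mon (α - Pi.single j 1) x := by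
  funext x
  have h1 : HasDerivAt (fun t : ℝ => mon α (x + t • Pi.single j 1)) (pderiv1 j (mon α) x) 0 :=
    hasLineDerivAt_dirD (contDiff_mon α) (Pi.single j 1) x
  have h2 : HasDerivAt (fun t : ℝ => (x j + t) ^ α j * ∏ i ∈ Finset.univ.erase j, x i ^ α i)
      ((α j : ℝ) * (x j + 0) ^ (α j - 1) * 1 * ∏ i ∈ Finset.univ.erase j, x i ^ α i) 0 :=
    (((hasDerivAt_id (0 : ℝ)).const_add (x j)).pow (α j)).mul_const _
  have h3 : (fun t : ℝ => mon α (x + t • Pi.single j 1)) =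
      fun t : ℝ => (x j + t) ^ α j * ∏ i ∈ Finset.univ.erase j, x i ^ α i := by
    funext t
    rw [mon, ← Finset.mul_prod_erase _ _ (Finset.mem_univ j)]
    congr 1
    · simp
    · refine Finset.prod_congr rfl fun i hi => ?_
      simp [Finset.ne_of_mem_erase hi]
  rw [h3] at h1
  rw [h1.unique h2, mon, ← Finset.mul_prod_erase _ _ (Finset.mem_univ j), add_zero, mul_one,
    mul_assoc]
  congr 2
  · simp
  · refine Finset.prod_congr rfl fun i hi => ?_
    simp [Finset.ne_of_mem_erase hi]

theorem mderiv_mon_zero (α β : Fin n → ℕ) :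
    mderiv β (mon α) 0 = if α = β then ((∏ i, Nat.factorial (β i) : ℕ) : ℝ) else 0 := by
  induction β using multiIndex_induction generalizing α with
  | h0 =>
    rw [mderiv_zero]
    split_ifs with h
    · simp [mon, h]
    · obtain ⟨i, hi⟩ := Function.ne_iff.1 h
      exact Finset.prod_eq_zero (Finset.mem_univ i) (by simpa using hi)
  | hs β j ih =>
    rw [mderiv_add_single (contDiff_mon α), pderiv1_mon]
    have := mderiv_sum (Finset.univ : Finset Unit) (fun _ => (α j : ℝ))
      (F := fun _ => mon (α - Pi.single j 1)) (fun _ => contDiff_mon _) β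
    simp only [Finset.univ_unique, Finset.sum_singleton] at this
    rw [this]
    simp only [ih]
    rcases Nat.eq_zero_or_pos (α j) with h0 | hpos
    · rw [if_neg (c := α = _)]
      · simp [h0]
      · rintro rfl
        simp at h0
    · have hiff : α - Pi.single j 1 = β ↔ α = β + Pi.single j 1 := by
        constructor
        · rintro rfl
          funext i
          rcases eq_or_ne i j with rfl | h
          · simp only [Pi.add_apply, Pi.sub_apply, Pi.single_eq_same]
            omega
          · simp [h]
        · rintro rfl
          funext i
          simp
      simp only [hiff]
      split_ifs with h
      · have hfac : ∏ i, Nat.factorial ((β + Pi.single j 1 : Fin n → ℕ) i) =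
            (β j + 1) * ∏ i, Nat.factorial (β i) := by
          have h1 : ∏ i ∈ Finset.univ.erase j, Nat.factorial ((β + Pi.single j 1 : Fin n → ℕ) i) =
              ∏ i ∈ Finset.univ.erase j, Nat.factorial (β i) :=
            Finset.prod_congr rfl fun i hi => by simp [Finset.ne_of_mem_erase hi]
          refine (Finset.mul_prod_erase Finset.univ
            (fun i => Nat.factorial ((β + Pi.single j 1 : Fin n → ℕ) i))
            (Finset.mem_univ j)).symm.trans ?_
          refine (congrArg _ h1).trans ?_
          rw [← Finset.mul_prod_erase Finset.univ (fun i => Nat.factorial (β i))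
              (Finset.mem_univ j), Pi.add_apply, Pi.single_eq_same, Nat.factorial_succ, mul_assoc]
        have hfac' := congrArg (Nat.cast : ℕ → ℝ) hfac
        rw [h]
        refine Eq.trans ?_ hfac'.symm
        rw [Nat.cast_mul, Pi.add_apply, Pi.single_eq_same]
      · simp

theorem mon_scaleAction (α a : Fin n → ℕ) (t : ℝ) (x : Fin n → ℝ) :
    mon α (scaleAction a t x) = t ^ natDot a α * mon α x := by
  simp only [mon, scaleAction, natDot, mul_pow, ← pow_mul, Finset.prod_mul_distrib,
    Finset.prod_pow_eq_pow_sum]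

end Monomials

section Taylor

theorem norm_fderiv_le_sum (f : (Fin n → ℝ) → ℝ) (x : Fin n → ℝ) :
    ‖fderiv ℝ f x‖ ≤ ∑ i, |pderiv1 i f x| := by
  refine ContinuousLinearMap.opNorm_le_bound _ (Finset.sum_nonneg fun _ _ => abs_nonneg _)
    fun v => ?_
  conv_lhs => rw [pi_eq_sum_univ' v]
  rw [map_sum, Finset.sum_mul]
  refine (norm_sum_le _ _).trans (Finset.sum_le_sum fun i _ => ?_)
  rw [map_smul, smul_eq_mul, norm_mul, mul_comm]
  exact mul_le_mul_of_nonneg_left (norm_le_pi_norm v i) (abs_nonneg _)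

theorem exists_bound_of_mderiv_eq_zero (N : ℕ) {h : (Fin n → ℝ) → ℝ}
    (hh : ContDiff ℝ (⊤ : ℕ∞) h) (h0 : ∀ β : Fin n → ℕ, ∑ i, β i < N → mderiv β h 0 = 0) :
    ∃ C, 0 ≤ C ∧ ∀ x, ‖x‖ ≤ 1 → |h x| ≤ C * ‖x‖ ^ N := by
  induction N generalizing h with
  | zero =>
    obtain ⟨C, hC⟩ := (isCompact_closedBall (0 : Fin n → ℝ) 1).exists_bound_of_continuousOn
      hh.continuous.continuousOn
    refine ⟨max C 0, le_max_right _ _, fun x hx => ?_⟩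
    rw [pow_zero, mul_one]
    exact (hC x (by simpa using hx)).trans (le_max_left _ _)
  | succ N ih =>
    have hi : ∀ i, ∃ C, 0 ≤ C ∧ ∀ x, ‖x‖ ≤ 1 → |pderiv1 i h x| ≤ C * ‖x‖ ^ N := fun i =>
      ih (contDiff_pderiv1 hh i) fun β hβ => by
        rw [← mderiv_add_single hh]
        refine h0 _ ?_
        simp only [Pi.add_apply, Finset.sum_add_distrib, Finset.sum_pi_single', Finset.mem_univ,
          if_true]
        omega
    choose C hC0 hC using hi
    refine ⟨∑ i, C i, Finset.sum_nonneg fun i _ => hC0 i, fun x hx => ?_⟩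
    have hb : ∀ y ∈ Metric.closedBall (0 : Fin n → ℝ) ‖x‖,
        ‖fderiv ℝ h y‖ ≤ (∑ i, C i) * ‖x‖ ^ N := by
      intro y hy
      rw [mem_closedBall_zero_iff] at hy
      refine (norm_fderiv_le_sum h y).trans ?_
      rw [Finset.sum_mul]
      exact Finset.sum_le_sum fun i _ => (hC i y (hy.trans hx)).trans
        (mul_le_mul_of_nonneg_left (pow_le_pow_left₀ (norm_nonneg _) hy _) (hC0 i))
    have := (convex_closedBall (0 : Fin n → ℝ) ‖x‖).norm_image_sub_le_of_norm_fderiv_le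
      (fun y _ => hh.differentiable (by simp) y) hb (x := 0) (y := x) (by simp) (by simp)
    have hz : h 0 = 0 := by
      have := h0 0 (by simp)
      rwa [mderiv_zero] at this
    rw [hz, sub_zero, sub_zero, mul_assoc, ← pow_succ] at this
    exact this

variable {f : (Fin n → ℝ) → ℝ}

/-- Subtracting a Taylor polynomial leaves a small remainder. -/
theorem exists_taylor_bound (hf : ContDiff ℝ (⊤ : ℕ∞) f) (l : ℕ) :
    ∃ C, 0 ≤ C ∧ ∀ x, ‖x‖ ≤ 1 →
      |f x - ∑ α ∈ Fintype.piFinset fun _ : Fin n => Finset.range (l + 1),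
        taylorCoeff f α * mon α x| ≤ C * ‖x‖ ^ (l + 1) := by
  have hP : ContDiff ℝ (⊤ : ℕ∞) fun x => ∑ α ∈ Fintype.piFinset fun _ : Fin n =>
      Finset.range (l + 1), taylorCoeff f α * mon α x :=
    ContDiff.sum fun α _ => contDiff_const.mul (contDiff_mon α)
  refine exists_bound_of_mderiv_eq_zero (l + 1) (hf.sub hP) fun β hβ => ?_
  change mderiv β (f - _) 0 = 0
  rw [mderiv_sub hf hP, mderiv_sum _ _ contDiff_mon]
  have hmem : β ∈ Fintype.piFinset fun _ : Fin n => Finset.range (l + 1) := by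
    rw [Fintype.mem_piFinset]
    intro i
    have := Finset.single_le_sum (f := β) (fun _ _ => Nat.zero_le _) (Finset.mem_univ i)
    rw [Finset.mem_range]
    omega
  simp only [Pi.sub_apply, mderiv_mon_zero, mul_ite, mul_zero]
  rw [Finset.sum_ite_eq' _ _ _, if_pos hmem, taylorCoeff, div_mul_cancel₀, sub_self]
  exact Nat.cast_ne_zero.2 (Finset.prod_ne_zero_iff.2 fun i _ => Nat.factorial_ne_zero _)

/-- The quasihomogeneous leading part of `f`. -/
theorem tendsto_scaleAction_div (hf : ContDiff ℝ (⊤ : ℕ∞) f) {a : Fin n → ℕ} (ha : ∀ i, 0 < a i)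
    {l : ℕ} (hl : ∀ α, taylorCoeff f α ≠ 0 → l ≤ natDot a α) (x : Fin n → ℝ) :
    Tendsto (fun t : ℝ => f (scaleAction a t x) / t ^ l) (𝓝[>] 0)
      (𝓝 (∑ α ∈ (Fintype.piFinset fun _ : Fin n => Finset.range (l + 1)),
        if natDot a α = l then taylorCoeff f α * mon α x else 0)) := by
  obtain ⟨C, hC0, hC⟩ := exists_taylor_bound hf l
  set P : (Fin n → ℝ) → ℝ := fun x => ∑ α ∈ Fintype.piFinset fun _ : Fin n => Finset.range (l + 1),
        taylorCoeff f α * mon α x with hPdef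
  have hlim : Tendsto (fun t : ℝ => P (scaleAction a t x) / t ^ l) (𝓝[>] 0)
      (𝓝 (∑ α ∈ (Fintype.piFinset fun _ : Fin n => Finset.range (l + 1)),
        if natDot a α = l then taylorCoeff f α * mon α x else 0)) := by
    simp only [hPdef, Finset.sum_div]
    refine tendsto_finsetSum _ fun α _ => ?_
    have hc : ∀ k : ℕ, natDot a α = l + k → ∀ t : ℝ, t ∈ Ioi (0 : ℝ) →
        t ^ k * (taylorCoeff f α * mon α x) =
        taylorCoeff f α * mon α (scaleAction a t x) / t ^ l := by
      intro k hk t ht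
      have : t ^ l ≠ 0 := pow_ne_zero _ (ne_of_gt ht)
      rw [mon_scaleAction, hk, pow_add]
      field_simp
    rcases eq_or_ne (taylorCoeff f α) 0 with h0 | h0
    · simp [h0]
    · obtain ⟨k, hk⟩ := Nat.exists_eq_add_of_le (hl α h0)
      have hlimk : Tendsto (fun t : ℝ => t ^ k * (taylorCoeff f α * mon α x)) (𝓝[>] 0)
          (𝓝 ((0 : ℝ) ^ k * (taylorCoeff f α * mon α x))) :=
        ((continuous_pow k).mul continuous_const).tendsto' _ _ rfl |>.mono_left
          nhdsWithin_le_nhds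
      refine (hlimk.congr' (eventually_nhdsWithin_of_forall (hc k hk))).trans_eq ?_
      split_ifs with h
      · have : k = 0 := by omega
        simp [this]
      · have : k ≠ 0 := by omega
        simp [this]
  have hrem : Tendsto (fun t : ℝ => (f (scaleAction a t x) - P (scaleAction a t x)) / t ^ l)
      (𝓝[>] 0) (𝓝 0) := by
    have hz : Tendsto (fun t : ℝ => C * ‖x‖ ^ (l + 1) * t) (𝓝[>] 0) (𝓝 0) :=
      ((continuous_const.mul continuous_id).tendsto' _ _ (by simp)).mono_left nhdsWithin_le_nhds
    refine squeeze_zero_norm' ?_ hz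
    have hsmall : ∀ᶠ t : ℝ in 𝓝[>] 0, t * ‖x‖ < 1 :=
      (((continuous_id.mul continuous_const).tendsto' (0 : ℝ) 0 (by simp)).mono_left
        nhdsWithin_le_nhds).eventually (gt_mem_nhds one_pos)
    have hsmall' : ∀ᶠ t : ℝ in 𝓝[>] 0, t < 1 :=
      nhdsWithin_le_nhds (gt_mem_nhds one_pos)
    filter_upwards [hsmall, hsmall', self_mem_nhdsWithin] with t h1 h2 (h3 : 0 < t)
    have hn : ‖scaleAction a t x‖ ≤ t * ‖x‖ := by
      refine (pi_norm_le_iff_of_nonneg (by positivity)).2 fun i => ?_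
      rw [scaleAction, norm_mul, norm_pow, Real.norm_of_nonneg h3.le]
      exact mul_le_mul (pow_le_of_le_one h3.le h2.le (ha i).ne') (norm_le_pi_norm x i)
        (norm_nonneg _) h3.le
    have := (hC _ (hn.trans h1.le)).trans
      (mul_le_mul_of_nonneg_left (pow_le_pow_left₀ (norm_nonneg _) hn _) hC0)
    rw [norm_div, norm_pow, Real.norm_of_nonneg h3.le, div_le_iff₀ (by positivity)]
    refine this.trans_eq ?_
    rw [mul_pow, pow_succ t]
    ring
  have := hrem.add hlim
  rw [zero_add] at this
  refine this.congr fun t => ?_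
  ring

/-- The polynomial part on a compact face. -/
theorem gammaPartPoly_eq_sum {a : Fin n → ℕ} (ha : ∀ i, 0 < a i) (l : ℕ) (x : Fin n → ℝ) :
    gammaPartPoly f (NewtonPolyhedron f ∩ Hplane (natPt a) l) x =
      ∑ α ∈ (Fintype.piFinset fun _ : Fin n => Finset.range (l + 1)),
        if natDot a α = l then taylorCoeff f α * mon α x else 0 := by
  classical
  rw [gammaPartPoly]
  have h1 := tsum_subtype {α : Fin n → ℕ | natPt α ∈ NewtonPolyhedron f ∩ Hplane (natPt a) l}
    fun α => taylorCoeff f α * ∏ i, x i ^ α i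
  refine h1.trans ?_
  have h2 : ∀ α : Fin n → ℕ,
      ({α : Fin n → ℕ | natPt α ∈ NewtonPolyhedron f ∩ Hplane (natPt a) l}.indicator
        (fun α => taylorCoeff f α * ∏ i, x i ^ α i) α : ℝ) =
      if natDot a α = l then taylorCoeff f α * mon α x else 0 := by
    intro α
    rw [Set.indicator_apply]
    rcases eq_or_ne (taylorCoeff f α) 0 with h0 | h0
    · simp [h0]
    · have hiff : α ∈ {α : Fin n → ℕ | natPt α ∈ NewtonPolyhedron f ∩ Hplane (natPt a) l} ↔
          natDot a α = l := by
        constructor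
        · rintro ⟨-, h⟩
          have : dot (natPt a) (natPt α) = l := h
          rw [dot_natPt] at this
          exact_mod_cast this
        · intro h
          refine ⟨natPt_mem_upHull (A := {α | taylorCoeff f α ≠ 0}) h0, ?_⟩
          show dot (natPt a) (natPt α) = l
          rw [dot_natPt, h]
      simp only [hiff]
      rfl
  simp only [h2]
  refine tsum_eq_sum fun α hα => if_neg fun h => hα ?_
  rw [Fintype.mem_piFinset]
  intro i
  have h3 : a i * α i ≤ natDot a α :=
    Finset.single_le_sum (f := fun i => a i * α i) (fun _ _ => Nat.zero_le _) (Finset.mem_univ i)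
  have h4 : α i ≤ a i * α i := Nat.le_mul_of_pos_left _ (ha i)
  rw [Finset.mem_range]
  omega

end Taylor

section CompactFace

variable {A : Set (Fin n → ℕ)}

/-- A face with positive conormal is compact. -/
theorem isCompact_face {a : Fin n → ℕ} (ha : ∀ i, 0 < a i) {l : ℕ}
    (hl : ∀ α ∈ A, l ≤ natDot a α) : IsCompact (upHull A ∩ Hplane (natPt a) l) := by
  set B : Set (Fin n → ℝ) := natPt '' {α | α ∈ A ∧ natDot a α = l} with hB
  have hfin : B.Finite := by
    refine Set.Finite.image _ (Set.Finite.subset (Set.finite_Iic fun _ => l) fun α hα i => ?_)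
    have h3 : a i * α i ≤ natDot a α :=
      Finset.single_le_sum (f := fun i => a i * α i) (fun _ _ => Nat.zero_le _)
        (Finset.mem_univ i)
    exact (Nat.le_mul_of_pos_left _ (ha i)).trans (h3.trans hα.2.le)
  have hBl : convexHull ℝ B ⊆ {x | dot (natPt a) x = l} := by
    refine convexHull_min ?_ ?_
    · rintro _ ⟨α, hα, rfl⟩
      show dot (natPt a) (natPt α) = l
      rw [dot_natPt, hα.2]
    · exact convex_hyperplane (isLinearMap_dot _) _
  have hsub : upHull A ⊆ {x | (l : ℝ) < dot (natPt a) x} ∪ convexHull ℝ B := by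
    refine convexHull_min ?_ ?_
    · rintro y ⟨α, hα, hy⟩
      have h1 := dot_le_dot (natPt_nonneg a) hy
      by_cases h : (l : ℝ) < dot (natPt a) y
      · exact Or.inl h
      · right
        have h2 : (l : ℝ) ≤ dot (natPt a) (natPt α) := by
          rw [dot_natPt]
          exact_mod_cast hl α hα
        have heq : dot (natPt a) (natPt α) = l :=
          le_antisymm (h1.trans (not_lt.1 h)) h2
        have h3 := (Finset.sum_eq_sum_iff_of_le fun i _ =>
          mul_le_mul_of_nonneg_left (hy i) (natPt_nonneg a i)).1
          (le_antisymm h1 ((not_lt.1 h).trans_eq heq.symm))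
        have h4 : y = natPt α := funext fun i =>
          (mul_left_cancel₀ (Nat.cast_ne_zero.2 (ha i).ne') (h3 i (Finset.mem_univ i))).symm
        rw [h4]
        refine subset_convexHull ℝ _ ⟨α, ⟨hα, ?_⟩, rfl⟩
        rw [dot_natPt] at heq
        exact_mod_cast heq
    · rw [convex_iff_forall_pos]
      intro x hx y hy p q hp hq hpq
      have hge : ∀ z ∈ {x | (l : ℝ) < dot (natPt a) x} ∪ convexHull ℝ B,
          (l : ℝ) ≤ dot (natPt a) z := by
        rintro z (hz | hz)
        · exact le_of_lt hz
        · exact (hBl hz).ge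
      by_cases h : (l : ℝ) < dot (natPt a) (p • x + q • y)
      · exact Or.inl h
      · right
        rw [dot_add, dot_smul, dot_smul, not_lt] at h
        have hx1 := hge x hx
        have hy1 := hge y hy
        have hl' : (l : ℝ) = p * l + q * l := by rw [← add_mul, hpq, one_mul]
        have hx2 : ¬ (l : ℝ) < dot (natPt a) x := fun hlt => by
          nlinarith [mul_lt_mul_of_pos_left hlt hp, mul_le_mul_of_nonneg_left hy1 hq.le]
        have hy2 : ¬ (l : ℝ) < dot (natPt a) y := fun hlt => by
          nlinarith [mul_lt_mul_of_pos_left hlt hq, mul_le_mul_of_nonneg_left hx1 hp.le]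
        exact convex_convexHull ℝ B (hx.resolve_left hx2) (hy.resolve_left hy2) hp.le hq.le hpq
  have : upHull A ∩ Hplane (natPt a) l = convexHull ℝ B := by
    refine subset_antisymm (fun x hx => (hsub hx.1).resolve_left fun h => ?_)
      (fun x hx => ⟨convexHull_min ?_ (convex_convexHull ℝ _) hx, hBl hx⟩)
    · exact (ne_of_gt (show (l : ℝ) < dot (natPt a) x from h)) hx.2
    · rintro _ ⟨α, hα, rfl⟩
      exact natPt_mem_upHull hα.1
  rw [this]
  exact hfin.isCompact_convexHull ℝ

theorem isFaceOf_inter_Hplane {a : Fin n → ℕ} {l : ℕ} (hl : ∀ α ∈ A, l ≤ natDot a α) :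
    IsFaceOf (upHull A) (upHull A ∩ Hplane (natPt a) l) := by
  have h : intPt (fun i => (a i : ℤ)) = natPt a := by
    funext i
    simp [intPt, natPt]
  refine ⟨fun i => a i, l, fun x hx => ?_, ?_⟩
  · rw [h]
    refine le_dot_of_mem_upHull (natPt_nonneg a) (fun α hα => ?_) hx
    rw [dot_natPt]
    exact_mod_cast hl α hα
  · rw [h, Int.cast_natCast]

end CompactFace

section ParametricIntegral

variable {V : Type} [NormedAddCommGroup V] [NormedSpace ℝ V] [ProperSpace V]

theorem hasFDerivAt_intervalIntegral_param {G : Type} [NormedAddCommGroup G] [NormedSpace ℝ G]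
    [CompleteSpace G] {F : V × ℝ → G} (hF : ContDiff ℝ (⊤ : ℕ∞) F) (x₀ : V) :
    HasFDerivAt (fun x => ∫ t in (0 : ℝ)..1, F (x, t))
      (∫ t in (0 : ℝ)..1, (fderiv ℝ F (x₀, t)).comp (ContinuousLinearMap.inl ℝ V ℝ)) x₀ := by
  have hcont : Continuous fun p : V × ℝ =>
      (fderiv ℝ F p).comp (ContinuousLinearMap.inl ℝ V ℝ) :=
    (hF.continuous_fderiv (by simp)).clm_comp continuous_const
  obtain ⟨C, hC⟩ := ((isCompact_closedBall x₀ 1).prod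
    (isCompact_Icc (a := (0 : ℝ)) (b := 1))).exists_bound_of_continuousOn hcont.continuousOn
  refine intervalIntegral.hasFDerivAt_integral_of_dominated_of_fderiv_le
    (F := fun x t => F (x, t))
    (F' := fun x t => (fderiv ℝ F (x, t)).comp (ContinuousLinearMap.inl ℝ V ℝ))
    (bound := fun _ => C) (Metric.ball_mem_nhds x₀ one_pos) ?_ ?_ ?_ ?_ ?_ ?_
  · exact Eventually.of_forall fun x =>
      (hF.continuous.comp (by fun_prop : Continuous fun t : ℝ => (x, t))).aestronglyMeasurable
  · exact (hF.continuous.comp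
      (by fun_prop : Continuous fun t : ℝ => (x₀, t))).intervalIntegrable _ _
  · exact (hcont.comp (by fun_prop : Continuous fun t : ℝ => (x₀, t))).aestronglyMeasurable
  · refine Eventually.of_forall fun t ht x hx => hC (x, t) ⟨Metric.ball_subset_closedBall hx, ?_⟩
    rw [uIoc_of_le zero_le_one] at ht
    exact Ioc_subset_Icc_self ht
  · exact intervalIntegrable_const
  · refine Eventually.of_forall fun t _ x _ => ?_
    have h1 : HasFDerivAt (fun y : V => (y, t)) (ContinuousLinearMap.inl ℝ V ℝ) x :=
      hasFDerivAt_prodMk_left x t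
    exact ((hF.differentiable (by simp) (x, t)).hasFDerivAt).comp x h1

theorem contDiff_intervalIntegral_param {G : Type} [NormedAddCommGroup G] [NormedSpace ℝ G]
    [CompleteSpace G] {F : V × ℝ → G} (hF : ContDiff ℝ (⊤ : ℕ∞) F) :
    ContDiff ℝ (⊤ : ℕ∞) fun x => ∫ t in (0 : ℝ)..1, F (x, t) := by
  refine contDiff_infty.2 fun k => ?_
  induction k generalizing G with
  | zero =>
    exact contDiff_zero.2 (continuous_iff_continuousAt.2 fun x =>
      (hasFDerivAt_intervalIntegral_param hF x).continuousAt)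
  | succ k ih =>
    push_cast
    refine contDiff_succ_iff_fderiv.2 ⟨fun x =>
      (hasFDerivAt_intervalIntegral_param hF x).differentiableAt, by simp, ?_⟩
    have : (fderiv ℝ fun x => ∫ t in (0 : ℝ)..1, F (x, t)) = fun x => ∫ t in (0 : ℝ)..1,
        (fderiv ℝ F (x, t)).comp (ContinuousLinearMap.inl ℝ V ℝ) :=
      funext fun x => (hasFDerivAt_intervalIntegral_param hF x).fderiv
    rw [this]
    exact ih (F := fun p => (fderiv ℝ F p).comp (ContinuousLinearMap.inl ℝ V ℝ))
      ((hF.fderiv_right (m := (⊤ : ℕ∞)) le_rfl).clm_comp contDiff_const)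

end ParametricIntegral

section Hadamard

variable {H : (Fin n → ℝ) × (Fin n → ℝ) → ℝ}

/-- The Hadamard quotient in the `j`-th variable of the first factor. -/
noncomputable def hadQuot (j : Fin n) (H : (Fin n → ℝ) × (Fin n → ℝ) → ℝ)
    (p : (Fin n → ℝ) × (Fin n → ℝ)) : ℝ :=
  ∫ t in (0 : ℝ)..1, dirD ((Pi.single j 1 : Fin n → ℝ), (0 : Fin n → ℝ)) H
    (Function.update p.1 j (t * p.1 j), p.2)

theorem contDiff_hadQuot (hH : ContDiff ℝ (⊤ : ℕ∞) H) (j : Fin n) :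
    ContDiff ℝ (⊤ : ℕ∞) (hadQuot j H) := by
  have hc : ContDiff ℝ (⊤ : ℕ∞) fun q : ((Fin n → ℝ) × (Fin n → ℝ)) × ℝ =>
      ((Function.update q.1.1 j (q.2 * q.1.1 j), q.1.2) : (Fin n → ℝ) × (Fin n → ℝ)) := by
    refine ContDiff.prodMk (contDiff_pi.2 fun i => ?_) (by fun_prop)
    rcases eq_or_ne i j with rfl | h
    · simp only [Function.update_self]
      fun_prop
    · simp only [Function.update_of_ne h]
      fun_prop
  exact contDiff_intervalIntegral_param
    (F := fun q : ((Fin n → ℝ) × (Fin n → ℝ)) × ℝ =>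
      dirD ((Pi.single j 1 : Fin n → ℝ), (0 : Fin n → ℝ)) H
        (Function.update q.1.1 j (q.2 * q.1.1 j), q.1.2))
    ((contDiff_dirD hH _).comp hc)

theorem eq_add_hadQuot (hH : ContDiff ℝ (⊤ : ℕ∞) H) (j : Fin n) (y w : Fin n → ℝ) :
    H (y, w) = H (Function.update y j 0, w) + y j * hadQuot j H (y, w) := by
  have hd : ∀ t : ℝ, HasDerivAt (fun t : ℝ => H (Function.update y j (t * y j), w))
      (y j * dirD ((Pi.single j 1 : Fin n → ℝ), (0 : Fin n → ℝ)) H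
        (Function.update y j (t * y j), w)) t := by
    intro t
    have hc : HasDerivAt (fun t : ℝ =>
        ((Function.update y j (t * y j), w) : (Fin n → ℝ) × (Fin n → ℝ)))
        (y j • ((Pi.single j 1 : Fin n → ℝ), (0 : Fin n → ℝ))) t := by
      rw [Prod.smul_mk, smul_zero]
      refine HasDerivAt.prodMk (hasDerivAt_pi.2 fun i => ?_) (hasDerivAt_const t w)
      rcases eq_or_ne i j with rfl | h
      · simpa using (hasDerivAt_id t).mul_const (y i)
      · simpa [h] using hasDerivAt_const t (y i)
    have := ((hH.differentiable (by simp) _).hasFDerivAt).comp_hasDerivAt t hc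
    rw [map_smul, smul_eq_mul] at this
    exact this
  have hint : IntervalIntegrable (fun t => y j *
      dirD ((Pi.single j 1 : Fin n → ℝ), (0 : Fin n → ℝ)) H
        (Function.update y j (t * y j), w)) volume 0 1 := by
    refine Continuous.intervalIntegrable (continuous_const.mul
      ((contDiff_dirD hH _).continuous.comp ?_)) _ _
    exact Continuous.prodMk (Continuous.update (f := fun _ : ℝ => y) continuous_const j
      (continuous_id.mul continuous_const)) continuous_const
  have := intervalIntegral.integral_eq_sub_of_hasDerivAt (fun t _ => hd t) hint
  rw [intervalIntegral.integral_const_mul] at this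
  simp only [one_mul, zero_mul, Function.update_eq_self] at this
  have h2 : hadQuot j H (y, w) = ∫ t in (0 : ℝ)..1,
      dirD ((Pi.single j 1 : Fin n → ℝ), (0 : Fin n → ℝ)) H
        (Function.update y j (t * y j), w) := rfl
  rw [h2, this]
  ring

/-- A smooth function all of whose weighted limits at the coordinate hyperplanes exist is divisible
by the corresponding monomial. -/
theorem exists_monomial_division (hH : ContDiff ℝ (⊤ : ℕ∞) H) (l : Fin n → ℕ)
    (W : Set (Fin n → ℝ))
    (hlim : ∀ j, ∀ y ∈ box n, ∀ w ∈ W, ∃ c : ℝ,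
      Tendsto (fun t : ℝ => H (Function.update y j t, w) / t ^ l j) (𝓝[>] 0) (𝓝 c)) :
    ∃ g : (Fin n → ℝ) × (Fin n → ℝ) → ℝ, ContDiff ℝ (⊤ : ℕ∞) g ∧
      ∀ y ∈ box n, ∀ w ∈ W, H (y, w) = mon l y * g (y, w) := by
  have key : ∀ m : Fin n → ℕ, m ≤ l → ∃ g : (Fin n → ℝ) × (Fin n → ℝ) → ℝ,
      ContDiff ℝ (⊤ : ℕ∞) g ∧ ∀ y ∈ box n, ∀ w ∈ W, H (y, w) = mon m y * g (y, w) := by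
    intro m
    induction m using multiIndex_induction with
    | h0 => exact fun _ => ⟨H, hH, fun y _ w _ => by simp [mon]⟩
    | hs m j ih =>
      intro hm
      have hmj : m j + 1 ≤ l j := by simpa using hm j
      obtain ⟨g, hg, hgH⟩ := ih fun i => le_trans (by simp) (hm i)
      refine ⟨hadQuot j g, contDiff_hadQuot hg j, fun y hy w hw => ?_⟩
      have hy' : ∀ i, 0 < y i ∧ y i ≤ 1 := fun i => hy i (Set.mem_univ i)
      have hzero : g (Function.update y j 0, w) = 0 := by
        obtain ⟨c, hc⟩ := hlim j y hy w hw
        set Y : ℝ := ∏ i ∈ Finset.univ.erase j, y i ^ m i with hY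
        have hYpos : 0 < Y := Finset.prod_pos fun i _ => pow_pos (hy' i).1 _
        have h1 : Tendsto (fun t : ℝ => g (Function.update y j t, w)) (𝓝[>] 0)
            (𝓝 (g (Function.update y j 0, w))) := by
          refine (Continuous.tendsto' ?_ _ _ rfl).mono_left nhdsWithin_le_nhds
          exact hg.continuous.comp (Continuous.prodMk (Continuous.update (f := fun _ : ℝ => y)
            continuous_const j continuous_id) continuous_const)
        obtain ⟨k, hk⟩ := Nat.exists_eq_add_of_lt (Nat.lt_of_succ_le hmj)
        have h2 : Tendsto (fun t : ℝ => H (Function.update y j t, w) / t ^ l j *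
            (t ^ (k + 1) / Y)) (𝓝[>] 0) (𝓝 (c * ((0 : ℝ) ^ (k + 1) / Y))) := by
          refine hc.mul ?_
          exact (((continuous_pow (k + 1)).div_const Y).tendsto' _ _ rfl).mono_left
            nhdsWithin_le_nhds
        rw [zero_pow (Nat.succ_ne_zero k), zero_div, mul_zero] at h2
        refine tendsto_nhds_unique (h1.congr' ?_) h2
        have hsmall : ∀ᶠ t : ℝ in 𝓝[>] 0, t < 1 := nhdsWithin_le_nhds (gt_mem_nhds one_pos)
        filter_upwards [hsmall, self_mem_nhdsWithin] with t ht1 (ht0 : 0 < t)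
        have hbox : Function.update y j t ∈ box n := by
          intro i _
          rcases eq_or_ne i j with rfl | h
          · rw [Function.update_self]
            exact ⟨ht0, ht1.le⟩
          · rw [Function.update_of_ne h]
            exact hy' i
        have hmon : mon m (Function.update y j t) = t ^ m j * Y := by
          rw [mon, ← Finset.mul_prod_erase _ _ (Finset.mem_univ j), Function.update_self]
          congr 1
          exact Finset.prod_congr rfl fun i hi => by
            rw [Function.update_of_ne (Finset.ne_of_mem_erase hi)]
        rw [hgH _ hbox w hw, hmon, show l j = m j + (k + 1) by omega, pow_add]
        field_simp
      have hmon : mon (m + Pi.single j 1) y = mon m y * y j := by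
        rw [mon, mon]
        simp only [Pi.add_apply, pow_add, Finset.prod_mul_distrib]
        congr 1
        rw [Finset.prod_eq_single j (fun i _ h => by simp [h]) (by simp)]
        simp
      rw [hgH y hy w hw, eq_add_hadQuot hg j y w, hzero, hmon]
      ring
  exact key l le_rfl

end Hadamard

section Charts

variable {a : Fin n → Fin n → ℕ} {y r : Fin n → ℝ}

/-- The monomial map whose `i`-th coordinate is `∏ⱼ yⱼ ^ (aⱼ)ᵢ`. -/
def chartPi (a : Fin n → Fin n → ℕ) (y : Fin n → ℝ) : Fin n → ℝ :=
  fun i => mon (fun j => a j i) y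

/-- The coordinatewise negative logarithm. -/
noncomputable def negLog (r : Fin n → ℝ) : Fin n → ℝ := fun i => -Real.log (r i)

theorem mem_box : y ∈ box n ↔ ∀ i, y i ∈ Ioc (0 : ℝ) 1 := Set.mem_univ_pi

theorem mon_mem_Ioc (α : Fin n → ℕ) (hy : y ∈ box n) : mon α y ∈ Ioc (0 : ℝ) 1 :=
  ⟨Finset.prod_pos fun i _ => pow_pos (mem_box.1 hy i).1 _,
    Finset.prod_le_one (fun i _ => pow_nonneg (mem_box.1 hy i).1.le _)
      fun i _ => pow_le_one₀ (mem_box.1 hy i).1.le (mem_box.1 hy i).2⟩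

theorem chartPi_mem_box (a : Fin n → Fin n → ℕ) (hy : y ∈ box n) : chartPi a y ∈ box n :=
  mem_box.2 fun _ => mon_mem_Ioc _ hy

theorem contDiff_chartPi (a : Fin n → Fin n → ℕ) : ContDiff ℝ (⊤ : ℕ∞) (chartPi a) :=
  contDiff_pi.2 fun _ => contDiff_mon _

theorem mon_chartPi (a : Fin n → Fin n → ℕ) (v : Fin n → ℕ) (y : Fin n → ℝ) :
    mon v (chartPi a y) = mon (fun j => natDot (a j) v) y := by
  simp only [mon, chartPi, natDot, ← Finset.prod_pow, ← pow_mul, ← Finset.prod_pow_eq_pow_sum]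
  exact Finset.prod_comm

theorem negLog_chartPi (a : Fin n → Fin n → ℕ) (hy : y ∈ box n) :
    negLog (chartPi a y) = ∑ j, negLog y j • genR a j := by
  funext i
  simp only [negLog, chartPi, mon, Finset.sum_apply, Pi.smul_apply, genR, natPt, smul_eq_mul]
  rw [Real.log_prod fun j _ => pow_ne_zero _ (mem_box.1 hy j).1.ne', ← Finset.sum_neg_distrib]
  exact Finset.sum_congr rfl fun j _ => by rw [Real.log_pow]; ring

theorem negLog_mem_octant (hr : r ∈ box n) : negLog r ∈ octant n := fun i =>
  neg_nonneg.2 (Real.log_nonpos (mem_box.1 hr i).1.le (mem_box.1 hr i).2)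

theorem exp_neg_negLog (hr : r ∈ box n) : (fun i => Real.exp (-negLog r i)) = r := by
  funext i
  simp only [negLog, neg_neg, Real.exp_log (mem_box.1 hr i).1]

theorem exp_neg_mem_box {u : Fin n → ℝ} (hu : u ∈ octant n) :
    (fun i => Real.exp (-u i)) ∈ box n :=
  mem_box.2 fun i => ⟨Real.exp_pos _, Real.exp_le_one_iff.2 (neg_nonpos.2 (hu i))⟩

theorem negLog_exp_neg (u : Fin n → ℝ) : negLog (fun i => Real.exp (-u i)) = u := by
  funext i
  simp only [negLog, Real.log_exp, neg_neg]

theorem injOn_negLog : InjOn negLog (box n) := fun r hr r' hr' h => by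
  rw [← exp_neg_negLog hr, ← exp_neg_negLog hr', h]

theorem image_chartPi (ha : (Matrix.of (genR a)).det ≠ 0) :
    chartPi a '' box n = box n ∩ {r | negLog r ∈ coneSpan (genR a)} := by
  ext r
  constructor
  · rintro ⟨y, hy, rfl⟩
    refine ⟨chartPi_mem_box a hy, ?_⟩
    rw [mem_ofPred_eq, negLog_chartPi a hy, sum_mem_coneSpan_iff ha]
    exact negLog_mem_octant hy
  · rintro ⟨hr, hc⟩
    rw [mem_ofPred_eq, mem_coneSpan_iff ha] at hc
    refine ⟨_, exp_neg_mem_box hc, injOn_negLog (chartPi_mem_box a (exp_neg_mem_box hc)) hr ?_⟩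
    rw [negLog_chartPi a (exp_neg_mem_box hc), negLog_exp_neg, sum_coneCoord ha]

theorem injOn_chartPi (ha : (Matrix.of (genR a)).det ≠ 0) : InjOn (chartPi a) (box n) := by
  intro y hy y' hy' h
  have := congrArg (fun r => coneCoord (genR a) (negLog r)) h
  simp only [negLog_chartPi a hy, negLog_chartPi a hy', coneCoord_sum ha] at this
  exact injOn_negLog hy hy' this

/-- The sum of the entries of the `j`-th vector. -/
def wtSum (a : Fin n → Fin n → ℕ) (j : Fin n) : ℕ := ∑ i, a j i

theorem one_le_wtSum (ha : (Matrix.of (genR a)).det ≠ 0) (j : Fin n) : 1 ≤ wtSum a j := by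
  by_contra h
  have h0 : wtSum a j = 0 := by omega
  refine ha (Matrix.det_eq_zero_of_row_eq_zero j fun i => ?_)
  have := (Finset.sum_eq_zero_iff.1 h0) i (Finset.mem_univ i)
  simp [genR, natPt, this]

theorem pderiv1_mon_of_pos (α : Fin n → ℕ) (j : Fin n) (hy : y j ≠ 0) :
    pderiv1 j (mon α) y = α j * mon α y * (y j)⁻¹ := by
  rw [pderiv1_mon]
  rcases Nat.eq_zero_or_pos (α j) with h | h
  · simp [h]
  · have : mon α y = mon (α - Pi.single j 1) y * y j := by
      refine (Finset.mul_prod_erase _ _ (Finset.mem_univ j)).symm.trans (.trans ?_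
        (congrArg (· * y j) (Finset.mul_prod_erase Finset.univ
          (fun i => y i ^ (α - Pi.single j 1 : Fin n → ℕ) i) (Finset.mem_univ j))))
      rw [mul_right_comm, ← pow_succ]
      congr 1
      · congr 1
        simp only [Pi.sub_apply, Pi.single_eq_same]
        omega
      · refine Finset.prod_congr rfl fun i hi => ?_
        rw [Pi.sub_apply, Pi.single_eq_of_ne (Finset.ne_of_mem_erase hi), Nat.sub_zero]
    rw [this]
    field_simp

theorem det_fderiv_chartPi (ha : (Matrix.of (genR a)).det ≠ 0) (hy : y ∈ box n) :
    (fderiv ℝ (chartPi a) y).det =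
      (Matrix.of (genR a)).det * ∏ j, y j ^ (wtSum a j - 1) := by
  have hy0 : ∀ j, y j ≠ 0 := fun j => (mem_box.1 hy j).1.ne'
  have h1 : LinearMap.toMatrix' (fderiv ℝ (chartPi a) y : (Fin n → ℝ) →ₗ[ℝ] (Fin n → ℝ)) =
      Matrix.diagonal (chartPi a y) * (Matrix.of (genR a)).transpose *
        Matrix.diagonal (fun j => (y j)⁻¹) := by
    ext i j
    have hd : fderiv ℝ (chartPi a) y (Pi.single j 1) i = pderiv1 j (mon fun j => a j i) y := by
      have := fderiv_pi (𝕜 := ℝ) (x := y) (φ := fun i y => chartPi a y i)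
        fun i => ((contDiff_mon fun j => a j i).differentiable (by simp)) y
      change (fderiv ℝ (fun y i => chartPi a y i) y) (Pi.single j 1) i = _
      rw [this]
      rfl
    rw [LinearMap.toMatrix'_apply, Matrix.mul_diagonal, Matrix.diagonal_mul]
    simp only [ContinuousLinearMap.coe_coe, hd, pderiv1_mon_of_pos _ j (hy0 j)]
    simp only [chartPi, Matrix.transpose_apply, Matrix.of_apply, genR, natPt]
    ring
  rw [ContinuousLinearMap.det, ← LinearMap.det_toMatrix', h1, Matrix.det_mul, Matrix.det_mul,
    Matrix.det_diagonal, Matrix.det_diagonal, Matrix.det_transpose,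
    mul_comm (∏ i, chartPi a y i), mul_assoc]
  congr 1
  simp only [chartPi, mon]
  rw [Finset.prod_comm, ← Finset.prod_mul_distrib]
  refine Finset.prod_congr rfl fun j _ => ?_
  have : wtSum a j = wtSum a j - 1 + 1 := (Nat.sub_add_cancel (one_le_wtSum ha j)).symm
  rw [Finset.prod_pow_eq_pow_sum, show ∑ i, a j i = wtSum a j from rfl]
  nth_rewrite 1 [this]
  rw [pow_succ, mul_assoc, mul_inv_cancel₀ (hy0 j), mul_one]

theorem measurableSet_coneSpan (ha : (Matrix.of (genR a)).det ≠ 0) :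
    MeasurableSet (coneSpan (genR a)) := by
  have : coneSpan (genR a) = ⋂ j, {u | 0 ≤ coneCoord (genR a) u j} := by
    ext u
    simp [mem_coneSpan_iff ha]
  rw [this]
  refine MeasurableSet.iInter fun j => measurableSet_le measurable_const ?_
  exact (measurable_pi_apply j).comp
    (LinearMap.continuous_of_finiteDimensional (coneCoord (genR a))).measurable

theorem measurable_negLog : Measurable (negLog (n := n)) :=
  measurable_pi_iff.2 fun i => ((measurable_pi_apply i).log).neg

theorem integral_box_coneInd (ha : (Matrix.of (genR a)).det ≠ 0) (G : (Fin n → ℝ) → ℂ) :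
    ∫ r in box n, ((coneInd a (negLog r) : ℝ) : ℂ) * G r =
      ((|(Matrix.of (genR a)).det| : ℝ) : ℂ) *
        ∫ y in box n, ((∏ j, y j ^ (wtSum a j - 1) : ℝ) : ℂ) * G (chartPi a y) := by
  classical
  have hT : MeasurableSet {r : Fin n → ℝ | negLog r ∈ coneSpan (genR a)} :=
    measurable_negLog (measurableSet_coneSpan ha)
  have h1 : (fun r => ((coneInd a (negLog r) : ℝ) : ℂ) * G r) =
      {r | negLog r ∈ coneSpan (genR a)}.indicator G := by
    funext r
    simp only [coneInd, Set.indicator_apply, mem_ofPred_eq]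
    split_ifs <;> simp
  rw [h1, setIntegral_indicator hT, ← image_chartPi ha,
    integral_image_eq_integral_abs_det_fderiv_smul volume (measurableSet_box n)
      (fun y _ => (((contDiff_chartPi a).differentiable (by simp)) y).hasFDerivAt.hasFDerivWithinAt)
      (injOn_chartPi ha), ← integral_const_mul]
  refine setIntegral_congr_fun (measurableSet_box n) fun y hy => ?_
  rw [det_fderiv_chartPi ha hy, abs_mul, abs_of_nonneg (a := ∏ j, _)
    (Finset.prod_nonneg fun j _ => pow_nonneg (mem_box.1 hy j).1.le _), Complex.real_smul,
    Complex.ofReal_mul, mul_assoc]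

theorem ae_box_of_ae_octant {Q : (Fin n → ℝ) → Prop} (h : ∀ᵐ u : Fin n → ℝ, u ∈ octant n → Q u) :
    ∀ᵐ r ∂(volume.restrict (box n)), Q (negLog r) := by
  rw [ae_restrict_iff' (measurableSet_box n)]
  have hN : volume {u : Fin n → ℝ | ¬(u ∈ octant n → Q u)} = 0 := h
  refine measure_mono_null ?_ (addHaar_image_eq_zero_of_differentiableOn_of_addHaar_eq_zero volume
    (f := fun (u : Fin n → ℝ) i => Real.exp (-u i)) ?_ hN)
  · intro r hr
    simp only [mem_compl_iff, mem_ofPred_eq, Classical.not_imp] at hr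
    exact ⟨negLog r, fun hcon => hr.2 (hcon (negLog_mem_octant hr.1)), exp_neg_negLog hr.1⟩
  · refine Differentiable.differentiableOn (differentiable_pi.2 fun i => ?_)
    exact ((differentiable_apply (𝕜 := ℝ) i).neg).exp

end Charts

section Averaging

theorem deriv_eq_zero_of_eqOn {χ : ℝ → ℝ} {s : Set ℝ} (hs : IsOpen s) {c : ℝ}
    (h : ∀ u ∈ s, χ u = c) {u : ℝ} (hu : u ∈ s) : deriv χ u = 0 := by
  have : χ =ᶠ[𝓝 u] fun _ => c := by
    filter_upwards [hs.mem_nhds hu] with v hv using h v hv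
  rw [this.deriv_eq, deriv_const]

theorem exists_multiplicative_bump {lam : ℝ} (hlam : 0 < lam) :
    ∃ ρ : ℝ → ℝ, ContDiff ℝ (⊤ : ℕ∞) ρ ∧ (∀ u, ρ u ≠ 0 → lam ≤ |u| ∧ |u| ≤ 2 * lam) ∧
      ∀ x : ℝ, x ≠ 0 → |x| ≤ lam → ∫ r in Ioc (0 : ℝ) 1, r⁻¹ * ρ (x / r) = 1 := by
  set χ : ℝ → ℝ := fun u => Real.smoothTransition ((u ^ 2 - lam ^ 2) / (3 * lam ^ 2)) with hχ
  have h3 : 0 < 3 * lam ^ 2 := by positivity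
  have hχs : ContDiff ℝ (⊤ : ℕ∞) χ := Real.smoothTransition.contDiff.comp
    (((contDiff_id.pow 2).sub contDiff_const).div_const _)
  have hχ0 : ∀ u, |u| ≤ lam → χ u = 0 := fun u hu =>
    Real.smoothTransition.zero_of_nonpos (div_nonpos_of_nonpos_of_nonneg
      (by nlinarith [sq_abs u, abs_nonneg u]) h3.le)
  have hχ1 : ∀ u, 2 * lam ≤ |u| → χ u = 1 := fun u hu =>
    Real.smoothTransition.one_of_one_le ((one_le_div h3).2 (by nlinarith [sq_abs u, abs_nonneg u]))
  have hχ' : ContDiff ℝ (⊤ : ℕ∞) (deriv χ) := (contDiff_infty_iff_deriv.1 hχs).2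
  have hsupp : ∀ u, u * deriv χ u ≠ 0 → lam ≤ |u| ∧ |u| ≤ 2 * lam := by
    intro u hu
    have hd := right_ne_zero_of_mul hu
    constructor
    · by_contra! hcon
      exact hd (deriv_eq_zero_of_eqOn (isOpen_Iio.preimage continuous_abs)
        (fun v hv => hχ0 v (le_of_lt hv)) hcon)
    · by_contra! hcon
      exact hd (deriv_eq_zero_of_eqOn (isOpen_Ioi.preimage continuous_abs)
        (fun v hv => hχ1 v (le_of_lt hv)) hcon)
  refine ⟨fun u => u * deriv χ u, contDiff_id.mul hχ', hsupp, fun x hx hxl => ?_⟩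
  have hx' : 0 < |x| := abs_pos.2 hx
  set c : ℝ := |x| / (3 * lam) with hc
  have hc0 : 0 < c := by positivity
  have hc1 : c ≤ 1 := (div_le_one (by positivity)).2 (by linarith)
  have hsub : ∫ r in Ioc (0 : ℝ) 1, r⁻¹ * (x / r * deriv χ (x / r)) =
      ∫ r in Ioc c 1, r⁻¹ * (x / r * deriv χ (x / r)) := by
    refine (setIntegral_eq_of_subset_of_forall_sdiff_eq_zero measurableSet_Ioc
      (Ioc_subset_Ioc_left hc0.le) fun r hr => ?_)
    have hr0 : 0 < r := hr.1.1
    have hrc : r ≤ c := by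
      by_contra! hcon
      exact hr.2 ⟨hcon, hr.1.2⟩
    by_contra hne
    have h2 := (hsupp _ (right_ne_zero_of_mul hne)).2
    rw [abs_div, abs_of_pos hr0, div_le_iff₀ hr0] at h2
    have : c * (3 * lam) = |x| := by rw [hc]; field_simp
    nlinarith
  rw [hsub, ← intervalIntegral.integral_of_le hc1]
  have hpos : ∀ r ∈ Set.uIcc c 1, 0 < r := fun r hr => by
    rw [Set.uIcc_of_le hc1] at hr
    exact hc0.trans_le hr.1
  have hderiv : ∀ r ∈ Set.uIcc c 1, HasDerivAt (fun r => -χ (x / r))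
      (r⁻¹ * (x / r * deriv χ (x / r))) r := by
    intro r hr
    have hr0 := (hpos r hr).ne'
    have h1 : HasDerivAt (fun r : ℝ => x / r) (-x / r ^ 2) r := 
      ((hasDerivAt_const r x).div (hasDerivAt_id r) hr0).congr_deriv (by simp)
    have h2 := ((hχs.differentiable (by simp)) (x / r)).hasDerivAt.comp r h1
    refine h2.neg.congr_deriv ?_
    field_simp
  rw [intervalIntegral.integral_eq_sub_of_hasDerivAt hderiv]
  · have e1 : χ (x / c) = 1 := by
      refine hχ1 _ ?_
      rw [abs_div, abs_of_pos hc0, hc, div_div_eq_mul_div, mul_div_cancel_left₀ _ hx'.ne']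
      linarith
    have e2 : χ (x / 1) = 0 := hχ0 _ (by rwa [div_one])
    rw [e1, e2]
    norm_num
  · refine ContinuousOn.intervalIntegrable fun r hr => ?_
    have hr0 := (hpos r hr).ne'
    have hd : ContinuousAt (fun r : ℝ => x / r) r := continuousAt_const.div continuousAt_id hr0
    exact ((continuousAt_inv₀ hr0).mul
      (hd.mul (hχ'.continuous.continuousAt.comp hd))).continuousWithinAt

theorem integral_rescale {F : Type} [NormedAddCommGroup F] [NormedSpace ℝ F] {r : Fin n → ℝ}
    (hr : ∀ i, 0 < r i) {K : (Fin n → ℝ) → F} (hK : Continuous K) :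
    ∫ w, K w = (∏ i, (r i)⁻¹) • ∫ x : Fin n → ℝ, K fun i => x i / r i := by
  have hdet : (Matrix.diagonal fun i => (r i)⁻¹).det = ∏ i, (r i)⁻¹ := Matrix.det_diagonal
  have hpos : 0 < ∏ i, (r i)⁻¹ := Finset.prod_pos fun i _ => inv_pos.2 (hr i)
  have h := Real.smul_map_diagonal_volume_pi (D := fun i => (r i)⁻¹) (by rw [hdet]; exact hpos.ne')
  rw [hdet, abs_of_pos hpos] at h
  conv_lhs => rw [← h]
  rw [integral_smul_measure, ENNReal.toReal_ofReal hpos.le, integral_map]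
  · congr 1
    refine integral_congr_ae (Eventually.of_forall fun x => ?_)
    simp only
    congr 1
    funext i
    simp [Matrix.mulVec_diagonal, div_eq_inv_mul]
  · exact (LinearMap.continuous_of_finiteDimensional _).aemeasurable
  · exact hK.aestronglyMeasurable

variable {h : (Fin n → ℝ) → ℂ} {ψ : (Fin n → ℝ) → ℝ}

theorem integrable_rescaled (hh : Continuous h) (hhc : HasCompactSupport h) (hψ : Continuous ψ)
    (hψc : HasCompactSupport ψ) :
    Integrable (fun p : (Fin n → ℝ) × (Fin n → ℝ) =>
      ((∏ i, (p.1 i)⁻¹ : ℝ) : ℂ) * (h p.2 * (ψ fun i => p.2 i / p.1 i : ℝ)))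
      (chartMeasure n) := by
  have hm : Measurable (fun p : (Fin n → ℝ) × (Fin n → ℝ) =>
      ((∏ i, (p.1 i)⁻¹ : ℝ) : ℂ) * (h p.2 * (ψ fun i => p.2 i / p.1 i : ℝ))) := by
    have h1 : Measurable fun p : (Fin n → ℝ) × (Fin n → ℝ) => ψ fun i => p.2 i / p.1 i := by
      refine hψ.measurable.comp (measurable_pi_iff.2 fun i => ?_)
      fun_prop
    have h2 : Measurable fun p : (Fin n → ℝ) × (Fin n → ℝ) => (∏ i, (p.1 i)⁻¹ : ℝ) := by fun_prop
    exact (Complex.measurable_ofReal.comp h2).mul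
      ((hh.measurable.comp measurable_snd).mul (Complex.measurable_ofReal.comp h1))
  obtain ⟨C, hC⟩ := hh.bounded_above_of_compact_support hhc
  rw [chartMeasure, integrable_prod_iff hm.aestronglyMeasurable]
  refine ⟨Eventually.of_forall fun r => ?_, ?_⟩
  · refine Continuous.integrable_of_hasCompactSupport ?_ ?_
    · have hd : Continuous fun x : Fin n → ℝ => ψ fun i => x i / r i := hψ.comp (by fun_prop)
      have hd' := hh.mul (Complex.continuous_ofReal.comp hd)
      exact hd'.const_smul ((∏ i, (r i)⁻¹ : ℝ) : ℂ)
    · exact hhc.mul_right.mul_left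
  · refine Integrable.mono' (integrable_const (C * ∫ w, ‖ψ w‖))
      hm.aestronglyMeasurable.norm.integral_prod_right' ?_
    filter_upwards [self_mem_ae_restrict (measurableSet_box n)] with r hr
    have hr0 : ∀ i, 0 < r i := fun i => (mem_box.1 hr i).1
    have hKc : Continuous fun w : Fin n → ℝ => ‖h (fun i => r i * w i) * (ψ w : ℂ)‖ := by
      refine ((hh.comp ?_).mul (Complex.continuous_ofReal.comp hψ)).norm
      fun_prop
    have e : ∫ x : Fin n → ℝ, ‖((∏ i, (r i)⁻¹ : ℝ) : ℂ) * (h x * (ψ fun i => x i / r i : ℝ))‖ =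
        ∫ w, ‖h (fun i => r i * w i) * (ψ w : ℂ)‖ := by
      rw [integral_rescale hr0 hKc, smul_eq_mul, ← integral_const_mul]
      refine integral_congr_ae (Eventually.of_forall fun x => ?_)
      simp only
      rw [norm_mul, Complex.norm_real, Real.norm_of_nonneg
        (Finset.prod_nonneg fun i _ => (inv_pos.2 (hr0 i)).le)]
      congr 4
      funext i
      rw [mul_div_cancel₀ _ (hr0 i).ne']
    rw [Real.norm_of_nonneg (integral_nonneg fun _ => norm_nonneg _), e, ← integral_const_mul]
    refine integral_mono_of_nonneg (Eventually.of_forall fun _ => norm_nonneg _)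
      ((hψ.norm.integrable_of_hasCompactSupport hψc.norm).const_mul C)
      (Eventually.of_forall fun w => ?_)
    simp only [norm_mul, Complex.norm_real]
    exact mul_le_mul_of_nonneg_right (hC _) (norm_nonneg _)

theorem integral_eq_integral_box_rescaled {lam : ℝ} {ρ : ℝ → ℝ} (hρ : Continuous ρ)
    (hρc : HasCompactSupport ρ)
    (hρ1 : ∀ x : ℝ, x ≠ 0 → |x| ≤ lam → ∫ r in Ioc (0 : ℝ) 1, r⁻¹ * ρ (x / r) = 1)
    (hh : Continuous h) (hhc : HasCompactSupport h) (hhl : ∀ x, h x ≠ 0 → ∀ i, |x i| ≤ lam) :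
    ∫ x, h x = ∫ r in box n, ∫ w : Fin n → ℝ,
      h (fun i => r i * w i) * ((∏ i, ρ (w i) : ℝ) : ℂ) := by
  have hψ : Continuous fun w : Fin n → ℝ => ∏ i, ρ (w i) :=
    continuous_finsetProd _ fun i _ => hρ.comp (continuous_apply i)
  have hψc : HasCompactSupport fun w : Fin n → ℝ => ∏ i, ρ (w i) := by
    refine HasCompactSupport.intro (isCompact_univ_pi fun _ : Fin n => hρc.isCompact)
      fun w hw => ?_
    simp only [Set.mem_univ_pi, not_forall] at hw
    obtain ⟨i, hi⟩ := hw
    exact Finset.prod_eq_zero (Finset.mem_univ i) (image_eq_zero_of_notMem_tsupport hi)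
  have hint := integrable_rescaled hh hhc hψ hψc
  have e1 : ∀ r ∈ box n, ∫ w : Fin n → ℝ,
      h (fun i => r i * w i) * ((∏ i, ρ (w i) : ℝ) : ℂ) =
      ∫ x : Fin n → ℝ, ((∏ i, (r i)⁻¹ : ℝ) : ℂ) * (h x * ((∏ i, ρ (x i / r i) : ℝ) : ℂ)) := by
    intro r hr
    have hr0 : ∀ i, 0 < r i := fun i => (mem_box.1 hr i).1
    have hKc : Continuous fun w : Fin n → ℝ =>
        h (fun i => r i * w i) * ((∏ i, ρ (w i) : ℝ) : ℂ) := by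
      refine (hh.comp ?_).mul (Complex.continuous_ofReal.comp hψ)
      fun_prop
    rw [integral_rescale hr0 hKc, Complex.real_smul, ← integral_const_mul]
    refine integral_congr_ae (Eventually.of_forall fun x => ?_)
    simp only
    congr 3
    funext i
    rw [mul_div_cancel₀ _ (hr0 i).ne']
  rw [setIntegral_congr_fun (measurableSet_box n) e1]
  refine Eq.trans ?_ (integral_integral_swap hint).symm
  have hae : ∀ᵐ x : Fin n → ℝ, ∀ i, x i ≠ 0 :=
    ae_all_iff.2 fun i => ae_linear_ne_zero (LinearMap.proj i) fun hcon => by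
      have := LinearMap.congr_fun hcon (Pi.single i 1)
      simp at this
  refine integral_congr_ae (hae.mono fun x hx => ?_)
  simp only
  by_cases h0 : h x = 0
  · simp [h0]
  have e2 : ∀ r : Fin n → ℝ,
      ((∏ i, (r i)⁻¹ : ℝ) : ℂ) * (h x * ((∏ i, ρ (x i / r i) : ℝ) : ℂ)) =
      h x * ((∏ i, (r i)⁻¹ * ρ (x i / r i) : ℝ) : ℂ) := by
    intro r
    rw [Finset.prod_mul_distrib]
    push_cast
    ring
  simp only [e2]
  rw [integral_const_mul, integral_complex_ofReal, volume_restrict_box,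
    integral_fintype_prod_eq_prod (fun i t => t⁻¹ * ρ (x i / t)),
    Finset.prod_eq_one fun i _ => hρ1 _ (hx i) (hhl x h0 i), Complex.ofReal_one, mul_one]

end Averaging

section Good

/-- The open cube of half side `3 * lam`. -/
def openCube (n : ℕ) (lam : ℝ) : Set (Fin n → ℝ) := {x | ∀ i, |x i| < 3 * lam}

/-- The set of points all of whose coordinates have absolute value between `lam` and `2 * lam`. -/
def annulus (n : ℕ) (lam : ℝ) : Set (Fin n → ℝ) := {w | ∀ i, lam ≤ |w i| ∧ |w i| ≤ 2 * lam}

/-- The linear form `a` attains its minimum over `A` at `v`. -/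
def IsMinAt (A : Set (Fin n → ℕ)) (a v : Fin n → ℕ) : Prop :=
  v ∈ A ∧ ∀ α ∈ A, natDot a v ≤ natDot a α

/-- The properties of a germ satisfying condition (C) that enter the local analysis. -/
structure IsGood (A : Set (Fin n → ℕ)) (F : (Fin n → ℝ) → ℝ) (lam : ℝ) : Prop where
  smooth : ContDiff ℝ (⊤ : ℕ∞) F
  lam_pos : 0 < lam
  lim : ∀ a v, IsMinAt A a v → ∀ x ∈ openCube n lam, ∃ c : ℝ,
    Tendsto (fun t : ℝ => F (scaleAction a t x) / t ^ natDot a v) (𝓝[>] 0) (𝓝 c)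
  nd : ∀ a v, (∀ i, 0 < a i) → IsMinAt A a v → ∀ (P : (Fin n → ℝ) → ℝ), ∀ x₀ ∈ openCube n lam,
    (∀ i, x₀ i ≠ 0) → (∀ᶠ x in 𝓝 x₀,
      Tendsto (fun t : ℝ => F (scaleAction a t x) / t ^ natDot a v) (𝓝[>] 0) (𝓝 (P x))) →
    ¬HasFDerivAt P (0 : (Fin n → ℝ) →L[ℝ] ℝ) x₀
  lead : ∀ a v, (∀ i, 0 < a i) → v ∈ A → (∀ α ∈ A, α ≠ v → natDot a v < natDot a α) →
    ∀ x : Fin n → ℝ, (∀ i, x i ≠ 0) → ∃ c : ℝ, c ≠ 0 ∧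
      Tendsto (fun t : ℝ => F (scaleAction a t x) / t ^ natDot a v) (𝓝[>] 0) (𝓝 c)

variable {A : Set (Fin n → ℕ)} {F : (Fin n → ℝ) → ℝ} {lam : ℝ}

theorem isOpen_openCube (n : ℕ) (lam : ℝ) : IsOpen (openCube n lam) := by
  have : openCube n lam = ⋂ i, {x | |x i| < 3 * lam} := by
    ext x
    simp [openCube]
  rw [this]
  exact isOpen_iInter_of_finite fun i =>
    isOpen_lt (continuous_abs.comp (continuous_apply i)) continuous_const

theorem isCompact_annulus (n : ℕ) (lam : ℝ) : IsCompact (annulus n lam) := by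
  have : annulus n lam =
      Set.pi univ fun _ => Icc (-(2 * lam)) (2 * lam) ∩ {u | lam ≤ |u|} := by
    ext x
    simp only [annulus, mem_ofPred_eq, Set.mem_univ_pi, mem_inter_iff, mem_Icc, abs_le]
    exact forall_congr' fun i => and_comm
  rw [this]
  exact isCompact_univ_pi fun _ =>
    isCompact_Icc.inter_right (isClosed_le continuous_const continuous_abs)

theorem annulus_subset_openCube (hlam : 0 < lam) : annulus n lam ⊆ openCube n lam :=
  fun w hw i => (hw i).2.trans_lt (by linarith)

theorem ne_zero_of_mem_annulus (hlam : 0 < lam) {w : Fin n → ℝ} (hw : w ∈ annulus n lam)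
    (i : Fin n) : w i ≠ 0 :=
  abs_pos.1 (hlam.trans_le (hw i).1)

theorem IsGood.neg (h : IsGood A F lam) : IsGood A (fun x => -F x) lam where
  smooth := h.smooth.neg
  lam_pos := h.lam_pos
  lim a v hv x hx := by
    obtain ⟨c, hc⟩ := h.lim a v hv x hx
    exact ⟨-c, by simpa only [neg_div] using hc.neg⟩
  nd a v ha hv P x₀ hx₀ hx hP hd := by
    refine h.nd a v ha hv (fun x => -P x) x₀ hx₀ hx (hP.mono fun x hx' => ?_) (by have := hd.neg; rw [neg_zero] at this; exact this)
    simpa only [neg_div, neg_neg] using hx'.neg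
  lead a v ha hv hlt x hx := by
    obtain ⟨c, hc0, hc⟩ := h.lead a v ha hv hlt x hx
    exact ⟨-c, neg_ne_zero.2 hc0, by simpa only [neg_div] using hc.neg⟩

theorem scaleAction_mem_openCube {a : Fin n → ℕ} {t : ℝ} (ht : t ∈ Ioc (0 : ℝ) 1) {x : Fin n → ℝ}
    (hx : x ∈ openCube n lam) : scaleAction a t x ∈ openCube n lam := by
  intro i
  rw [scaleAction, abs_mul, abs_of_pos (pow_pos ht.1 _)]
  exact (mul_le_of_le_one_left (abs_nonneg _) (pow_le_one₀ ht.1.le ht.2)).trans_lt (hx i)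

theorem Ioc_mem_nhdsGT_zero : Ioc (0 : ℝ) 1 ∈ 𝓝[>] (0 : ℝ) := Ioc_mem_nhdsGT one_pos

theorem exists_isGood {U : Set (Fin n → ℝ)} (hU : IsOpen U) (hU0 : (0 : Fin n → ℝ) ∈ U)
    {f : (Fin n → ℝ) → ℝ} (hf : ContDiffOn ℝ (⊤ : ℕ∞) f U) (hΓ : (NewtonPolyhedron f).Nonempty)
    (hC : ConditionC U f) :
    ∃ F lam, IsGood {α | taylorCoeff f α ≠ 0} F lam ∧ ∀ x ∈ openCube n lam, F x = f x := by
  obtain ⟨δ, hδ, hball⟩ := Metric.isOpen_iff.1 hU 0 hU0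
  set lam := δ / 8 with hlam
  have hlam0 : 0 < lam := by positivity
  let b : ContDiffBump (0 : Fin n → ℝ) := ⟨4 * lam, 5 * lam, by positivity, by linarith⟩
  set F : (Fin n → ℝ) → ℝ := fun x => b x * f x with hF
  have hcube : openCube n lam ⊆ Metric.ball 0 (4 * lam) := by
    intro x hx
    rw [mem_ball_zero_iff]
    exact ((pi_norm_le_iff_of_nonneg (by positivity)).2 fun i => (hx i).le).trans_lt
      (by linarith : 3 * lam < 4 * lam)
  have hFf : ∀ x ∈ Metric.ball (0 : Fin n → ℝ) (4 * lam), F x = f x := fun x hx => by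
    simp only [hF]
    rw [b.one_of_mem_closedBall (Metric.ball_subset_closedBall hx), one_mul]
  have hFc : ∀ x ∈ openCube n lam, F x = f x := fun x hx => hFf x (hcube hx)
  have hcU : openCube n lam ⊆ U := fun x hx => hball (Metric.ball_subset_ball (by linarith) (hcube hx))
  have hFs : ContDiff ℝ (⊤ : ℕ∞) F := by
    refine contDiff_of_tsupport' fun x hx => ?_
    have hxs : x ∈ tsupport b := closure_mono (Function.support_mul_subset_left _ _) hx
    rw [b.tsupport_eq, mem_closedBall_zero_iff] at hxs
    have hxU : x ∈ U := hball (mem_ball_zero_iff.2 (lt_of_le_of_lt hxs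
      (show 5 * lam < δ by rw [hlam]; linarith)))
    exact b.contDiff.contDiffAt.mul (hf.contDiffAt (hU.mem_nhds hxU))
  have hFe : F =ᶠ[𝓝 0] f := by
    filter_upwards [Metric.ball_mem_nhds (0 : Fin n → ℝ) (by positivity : 0 < 4 * lam)] with x hx
      using hFf x hx
  have hcoef : ∀ α, taylorCoeff F α = taylorCoeff f α := taylorCoeff_congr hFe
  obtain ⟨hE, hN⟩ := hC
  have hE' : MemEhatP (NewtonPolyhedron f) U f := by
    rcases hE with ⟨h, -⟩ | ⟨-, h⟩
    · exact absurd h hΓ.ne_empty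
    · exact h
  have hFn : NewtonPolyhedron F = NewtonPolyhedron f := by
    simp only [NewtonPolyhedron, hcoef]
  have htend : ∀ a v, (∀ i, 0 < a i) → IsMinAt {α | taylorCoeff f α ≠ 0} a v → ∀ x,
      Tendsto (fun t : ℝ => F (scaleAction a t x) / t ^ natDot a v) (𝓝[>] 0)
        (𝓝 (∑ α ∈ (Fintype.piFinset fun _ : Fin n => Finset.range (natDot a v + 1)),
          if natDot a α = natDot a v then taylorCoeff F α * mon α x else 0)) :=
    fun a v ha hv x => tendsto_scaleAction_div hFs ha
      (fun α hα => hv.2 α (by rwa [hcoef] at hα)) x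
  refine ⟨F, lam, ⟨hFs, hlam0, ?_, ?_, ?_⟩, hFc⟩
  · intro a v hv x hx
    have hface := isFaceOf_inter_Hplane (A := {α | taylorCoeff f α ≠ 0}) (a := a)
      (l := natDot a v) hv.2
    have hval : NewtonPolyhedron f ⊆ Hhalf (natPt a) (natDot a v) := fun y hy =>
      le_dot_of_mem_upHull (natPt_nonneg a)
        (fun α hα => by rw [dot_natPt]; exact_mod_cast hv.2 α hα) hy
    obtain ⟨c, hc⟩ := hE'.2.2 _ hface x (hcU hx) a (natDot a v) ⟨hval, rfl⟩
    refine ⟨c, hc.congr' ?_⟩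
    filter_upwards [Ioc_mem_nhdsGT_zero] with t ht
    rw [hFc _ (scaleAction_mem_openCube ht hx)]
  · intro a v ha hv P x₀ hx₀ hx hP hd
    have hface := isFaceOf_inter_Hplane (A := {α | taylorCoeff f α ≠ 0}) (a := a)
      (l := natDot a v) hv.2
    refine hN _ hface ⟨natPt v, natPt_mem_upHull hv.1, dot_natPt a v⟩ (isCompact_face ha hv.2) x₀
      (hcU hx₀) hx ?_
    have hPe : gammaPartPoly f (NewtonPolyhedron f ∩ Hplane (natPt a) (natDot a v)) =ᶠ[𝓝 x₀] P := by
      filter_upwards [hP] with x hx'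
      rw [gammaPartPoly_eq_sum ha]
      have := htend a v ha hv x
      simp only [hcoef] at this
      exact tendsto_nhds_unique this hx'
    exact (hd.congr_of_eventuallyEq hPe).fderiv
  · intro a v ha hv hlt x hx
    have hmin : IsMinAt {α | taylorCoeff f α ≠ 0} a v := ⟨hv, fun α hα => by
      rcases eq_or_ne α v with rfl | h
      · exact le_rfl
      · exact (hlt α hα h).le⟩
    refine ⟨taylorCoeff F v * mon v x, mul_ne_zero (by rwa [hcoef]) (Finset.prod_ne_zero_iff.2
      fun i _ => pow_ne_zero _ (hx i)), ?_⟩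
    have h := htend a v ha hmin x
    rw [Finset.sum_eq_single_of_mem v, if_pos rfl] at h
    · exact h
    · refine Fintype.mem_piFinset.2 fun i => Finset.mem_range.2 (Nat.lt_succ_of_le ?_)
      exact (Nat.le_mul_of_pos_left _ (ha i)).trans
        (Finset.single_le_sum (f := fun i => a i * v i) (fun _ _ => Nat.zero_le _)
          (Finset.mem_univ i))
    · intro α _ hαv
      split_ifs with he
      · by_cases h0 : taylorCoeff F α = 0
        · rw [h0, zero_mul]
        · rw [hcoef] at h0
          exact absurd he (hlt α h0 hαv).ne'
      · rfl

end Good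

section ChartGood

variable {A : Set (Fin n → ℕ)} {F : (Fin n → ℝ) → ℝ} {lam : ℝ} {a : Fin n → Fin n → ℕ}
  {v : Fin n → ℕ} {g : (Fin n → ℝ) × (Fin n → ℝ) → ℝ}

/-- The function `(r, w) ↦ F (r₁ w₁, …, rₙ wₙ)`. -/
def mulArg (F : (Fin n → ℝ) → ℝ) (p : (Fin n → ℝ) × (Fin n → ℝ)) : ℝ := F fun i => p.1 i * p.2 i

/-- The exponents `⟨aⱼ, v⟩` of the exceptional monomial. -/
def chartExp (a : Fin n → Fin n → ℕ) (v : Fin n → ℕ) (j : Fin n) : ℕ := natDot (a j) v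

theorem contDiff_mulArg (hF : ContDiff ℝ (⊤ : ℕ∞) F) : ContDiff ℝ (⊤ : ℕ∞) (mulArg F) := by
  refine hF.comp (contDiff_pi.2 fun i => ?_)
  exact ((contDiff_apply ℝ ℝ i).comp contDiff_fst).mul ((contDiff_apply ℝ ℝ i).comp contDiff_snd)

theorem mon_ite (α : Fin n → ℕ) (J : Finset (Fin n)) (t : ℝ) (y : Fin n → ℝ) :
    mon α (fun j => if j ∈ J then t else y j) =
      t ^ (∑ j ∈ J, α j) * mon α (fun j => if j ∈ J then 1 else y j) := by
  have h : t ^ (∑ j ∈ J, α j) = ∏ j, if j ∈ J then t ^ α j else 1 := by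
    rw [Finset.prod_ite_mem, Finset.univ_inter, Finset.prod_pow_eq_pow_sum]
  rw [h, mon, mon, ← Finset.prod_mul_distrib]
  refine Finset.prod_congr rfl fun j _ => ?_
  split_ifs <;> simp

theorem chartPi_ite_mul (a : Fin n → Fin n → ℕ) (J : Finset (Fin n)) (t : ℝ) (y w : Fin n → ℝ) :
    (fun i => chartPi a (fun j => if j ∈ J then t else y j) i * w i) =
      scaleAction (∑ j ∈ J, a j) t
        (fun i => chartPi a (fun j => if j ∈ J then 1 else y j) i * w i) := by
  funext i
  rw [chartPi, mon_ite, scaleAction, Finset.sum_apply, mul_assoc]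
  rfl

theorem ite_mem_box {J : Finset (Fin n)} {t : ℝ} {y : Fin n → ℝ} (ht : t ∈ Ioc (0 : ℝ) 1)
    (hy : ∀ j ∉ J, y j ∈ Ioc (0 : ℝ) 1) : (fun j => if j ∈ J then t else y j) ∈ box n :=
  mem_box.2 fun j => by
    by_cases h : j ∈ J
    · simpa only [if_pos h] using ht
    · simpa only [if_neg h] using hy j h

theorem mul_mem_openCube {r w : Fin n → ℝ} (hr : r ∈ box n) (hw : w ∈ openCube n lam) :
    (fun i => r i * w i) ∈ openCube n lam := fun i => by
  rw [abs_mul, abs_of_pos (mem_box.1 hr i).1]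
  exact (mul_le_of_le_one_left (abs_nonneg _) (mem_box.1 hr i).2).trans_lt (hw i)

theorem isMinAt_sum (hv : v ∈ A) (h : ∀ j, IsMinAt A (a j) v) (J : Finset (Fin n)) :
    IsMinAt A (∑ j ∈ J, a j) v :=
  ⟨hv, fun α hα => by
    rw [natDot_sum, natDot_sum]
    exact Finset.sum_le_sum fun j _ => (h j).2 α hα⟩

theorem IsGood.exists_chart (hF : IsGood A F lam) (h : ∀ j, IsMinAt A (a j) v) :
    ∃ g : (Fin n → ℝ) × (Fin n → ℝ) → ℝ, ContDiff ℝ (⊤ : ℕ∞) g ∧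
      ∀ y ∈ box n, ∀ w ∈ openCube n lam,
        mulArg F (chartPi a y, w) = mon (chartExp a v) y * g (y, w) := by
  refine exists_monomial_division (H := fun p => mulArg F (chartPi a p.1, p.2))
    ((contDiff_mulArg hF.smooth).comp
      (((contDiff_chartPi a).comp contDiff_fst).prodMk contDiff_snd)) _ _ fun j y hy w hw => ?_
  have hb : (fun k => if k ∈ ({j} : Finset (Fin n)) then 1 else y k) ∈ box n :=
    ite_mem_box ⟨one_pos, le_rfl⟩ fun k _ => mem_box.1 hy k
  obtain ⟨c, hc⟩ := hF.lim (a j) v (h j) _ (mul_mem_openCube (chartPi_mem_box a hb) hw)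
  refine ⟨c, hc.congr fun t => ?_⟩
  have e : Function.update y j t = fun k => if k ∈ ({j} : Finset (Fin n)) then t else y k := by
    funext k
    simp only [Finset.mem_singleton, Function.update_apply]
  simp only [mulArg, e]
  rw [show (fun i => chartPi a (fun k => if k ∈ ({j} : Finset (Fin n)) then t else y k) i * w i) = _
    from chartPi_ite_mul a {j} t y w, Finset.sum_singleton, chartExp]

/-- The relation between `F` and its quotient by the exceptional monomial. -/
def IsChart (F : (Fin n → ℝ) → ℝ) (lam : ℝ) (a : Fin n → Fin n → ℕ) (v : Fin n → ℕ)
    (g : (Fin n → ℝ) × (Fin n → ℝ) → ℝ) : Prop :=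
  ContDiff ℝ (⊤ : ℕ∞) g ∧ ∀ y ∈ box n, ∀ w ∈ openCube n lam,
    mulArg F (chartPi a y, w) = mon (chartExp a v) y * g (y, w)

theorem IsChart.tendsto (hg : IsChart F lam a v g) {y : Fin n → ℝ} {J : Finset (Fin n)}
    (hJ : ∀ j ∈ J, y j = 0) (hy : ∀ j ∉ J, y j ∈ Ioc (0 : ℝ) 1) {w : Fin n → ℝ}
    (hw : w ∈ openCube n lam) :
    Tendsto (fun t : ℝ => F (scaleAction (∑ j ∈ J, a j) t
        (fun i => chartPi a (fun j => if j ∈ J then 1 else y j) i * w i)) /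
          t ^ natDot (∑ j ∈ J, a j) v) (𝓝[>] 0)
      (𝓝 (mon (chartExp a v) (fun j => if j ∈ J then 1 else y j) * g (y, w))) := by
  have hcont : Continuous fun t : ℝ =>
      mon (chartExp a v) (fun j => if j ∈ J then 1 else y j) *
        g ((fun j => if j ∈ J then t else y j), w) := by
    refine continuous_const.mul (hg.1.continuous.comp (Continuous.prodMk (continuous_pi fun j => ?_)
      continuous_const))
    split_ifs
    · exact continuous_id
    · exact continuous_const
  have h0 : (fun j => if j ∈ J then 0 else y j) = y := by
    funext j
    split_ifs with h
    · exact (hJ j h).symm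
    · rfl
  have hlim := (hcont.tendsto 0).mono_left (nhdsWithin_le_nhds (s := Ioi (0 : ℝ)))
  rw [h0] at hlim
  refine hlim.congr' ?_
  filter_upwards [Ioc_mem_nhdsGT_zero] with t ht
  have h1 := hg.2 _ (ite_mem_box ht hy) w hw
  rw [mulArg] at h1
  simp only at h1
  rw [chartPi_ite_mul, mon_ite] at h1
  have e : ∑ j ∈ J, chartExp a v j = natDot (∑ j ∈ J, a j) v := (natDot_sum J a v).symm
  rw [h1, e]
  field_simp [ht.1.ne']

theorem IsChart.mem_regularSet_of_zero (hF : IsGood A F lam) (h : ∀ j, IsMinAt A (a j) v)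
    (hv : v ∈ A) (hg : IsChart F lam a v g) {y : Fin n → ℝ} (hy : ∀ j, y j ∈ Icc (0 : ℝ) 1)
    (hy0 : ∀ i, chartPi a y i = 0) {w : Fin n → ℝ} (hw : w ∈ openCube n lam)
    (hw0 : ∀ i, w i ≠ 0) : (y, w) ∈ regularSet g := by
  classical
  by_contra hcon
  simp only [regularSet, mem_ofPred_eq, not_exists, not_not] at hcon
  set J : Finset (Fin n) := Finset.univ.filter fun j => y j = 0 with hJdef
  have hJ : ∀ j ∈ J, y j = 0 := fun j hj => (Finset.mem_filter.1 hj).2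
  have hJ' : ∀ j ∉ J, y j ∈ Ioc (0 : ℝ) 1 := fun j hj =>
    ⟨lt_of_le_of_ne (hy j).1 fun h0 => hj (Finset.mem_filter.2 ⟨Finset.mem_univ _, h0.symm⟩),
      (hy j).2⟩
  have ha : ∀ i, 0 < (∑ j ∈ J, a j) i := by
    intro i
    have h0 : ∏ j, y j ^ a j i = 0 := hy0 i
    obtain ⟨j, -, hj⟩ := Finset.prod_eq_zero_iff.1 h0
    have hja : a j i ≠ 0 := fun h0 => by simp [h0] at hj
    have hjJ : j ∈ J := Finset.mem_filter.2 ⟨Finset.mem_univ _, (pow_eq_zero_iff hja).1 hj⟩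
    rw [Finset.sum_apply]
    exact (Nat.pos_of_ne_zero hja).trans_le
      (Finset.single_le_sum (f := fun j => a j i) (fun _ _ => Nat.zero_le _) hjJ)
  set c : Fin n → ℝ := chartPi a fun j => if j ∈ J then 1 else y j with hc
  set Y : ℝ := mon (chartExp a v) (fun j => if j ∈ J then 1 else y j) with hY
  have hb := ite_mem_box (J := J) (t := (1 : ℝ)) (y := y) ⟨one_pos, le_rfl⟩ hJ'
  have hcb : c ∈ box n := chartPi_mem_box a hb
  have hc0 : ∀ i, c i ≠ 0 := fun i => (mem_box.1 hcb i).1.ne'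
  have hdiv : ContDiff ℝ (⊤ : ℕ∞) fun x : Fin n → ℝ => fun i => x i / c i :=
    contDiff_pi.2 fun i => (contDiff_apply ℝ ℝ i).div_const _
  have hcw : (fun i => c i * w i / c i) = w := funext fun i => mul_div_cancel_left₀ _ (hc0 i)
  refine hF.nd (∑ j ∈ J, a j) v ha (isMinAt_sum hv h J) (fun x => Y * g (y, fun i => x i / c i))
    (fun i => c i * w i) (mul_mem_openCube hcb hw) (fun i => mul_ne_zero (hc0 i) (hw0 i)) ?_ ?_
  · have hopen : ∀ᶠ x : Fin n → ℝ in 𝓝 (fun i => c i * w i),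
        (fun i => x i / c i) ∈ openCube n lam := by
      refine hdiv.continuous.continuousAt.eventually_mem ((isOpen_openCube n lam).mem_nhds ?_)
      rwa [hcw]
    filter_upwards [hopen] with x hx
    have h1 := hg.tendsto hJ hJ' hx
    refine h1.congr fun t => ?_
    congr 3
    funext i
    exact mul_div_cancel₀ _ (hc0 i)
  · have hgd : HasFDerivAt g (fderiv ℝ g (y, w)) (y, w) :=
      ((hg.1.differentiable (by simp)) _).hasFDerivAt
    have hd : HasFDerivAt (fun x : Fin n → ℝ => (y, fun i => x i / c i))
        ((0 : (Fin n → ℝ) →L[ℝ] (Fin n → ℝ)).prod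
          (fderiv ℝ (fun x : Fin n → ℝ => fun i => x i / c i) (fun i => c i * w i)))
        (fun i => c i * w i) :=
      (hasFDerivAt_const y _).prodMk ((hdiv.differentiable (by simp)) _).hasFDerivAt
    have hcomp := (HasFDerivAt.comp (fun i => c i * w i) (g := g) (by rw [hcw]; exact hgd) hd)
    refine (hcomp.const_mul Y).congr_fderiv ?_
    have hz : ∀ u : Fin n → ℝ, fderiv ℝ g (y, w) (0, u) = 0 := by
      intro u
      have e : ((0 : Fin n → ℝ), u) =
          ∑ i, u i • ((0 : Fin n → ℝ), (Pi.single i 1 : Fin n → ℝ)) := by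
        refine Prod.ext ?_ ?_
        · simp [Prod.fst_sum]
        · rw [Prod.snd_sum]
          simp only [Prod.smul_snd]
          exact pi_eq_sum_univ' u
      rw [e, map_sum]
      refine Finset.sum_eq_zero fun i _ => ?_
      rw [map_smul, show fderiv ℝ g (y, w) (0, Pi.single i 1) = 0 from hcon i, smul_zero]
    ext u
    simp only [_root_.smul_apply, ContinuousLinearMap.comp_apply,
      ContinuousLinearMap.prod_apply, _root_.zero_apply, hz, smul_zero]

theorem IsChart.ne_zero_of_zero (hF : IsGood A F lam) (ha : (Matrix.of (genR a)).det ≠ 0)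
    (h : ∀ j, IsMinAt A (a j) v) (hv : v ∈ A) (hg : IsChart F lam a v g) {w : Fin n → ℝ}
    (hw : w ∈ openCube n lam) (hw0 : ∀ i, w i ≠ 0) : g (0, w) ≠ 0 := by
  have hpos : ∀ i, 0 < (∑ j ∈ Finset.univ, a j) i := by
    intro i
    rw [Finset.sum_apply]
    by_contra h0
    have h0' : ∑ j, a j i = 0 := by omega
    refine ha (Matrix.det_eq_zero_of_column_eq_zero i fun j => ?_)
    have := (Finset.sum_eq_zero_iff.1 h0') j (Finset.mem_univ j)
    simp [genR, natPt, this]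
  have hlt : ∀ α ∈ A, α ≠ v →
      natDot (∑ j ∈ Finset.univ, a j) v < natDot (∑ j ∈ Finset.univ, a j) α := by
    intro α hα hne
    rw [natDot_sum, natDot_sum]
    refine Finset.sum_lt_sum (fun j _ => (h j).2 α hα) ?_
    by_contra! hcon
    have heq : ∀ j, natDot (a j) α = natDot (a j) v := fun j =>
      le_antisymm (hcon j (Finset.mem_univ j)) ((h j).2 α hα)
    have hz : (Matrix.of (genR a)).mulVec (natPt α - natPt v) = 0 := by
      funext j
      have e : ∀ β, ((Matrix.of (genR a)).mulVec (natPt β)) j = natDot (a j) β := fun β =>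
        dot_natPt (a j) β
      rw [Matrix.mulVec_sub, Pi.sub_apply, e, e, heq, sub_self, Pi.zero_apply]
    have := Matrix.eq_zero_of_mulVec_eq_zero ha hz
    refine hne (funext fun i => ?_)
    have hi := congrFun this i
    simp only [Pi.sub_apply, natPt, Pi.zero_apply, sub_eq_zero] at hi
    exact_mod_cast hi
  obtain ⟨c, hc, ht⟩ := hF.lead _ v hpos hv hlt w hw0
  have h1 := hg.tendsto (y := 0) (J := Finset.univ) (fun _ _ => rfl)
    (fun j hj => absurd (Finset.mem_univ j) hj) hw
  have e1 : (fun i => chartPi a (fun j => if j ∈ Finset.univ then (1 : ℝ) else (0 : Fin n → ℝ) j) i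
      * w i) = w := by
    funext i
    simp [chartPi, mon]
  rw [e1] at h1
  intro h0
  rw [h0, mul_zero] at h1
  exact hc (tendsto_nhds_unique ht h1)

end ChartGood

section GradientBound

variable {A : Set (Fin n → ℕ)} {F : (Fin n → ℝ) → ℝ} {lam : ℝ} {a : Fin n → Fin n → ℕ}
  {v : Fin n → ℕ} {g : (Fin n → ℝ) × (Fin n → ℝ) → ℝ}

theorem gradSq_nonneg (g : (Fin n → ℝ) × (Fin n → ℝ) → ℝ) (p : (Fin n → ℝ) × (Fin n → ℝ)) :
    0 ≤ gradSq g p := Finset.sum_nonneg fun _ _ => sq_nonneg _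

theorem mem_regularSet_of_gradSq_pos {p : (Fin n → ℝ) × (Fin n → ℝ)} (h : 0 < gradSq g p) :
    p ∈ regularSet g := by
  by_contra hcon
  simp only [regularSet, mem_ofPred_eq, not_exists, not_not] at hcon
  simp [gradSq, hcon] at h

theorem IsChart.gradSq_eq (hF : ContDiff ℝ (⊤ : ℕ∞) F) (hg : IsChart F lam a v g)
    {y w : Fin n → ℝ} (hy : y ∈ box n) (hw : w ∈ openCube n lam) :
    gradSq (mulArg F) (chartPi a y, w) = mon (chartExp a v) y ^ 2 * gradSq g (y, w) := by
  rw [gradSq, gradSq, Finset.mul_sum]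
  refine Finset.sum_congr rfl fun i _ => ?_
  rw [← mul_pow]
  congr 1
  have h1 := hasLineDerivAt_dirD (contDiff_mulArg hF)
    ((0 : Fin n → ℝ), (Pi.single i 1 : Fin n → ℝ)) (chartPi a y, w)
  have h2 := hasLineDerivAt_dirD hg.1
    ((0 : Fin n → ℝ), (Pi.single i 1 : Fin n → ℝ)) (y, w)
  have h3 : HasDerivAt
      (fun t : ℝ => mon (chartExp a v) y *
        g ((y, w) + t • ((0 : Fin n → ℝ), (Pi.single i 1 : Fin n → ℝ)))) _ 0 :=
    HasDerivAt.const_mul (mon (chartExp a v) y) h2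
  refine HasDerivAt.unique (h1 : HasDerivAt _ _ _) (h3.congr_of_eventuallyEq ?_)
  have hcont : Continuous fun t : ℝ => w + t • (Pi.single i 1 : Fin n → ℝ) := by fun_prop
  have hev : ∀ᶠ t : ℝ in 𝓝 0, w + t • (Pi.single i 1 : Fin n → ℝ) ∈ openCube n lam :=
    hcont.continuousAt.eventually_mem ((isOpen_openCube n lam).mem_nhds (by simpa using hw))
  filter_upwards [hev] with t ht
  simpa using hg.2 y hy _ ht

/-- The closed unit cube. -/
def closedBox (n : ℕ) : Set (Fin n → ℝ) := Set.pi univ fun _ => Icc (0 : ℝ) 1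

theorem mem_closedBox {y : Fin n → ℝ} : y ∈ closedBox n ↔ ∀ j, y j ∈ Icc (0 : ℝ) 1 :=
   Set.mem_univ_pi

theorem isCompact_closedBox (n : ℕ) : IsCompact (closedBox n) :=
  isCompact_univ_pi fun _ => isCompact_Icc

theorem box_subset_closedBox : box n ⊆ closedBox n := fun _ hy =>
  mem_closedBox.2 fun j => Ioc_subset_Icc_self (mem_box.1 hy j)

theorem IsChart.exists_le_gradSq (hF : IsGood A F lam) (h : ∀ j, IsMinAt A (a j) v)
    (hv : v ∈ A) (hg : IsChart F lam a v g) :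
    ∃ e > 0, ∀ y ∈ closedBox n, ∀ w ∈ annulus n lam, (∀ i, chartPi a y i < e) →
      e ≤ gradSq g (y, w) := by
  have hcont : Continuous fun p : (Fin n → ℝ) × (Fin n → ℝ) =>
      ∑ i, chartPi a p.1 i + gradSq g p :=
    (continuous_finsetSum _ fun i _ => ((continuous_apply i).comp
      ((contDiff_chartPi a).continuous.comp continuous_fst))).add (contDiff_gradSq hg.1).continuous
  have hnn : ∀ y ∈ closedBox n, ∀ i, 0 ≤ chartPi a y i := fun y hy i =>
    show 0 ≤ ∏ j, y j ^ a j i from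
      Finset.prod_nonneg fun j _ => pow_nonneg (mem_closedBox.1 hy j).1 _
  obtain ⟨δ, hδ, hmin⟩ := ((isCompact_closedBox n).prod (isCompact_annulus n lam)).exists_forall_le'
    hcont.continuousOn (a := 0) (fun p hp => by
      have hs := Finset.sum_nonneg fun i (_ : i ∈ Finset.univ) => hnn p.1 hp.1 i
      rcases hs.lt_or_eq with h0 | h0
      · exact add_pos_of_pos_of_nonneg h0 (gradSq_nonneg g p)
      · refine add_pos_of_nonneg_of_pos hs ((gradSq_nonneg g p).lt_of_ne' (gradSq_ne_zero ?_))
        refine hg.mem_regularSet_of_zero hF h hv (mem_closedBox.1 hp.1) (fun i => ?_)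
          (annulus_subset_openCube hF.lam_pos hp.2) (ne_zero_of_mem_annulus hF.lam_pos hp.2)
        exact (Finset.sum_eq_zero_iff_of_nonneg fun i _ => hnn p.1 hp.1 i).1 h0.symm i
          (Finset.mem_univ i))
  refine ⟨δ / (n + 1), by positivity, fun y hy w hw hlt => ?_⟩
  have h1 := hmin (y, w) ⟨hy, hw⟩
  have h2 : ∑ i, chartPi a y i ≤ n * (δ / (n + 1)) := by
    refine (Finset.sum_le_sum fun i _ => (hlt i).le).trans_eq ?_
    simp
  have h3 : δ = n * (δ / (n + 1)) + δ / (n + 1) := by field_simp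
  simp only at h1
  linarith

theorem mon_le_mon_of_le {l m : Fin n → ℕ} (h : ∀ j, l j ≤ m j) {y : Fin n → ℝ}
    (hy : y ∈ box n) : mon m y ≤ mon l y :=
  Finset.prod_le_prod (fun j _ => pow_nonneg (mem_box.1 hy j).1.le _) fun j _ =>
    pow_le_pow_of_le_one (mem_box.1 hy j).1.le (mem_box.1 hy j).2 (h j)

theorem mon_pos (l : Fin n → ℕ) {y : Fin n → ℝ} (hy : y ∈ box n) : 0 < mon l y :=
  Finset.prod_pos fun j _ => pow_pos (mem_box.1 hy j).1 _

/-- The lower bound for the gradient of `F (r · w)` in terms of the monomials of `A`. -/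
def GradientBound (A : Set (Fin n → ℕ)) (F : (Fin n → ℝ) → ℝ) (lam e : ℝ) : Prop :=
  ∀ r ∈ box n, (∀ i, r i < e) → ∀ w ∈ annulus n lam, ∀ α ∈ A,
    e * mon α r ^ 2 ≤ gradSq (mulArg F) (r, w)

theorem ChartSystem.isMinAt (D : ChartSystem A) (σ : D.ι) (j : Fin n) :
    IsMinAt A (D.gen σ j) (D.vtx σ) := ⟨D.vtx_mem σ, D.vtx_le σ j⟩

theorem IsGood.exists_isChart (hF : IsGood A F lam) (h : ∀ j, IsMinAt A (a j) v) :
    ∃ g, IsChart F lam a v g := hF.exists_chart h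

theorem IsGood.exists_gradientBound (hF : IsGood A F lam) (hA : A.Nonempty) :
    ∃ e > 0, GradientBound A F lam e := by
  obtain ⟨D⟩ := nonempty_chartSystem hA
  have := D.fin
  choose g hg using fun σ => hF.exists_isChart (D.isMinAt σ)
  choose e he hle using fun σ => (hg σ).exists_le_gradSq hF (D.isMinAt σ) (D.vtx_mem σ)
  obtain ⟨x, hx, hx0⟩ : ∃ x : ℝ, (∀ σ, x ≤ e σ) ∧ 0 < x :=
    ((eventually_all.2 fun σ => Filter.mem_of_superset (Ioc_mem_nhdsGT (he σ))
      fun _ h => h.2).and self_mem_nhdsWithin : ∀ᶠ x : ℝ in 𝓝[>] 0, _).exists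
  refine ⟨x, hx0, fun r hr hrx w hw α hα => ?_⟩
  obtain ⟨σ, hσ⟩ := D.covers _ (negLog_mem_octant hr)
  obtain ⟨y, hy, rfl⟩ : r ∈ chartPi (D.gen σ) '' box n := by
    rw [image_chartPi (D.det_ne σ)]
    exact ⟨hr, hσ⟩
  have hlow := hle σ y (box_subset_closedBox hy) w hw fun i => (hrx i).trans_le (hx σ)
  rw [(hg σ).gradSq_eq hF.smooth hy (annulus_subset_openCube hF.lam_pos hw), mon_chartPi, mul_comm]
  refine mul_le_mul (pow_le_pow_left₀ (mon_pos _ hy).le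
    (mon_le_mon_of_le (fun j => D.vtx_le σ j α hα) hy) 2) ((hx σ).trans hlow) hx0.le (sq_nonneg _)

theorem IsChart.mem_regularSet {e : ℝ} (hF : IsGood A F lam) (he : 0 < e)
    (hb : GradientBound A F lam e) (hv : v ∈ A) (hg : IsChart F lam a v g) {y : Fin n → ℝ}
    (hy : y ∈ closedBox n) (hye : ∀ i, chartPi a y i < e) {w : Fin n → ℝ}
    (hw : w ∈ annulus n lam) : (y, w) ∈ regularSet g := by
  refine mem_regularSet_of_gradSq_pos (he.trans_le ?_)
  have hc : Continuous fun t : ℝ => fun j => max (y j) t :=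
    continuous_pi fun j => continuous_const.max continuous_id
  have h0 : (fun j => max (y j) (0 : ℝ)) = y := funext fun j => max_eq_left (mem_closedBox.1 hy j).1
  have hlim : Tendsto (fun t : ℝ => gradSq g ((fun j => max (y j) t), w)) (𝓝[>] 0)
      (𝓝 (gradSq g (y, w))) := by
    have h1 : Continuous fun t : ℝ => gradSq g ((fun j => max (y j) t), w) :=
      (contDiff_gradSq hg.1).continuous.comp (hc.prodMk continuous_const)
    have := (h1.tendsto 0).mono_left (nhdsWithin_le_nhds (s := Ioi (0 : ℝ)))
    rwa [h0] at this
  refine ge_of_tendsto hlim ?_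
  have hev : ∀ᶠ t : ℝ in 𝓝 0, ∀ i, chartPi a (fun j => max (y j) t) i < e :=
    eventually_all.2 fun i => (((continuous_apply i).comp
      ((contDiff_chartPi a).continuous.comp hc)).continuousAt.eventually_lt continuousAt_const
        (by simpa [h0] using hye i))
  filter_upwards [nhdsWithin_le_nhds hev, Ioc_mem_nhdsGT_zero] with t ht ht1
  have hbox : (fun j => max (y j) t) ∈ box n := mem_box.2 fun j =>
    ⟨lt_max_of_lt_right ht1.1, max_le (mem_closedBox.1 hy j).2 ht1.2⟩
  have h1 := hb _ (chartPi_mem_box a hbox) ht w hw v hv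
  rw [hg.gradSq_eq hF.smooth hbox (annulus_subset_openCube hF.lam_pos hw), mon_chartPi,
    mul_comm] at h1
  exact le_of_mul_le_mul_left h1 (pow_pos (mon_pos _ hbox) 2)

end GradientBound

section ZetaSum

variable {A : Set (Fin n → ℕ)} {F : (Fin n → ℝ) → ℝ} {lam e : ℝ} {a : Fin n → Fin n → ℕ}
  {v : Fin n → ℕ} {g : (Fin n → ℝ) × (Fin n → ℝ) → ℝ} {φ : (Fin n → ℝ) → ℂ} {ρ : ℝ → ℝ}

instance (D : ChartSystem A) : Fintype D.ι := D.fin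

theorem isOpen_regularSet (hg : ContDiff ℝ (⊤ : ℕ∞) g) : IsOpen (regularSet g) := by
  have : regularSet g = {p | gradSq g p ≠ 0} := by
    ext p
    refine ⟨gradSq_ne_zero, fun h => mem_regularSet_of_gradSq_pos ((gradSq_nonneg g p).lt_of_ne' h)⟩
  rw [this]
  exact isOpen_ne_fun (contDiff_gradSq hg).continuous continuous_const

theorem isClosed_annulus (n : ℕ) (lam : ℝ) : IsClosed (annulus n lam) :=
  (isCompact_annulus n lam).isClosed

theorem IsChart.exists_isAmp (hF : IsGood A F lam) (he : 0 < e) (hb : GradientBound A F lam e)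
    (hv : v ∈ A) (hg : IsChart F lam a v g) (hφ : ContDiff ℝ (⊤ : ℕ∞) φ)
    (hφe : ∀ x ∈ tsupport φ, ∀ i, |x i| < e * lam) (hρ : ContDiff ℝ (⊤ : ℕ∞) ρ)
    (hρl : ∀ u, ρ u ≠ 0 → lam ≤ |u| ∧ |u| ≤ 2 * lam) :
    ∃ Θ, IsAmp (regularSet g) Θ ∧ (∀ p ∈ tsupport Θ, p.2 ∈ annulus n lam) ∧
      ∀ y ∈ box n, ∀ w, Θ (y, w) =
        φ (fun i => chartPi a y i * w i) * ((∏ i, ρ (w i) : ℝ) : ℂ) := by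
  set m : (Fin n → ℝ) × (Fin n → ℝ) → (Fin n → ℝ) := fun p i => chartPi a p.1 i * p.2 i with hm
  have hms : ContDiff ℝ (⊤ : ℕ∞) m := contDiff_pi.2 fun i =>
    ((contDiff_apply ℝ ℝ i).comp ((contDiff_chartPi a).comp contDiff_fst)).mul
      ((contDiff_apply ℝ ℝ i).comp contDiff_snd)
  have hψs : ContDiff ℝ (⊤ : ℕ∞) fun p : (Fin n → ℝ) × (Fin n → ℝ) => ∏ i, ρ (p.2 i) :=
    contDiff_prod fun i _ => hρ.comp ((contDiff_apply ℝ ℝ i).comp contDiff_snd)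
  have hψ0 : ∀ w : Fin n → ℝ, ∏ i, ρ (w i) ≠ 0 → w ∈ annulus n lam := fun w hw i =>
    hρl _ (Finset.prod_ne_zero_iff.1 hw i (Finset.mem_univ i))
  set K : Set ((Fin n → ℝ) × (Fin n → ℝ)) :=
    (closedBox n ×ˢ annulus n lam) ∩ m ⁻¹' tsupport φ with hK
  have hKc : IsCompact K := ((isCompact_closedBox n).prod (isCompact_annulus n lam)).inter_right
    ((isClosed_tsupport φ).preimage hms.continuous)
  have hKr : K ⊆ regularSet g := by
    rintro ⟨y, w⟩ ⟨⟨hy, hw⟩, hp⟩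
    refine hg.mem_regularSet hF he hb hv hy (fun i => ?_) hw
    have h1 := hφe _ hp i
    have h0 : 0 ≤ chartPi a y i := show 0 ≤ ∏ j, y j ^ a j i from
      Finset.prod_nonneg fun j _ => pow_nonneg (mem_closedBox.1 hy j).1 _
    rw [hm] at h1
    simp only at h1
    rw [abs_mul, abs_of_nonneg h0] at h1
    exact lt_of_mul_lt_mul_right ((mul_le_mul_of_nonneg_left (hw i).1 h0).trans_lt h1) hF.lam_pos.le
  obtain ⟨R, hR⟩ := hKc.isBounded.subset_ball 0
  obtain ⟨χ, hχ, h1, h0⟩ := exists_smooth_cutoff hKc.isClosed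
    (((isOpen_regularSet hg.1).inter Metric.isOpen_ball).isClosed_compl)
    (Set.disjoint_left.2 fun p hp hp' => hp' ⟨hKr hp, hR hp⟩)
  have hχT : tsupport χ ⊆ regularSet g ∩ Metric.ball 0 R := fun p hp => by
    by_contra hcon
    exact notMem_tsupport_iff_eventuallyEq.2 (h0 p hcon) hp
  have hχc : HasCompactSupport χ := HasCompactSupport.of_support_subset_isCompact
    (isCompact_closedBall 0 R)
    ((subset_tsupport χ).trans (hχT.trans (inter_subset_right.trans Metric.ball_subset_closedBall)))
  refine ⟨fun p => ((χ p : ℝ) : ℂ) * (φ (m p) * ((∏ i, ρ (p.2 i) : ℝ) : ℂ)), ⟨?_, ?_, ?_⟩, ?_, ?_⟩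
  · exact (Complex.ofRealCLM.contDiff.comp hχ).mul ((hφ.comp hms).mul
      (Complex.ofRealCLM.contDiff.comp hψs))
  · exact (hχc.comp_left (g := fun x : ℝ => (x : ℂ)) Complex.ofReal_zero).mul_right
  · refine fun p hp => (hχT ?_).1
    refine closure_mono (fun q hq => ?_) hp
    intro hq0
    refine hq ?_
    simp only [hq0, Complex.ofReal_zero, zero_mul]
  · refine fun p hp => closure_minimal (t := Prod.snd ⁻¹' annulus n lam) (fun q hq => ?_)
      ((isClosed_annulus n lam).preimage continuous_snd) hp
    refine hψ0 q.2 fun hq0 => hq ?_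
    simp only [hq0, Complex.ofReal_zero, mul_zero]
  · intro y hy w
    by_cases hw : w ∈ annulus n lam
    · by_cases hp : m (y, w) ∈ tsupport φ
      · show ((χ (y, w) : ℝ) : ℂ) * (φ (m (y, w)) * _) = _
        rw [(h1 (y, w) ⟨⟨box_subset_closedBox hy, hw⟩, hp⟩).self_of_nhds, Complex.ofReal_one,
          one_mul]
      · have hz : φ (m (y, w)) = 0 := image_eq_zero_of_notMem_tsupport hp
        show ((χ (y, w) : ℝ) : ℂ) * (φ (m (y, w)) * _) = φ (m (y, w)) * _
        rw [hz]
        simp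
    · have hz : ∏ i, ρ (w i) = 0 := by
        by_contra hcon
        exact hw (hψ0 w hcon)
      simp [hz]

theorem ofReal_prod_cpow {ι : Type*} (t : Finset ι) (x : ι → ℝ) (hx : ∀ i ∈ t, 0 ≤ x i) (s : ℂ) :
    ((∏ i ∈ t, x i : ℝ) : ℂ) ^ s = ∏ i ∈ t, ((x i : ℝ) : ℂ) ^ s := by
  classical
  induction t using Finset.induction_on with
  | empty => simp
  | insert i t hi ih =>
    rw [Finset.prod_insert hi, Finset.prod_insert hi, Complex.ofReal_mul,
      Complex.mul_cpow_ofReal_nonneg (hx i (Finset.mem_insert_self _ _))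
        (Finset.prod_nonneg fun j hj => hx j (Finset.mem_insert_of_mem hj)),
      ih fun j hj => hx j (Finset.mem_insert_of_mem hj)]

theorem monWeight_eq {l b : Fin n → ℕ} (hb : ∀ j, 1 ≤ b j) (s : ℂ) {y : Fin n → ℝ}
    (hy : y ∈ box n) :
    monWeight l b s y = ((∏ j, y j ^ (b j - 1) : ℝ) : ℂ) * ((mon l y : ℝ) : ℂ) ^ s := by
  rw [mon, ofReal_prod_cpow _ _ fun j _ => pow_nonneg (mem_box.1 hy j).1.le _, Complex.ofReal_prod,
    ← Finset.prod_mul_distrib, monWeight]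
  refine Finset.prod_congr rfl fun j _ => ?_
  have hj := (mem_box.1 hy j).1
  have hj' : (y j : ℂ) ≠ 0 := by exact_mod_cast hj.ne'
  rw [add_sub_assoc, Complex.cpow_add _ _ hj', mul_comm,
    show (b j : ℂ) - 1 = ((b j - 1 : ℕ) : ℂ) by rw [Nat.cast_sub (hb j), Nat.cast_one],
    Complex.cpow_natCast, Complex.ofReal_pow, Complex.ofReal_pow]
  congr 1
  have h2 : ((y j : ℂ) ^ l j) ≠ 0 := pow_ne_zero _ hj'
  rw [Complex.cpow_def_of_ne_zero hj', Complex.cpow_def_of_ne_zero h2, ← Complex.ofReal_pow,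
    ← Complex.ofReal_log (pow_nonneg hj.le _), ← Complex.ofReal_log hj.le, Real.log_pow]
  push_cast
  ring_nf

theorem IsChart.integral_eq_chartInt (hF : IsGood A F lam) (ha : (Matrix.of (genR a)).det ≠ 0)
    (hg : IsChart F lam a v g) {Ω : Set ((Fin n → ℝ) × (Fin n → ℝ))}
    {Θ : (Fin n → ℝ) × (Fin n → ℝ) → ℂ} (hΘ : IsAmp Ω Θ)
    (hρl : ∀ u, ρ u ≠ 0 → lam ≤ |u| ∧ |u| ≤ 2 * lam)
    (hΘφ : ∀ y ∈ box n, ∀ w, Θ (y, w) =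
      φ (fun i => chartPi a y i * w i) * ((∏ i, ρ (w i) : ℝ) : ℂ)) {s : ℂ} (hs : 0 < s.re) :
    ∫ y in box n, ((∏ j, y j ^ (wtSum a j - 1) : ℝ) : ℂ) * ∫ w : Fin n → ℝ,
        (posPow s (F fun i => chartPi a y i * w i) * φ fun i => chartPi a y i * w i) *
          ((∏ i, ρ (w i) : ℝ) : ℂ) =
      chartInt g (chartExp a v) (wtSum a) 0 Θ s := by
  have hint := hΘ.integrable hg.1 (l := chartExp a v) (one_le_wtSum ha) hs (z := s + (0 : ℕ))
    (by simpa using hs)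
  rw [chartInt, chartMeasure, integral_prod _ hint]
  refine setIntegral_congr_fun (measurableSet_box n) fun y hy => ?_
  simp only
  rw [← integral_const_mul]
  refine integral_congr_ae (Eventually.of_forall fun w => ?_)
  simp only [Nat.cast_zero, add_zero]
  rw [hΘφ y hy, monWeight_eq (one_le_wtSum ha) s hy]
  by_cases hw : ∏ i, ρ (w i) = 0
  · simp [hw]
  have hwc : w ∈ openCube n lam := annulus_subset_openCube hF.lam_pos fun i =>
    hρl _ (Finset.prod_ne_zero_iff.1 hw i (Finset.mem_univ i))
  have h1 : F (fun i => chartPi a y i * w i) = mon (chartExp a v) y * g (y, w) := hg.2 y hy w hwc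
  rw [h1, posPow_mul (mon_pos _ hy)]
  ring

theorem integrableOn_box_integral_rescaled {h ψ : (Fin n → ℝ) → ℂ} (hh : Continuous h)
    (hhc : HasCompactSupport h) (hψ : Continuous ψ) (hψc : HasCompactSupport ψ) :
    IntegrableOn (fun r => ∫ w : Fin n → ℝ, h (fun i => r i * w i) * ψ w) (box n) := by
  obtain ⟨C, hC⟩ := hhc.exists_bound_of_continuous hh
  have h1 : Integrable (fun p : (Fin n → ℝ) × (Fin n → ℝ) => ψ p.2)
      (((volume : Measure (Fin n → ℝ)).restrict (box n)).prod volume) :=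
    (hψ.integrable_of_hasCompactSupport hψc).comp_snd _
  have h2 : Continuous fun p : (Fin n → ℝ) × (Fin n → ℝ) => h fun i => p.1 i * p.2 i :=
    hh.comp (continuous_pi fun i => ((continuous_apply i).comp continuous_fst).mul
      ((continuous_apply i).comp continuous_snd))
  have h3 := h1.bdd_mul (c := C) h2.aestronglyMeasurable (Eventually.of_forall fun p => hC _)
  exact h3.integral_prod_left

theorem ChartSystem.zetaPlus_eq_sum (D : ChartSystem A) (hF : IsGood A F lam)
    {g : D.ι → (Fin n → ℝ) × (Fin n → ℝ) → ℝ}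
    (hg : ∀ σ, IsChart F lam (D.gen σ) (D.vtx σ) (g σ)) (hφ : ContDiff ℝ (⊤ : ℕ∞) φ)
    (hφc : HasCompactSupport φ) (hφl : ∀ x ∈ tsupport φ, ∀ i, |x i| ≤ lam)
    (hρ : ContDiff ℝ (⊤ : ℕ∞) ρ) (hρl : ∀ u, ρ u ≠ 0 → lam ≤ |u| ∧ |u| ≤ 2 * lam)
    (hρ1 : ∀ x : ℝ, x ≠ 0 → |x| ≤ lam → ∫ r in Ioc (0 : ℝ) 1, r⁻¹ * ρ (x / r) = 1)
    {Θ : D.ι → (Fin n → ℝ) × (Fin n → ℝ) → ℂ} {Ω : D.ι → Set ((Fin n → ℝ) × (Fin n → ℝ))}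
    (hΘ : ∀ σ, IsAmp (Ω σ) (Θ σ))
    (hΘφ : ∀ σ, ∀ y ∈ box n, ∀ w, Θ σ (y, w) =
      φ (fun i => chartPi (D.gen σ) y i * w i) * ((∏ i, ρ (w i) : ℝ) : ℂ)) {s : ℂ}
    (hs : 0 < s.re) :
    zetaPlus F φ s = ∑ σ, ((D.wt σ * |(Matrix.of (genR (D.gen σ))).det| : ℝ) : ℂ) *
      chartInt (g σ) (chartExp (D.gen σ) (D.vtx σ)) (wtSum (D.gen σ)) 0 (Θ σ) s := by
  set h : (Fin n → ℝ) → ℂ := fun x => posPow s (F x) * φ x with hh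
  have hhc : Continuous h :=
    ((continuous_posPow hs).comp hF.smooth.continuous).mul hφ.continuous
  have hhs : HasCompactSupport h := hφc.mul_left
  have hρc : HasCompactSupport ρ := HasCompactSupport.intro (isCompact_Icc (a := -(2 * lam))
    (b := 2 * lam)) fun u hu => by
      by_contra hcon
      exact hu (abs_le.1 (hρl u hcon).2)
  have hψ : Continuous fun w : Fin n → ℝ => ((∏ i, ρ (w i) : ℝ) : ℂ) :=
    Complex.continuous_ofReal.comp
      (continuous_finsetProd _ fun i _ => hρ.continuous.comp (continuous_apply i))
  have hψc : HasCompactSupport fun w : Fin n → ℝ => ((∏ i, ρ (w i) : ℝ) : ℂ) := by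
    refine HasCompactSupport.intro (isCompact_annulus n lam) fun w hw => ?_
    rw [Complex.ofReal_eq_zero]
    by_contra hcon
    exact hw fun i => hρl _ (Finset.prod_ne_zero_iff.1 hcon i (Finset.mem_univ i))
  set G : (Fin n → ℝ) → ℂ := fun r => ∫ w : Fin n → ℝ,
    h (fun i => r i * w i) * ((∏ i, ρ (w i) : ℝ) : ℂ) with hG
  have hGint : IntegrableOn G (box n) :=
    integrableOn_box_integral_rescaled hhc hhs hψ hψc
  have h0 : zetaPlus F φ s = ∫ r in box n, G r :=
    integral_eq_integral_box_rescaled hρ.continuous hρc hρ1 hhc hhs fun x hx i =>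
      hφl x (subset_tsupport φ (right_ne_zero_of_mul hx)) i
  have hsum : ∀ᵐ r ∂(volume.restrict (box n)),
      ∑ σ, D.wt σ * coneInd (D.gen σ) (negLog r) = 1 :=
    ae_box_of_ae_octant (Q := fun u => ∑ σ, D.wt σ * coneInd (D.gen σ) u = 1) D.ae_sum
  have h1 : ∫ r in box n, G r =
      ∫ r in box n, ∑ σ, ((D.wt σ : ℝ) : ℂ) * (((coneInd (D.gen σ) (negLog r) : ℝ) : ℂ) * G r) := by
    refine integral_congr_ae ?_
    filter_upwards [hsum] with r hr
    simp only [← mul_assoc, ← Finset.sum_mul, ← Complex.ofReal_mul, ← Complex.ofReal_sum, hr,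
      Complex.ofReal_one, one_mul]
  rw [h0, h1, integral_finsetSum]
  · refine Finset.sum_congr rfl fun σ _ => ?_
    rw [integral_const_mul, integral_box_coneInd (D.det_ne σ), Complex.ofReal_mul, mul_assoc]
    congr 2
    exact (hg σ).integral_eq_chartInt hF (D.det_ne σ) (hΘ σ) hρl (hΘφ σ) hs
  · intro σ _
    refine Integrable.const_mul ?_ _
    classical
    have hT : MeasurableSet {r : Fin n → ℝ | negLog r ∈ coneSpan (genR (D.gen σ))} :=
      measurable_negLog (measurableSet_coneSpan (D.det_ne σ))
    refine (hGint.indicator hT).congr (Eventually.of_forall fun r => ?_)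
    by_cases hr : negLog r ∈ coneSpan (genR (D.gen σ))
    · simp [Set.indicator, coneInd, hr]
    · simp [Set.indicator, coneInd, hr]

end ZetaSum

section MeroZeta

variable {A : Set (Fin n → ℕ)} {F : (Fin n → ℝ) → ℝ} {lam e : ℝ} {φ : (Fin n → ℝ) → ℂ}

open Classical in
theorem ChartSystem.meroExt_zetaPlus (D : ChartSystem A) (hF : IsGood A F lam) (he : 0 < e)
    (hb : GradientBound A F lam e) (hφ : ContDiff ℝ (⊤ : ℕ∞) φ) (hφc : HasCompactSupport φ)
    (hφe : ∀ x ∈ tsupport φ, ∀ i, |x i| < e * lam) (hφl : ∀ x ∈ tsupport φ, ∀ i, |x i| ≤ lam)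
    (M : ℕ) {P : Set ℂ} {ρ : ℝ} {q : ℕ}
    (hP : ∀ σ j, 0 < chartExp (D.gen σ) (D.vtx σ) j → ∀ ν : ℕ,
      -((wtSum (D.gen σ) j : ℂ) + ν) / chartExp (D.gen σ) (D.vtx σ) j ∈ P)
    (hP' : ∀ m : ℕ, -((m : ℂ) + 1) ∈ P)
    (hρ : ∀ σ j, ρ * chartExp (D.gen σ) (D.vtx σ) j ≤ wtSum (D.gen σ) j)
    (hq : ∀ σ, ((Finset.univ.filter fun j => 0 < chartExp (D.gen σ) (D.vtx σ) j ∧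
        ρ * chartExp (D.gen σ) (D.vtx σ) j = wtSum (D.gen σ) j).card +
        if ∃ k : ℤ, ρ = k then 1 else 0) ≤ q ∨
      ((∀ j, ρ * chartExp (D.gen σ) (D.vtx σ) j = wtSum (D.gen σ) j) ∧ n ≤ q)) :
    MeroExt M P ((-ρ : ℝ) : ℂ) q (zetaPlus F φ) := by
  obtain ⟨r, hr, hrl, hr1⟩ := exists_multiplicative_bump hF.lam_pos
  choose g hg using fun σ => hF.exists_isChart (D.isMinAt σ)
  choose Θ hΘ hΘa hΘφ using fun σ =>
    (hg σ).exists_isAmp hF he hb (D.vtx_mem σ) hφ hφe hr hrl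
  have hsum : ∀ s : ℂ, 0 < s.re → _ = _ := fun s hs =>
    (D.zetaPlus_eq_sum hF hg hφ hφc hφl hr hrl hr1 hΘ hΘφ hs).symm
  refine MeroExt.congr (MeroExt.sum Finset.univ fun σ _ => MeroExt.const_mul ?_ _) hsum
  rcases hq σ with h | ⟨h1, h2⟩
  · exact (meroExt_chartInt (hg σ).1 M (one_le_wtSum (D.det_ne σ)) (hΘ σ) (hP σ) hP' (hρ σ)).mono h
  · refine (meroExt_chartInt_of_all (hg σ).1 M (one_le_wtSum (D.det_ne σ)) (hΘ σ) (hP σ) hP' h1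
      ?_).mono h2
    rintro ⟨y, w⟩ hp (rfl : y = 0)
    have hw := hΘa σ _ hp
    exact (hg σ).ne_zero_of_zero hF (D.det_ne σ) (D.isMinAt σ) (D.vtx_mem σ)
      (annulus_subset_openCube hF.lam_pos hw) fun i => ne_zero_of_mem_annulus hF.lam_pos hw i

end MeroZeta

section Gluing

variable {M : ℕ}

theorem isConnected_halfPlane (M : ℕ) : IsConnected (halfPlane M) := by
  refine ⟨⟨1, pos_mem_halfPlane M (by simp)⟩, ?_⟩
  exact (convex_halfSpace_re_gt _).isPreconnected

theorem meromorphicOn_eventuallyEq {G₁ G₂ : ℂ → ℂ} (h₁ : MeromorphicOn G₁ (halfPlane M))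
    (h₂ : MeromorphicOn G₂ (halfPlane M)) (he : ∀ s : ℂ, 0 < s.re → G₁ s = G₂ s) {s : ℂ}
    (hs : s ∈ halfPlane M) : G₁ =ᶠ[𝓝[≠] s] G₂ := by
  have hm : MeromorphicOn (G₁ - G₂) (halfPlane M) := h₁.sub h₂
  have h0 : meromorphicOrderAt (G₁ - G₂) 1 = ⊤ := by
    rw [meromorphicOrderAt_eq_top_iff]
    refine Filter.Eventually.filter_mono nhdsWithin_le_nhds ?_
    filter_upwards [(isOpen_lt continuous_const Complex.continuous_re).mem_nhds
      (show (1 : ℂ) ∈ {s : ℂ | 0 < s.re} by simp)] with t ht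
    rw [Pi.sub_apply, he t ht, sub_self]
  have h1 : meromorphicOrderAt (G₁ - G₂) s = ⊤ := by
    by_contra hcon
    exact (hm.exists_meromorphicOrderAt_ne_top_iff_forall (isConnected_halfPlane M)).1
      ⟨⟨s, hs⟩, hcon⟩ ⟨1, pos_mem_halfPlane M (by simp)⟩ h0
  rw [meromorphicOrderAt_eq_top_iff] at h1
  filter_upwards [h1] with t ht
  exact sub_eq_zero.1 ht

theorem exists_global_meroExt {F : ℂ → ℂ} {P : Set ℂ} {s₀ : ℂ} {p : ℕ}
    (hF : ∀ M, MeroExt M P s₀ p F) (hP : ∀ s ∈ P, s.re ≤ 0) :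
    ∃ Z : ℂ → ℂ, MeromorphicOn Z univ ∧ (∀ s : ℂ, 0 < s.re → Z s = F s) ∧
      ∀ M P s₀ p, MeroExt M P s₀ p F →
        (∀ s ∈ halfPlane M, s ∉ P → AnalyticAt ℂ Z s) ∧
        (s₀ ∈ halfPlane M → PoleOrderAtMost Z s₀ p) := by
  choose G hGm hGe hGa _ using hF
  set N : ℕ → ℂ → ℂ := fun M => toMeromorphicNFOn (G M) (halfPlane M) with hN
  have hNF : ∀ M, MeromorphicNFOn (N M) (halfPlane M) := fun M =>
    meromorphicNFOn_toMeromorphicNFOn _ _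
  have hNe : ∀ M, ∀ s : ℂ, 0 < s.re → N M s = F s := by
    intro M s hs
    have hs' := pos_mem_halfPlane M hs
    have ha : AnalyticAt ℂ (G M) s := hGa M s hs' fun h => hs.not_ge (hP s h)
    have h2 := (MeromorphicNFAt.eventuallyEq_nhdsNE_iff_eventuallyEq_nhds ha.meromorphicNFAt
      (hNF M hs')).1 (MeromorphicOn.toMeromorphicNFOn_eq_self_on_nhdsNE (hGm M) hs').symm
    rw [← hGe M s hs]
    exact h2.self_of_nhds.symm
  have hNN : ∀ M M', ∀ s ∈ halfPlane M, s ∈ halfPlane M' → N M s = N M' s := by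
    intro M M' s hs hs'
    wlog h : M ≤ M' generalizing M M'
    · exact (this M' M hs' hs (le_of_not_ge h)).symm
    have hsub : halfPlane M ⊆ halfPlane M' := fun t ht => by
      have : (M : ℝ) ≤ M' := by exact_mod_cast h
      exact lt_of_le_of_lt (neg_le_neg this) ht
    have h1 := meromorphicOn_eventuallyEq (hNF M).meromorphicOn
      (fun t ht => (hNF M').meromorphicOn t (hsub ht))
      (fun t ht => (hNe M t ht).trans (hNe M' t ht).symm) hs
    exact ((MeromorphicNFAt.eventuallyEq_nhdsNE_iff_eventuallyEq_nhds (hNF M hs)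
      (hNF M' hs')).1 h1).self_of_nhds
  have hmem : ∀ s : ℂ, s ∈ halfPlane (⌈|s.re|⌉₊ + 1) := fun s => by
    show -((⌈|s.re|⌉₊ + 1 : ℕ) : ℝ) < s.re
    have h1 := Nat.le_ceil |s.re|
    have h2 := neg_abs_le s.re
    push_cast
    linarith
  set Z : ℂ → ℂ := fun s => N (⌈|s.re|⌉₊ + 1) s with hZ
  have hZN : ∀ M, ∀ s ∈ halfPlane M, Z =ᶠ[𝓝 s] N M := fun M s hs => by
    filter_upwards [(isOpen_halfPlane M).mem_nhds hs] with t ht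
    exact hNN _ _ t (hmem t) ht
  have hZNF : ∀ s, MeromorphicNFAt Z s := fun s =>
    (meromorphicNFAt_congr (hZN _ s (hmem s))).2 (hNF _ (hmem s))
  refine ⟨Z, fun s _ => (hZNF s).meromorphicAt, fun s hs => hNe _ s hs, ?_⟩
  rintro M P s₀ p ⟨H, hHm, hHe, hHa, hHp⟩
  have key : ∀ s ∈ halfPlane M, H =ᶠ[𝓝[≠] s] Z := fun s hs =>
    meromorphicOn_eventuallyEq hHm (fun t _ => (hZNF t).meromorphicAt)
      (fun t ht => (hHe t ht).trans (hNe _ t ht).symm) hs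
  refine ⟨fun s hs hsP => ?_, fun hs => (hHp hs).congr (key s₀ hs)⟩
  have ha := hHa s hs hsP
  exact ha.congr ((MeromorphicNFAt.eventuallyEq_nhdsNE_iff_eventuallyEq_nhds ha.meromorphicNFAt
    (hZNF s)).1 (key s hs))

end Gluing

section Distance

variable {A : Set (Fin n → ℕ)} {d : ℝ}

theorem dot_const (a : Fin n → ℕ) (d : ℝ) :
    dot (natPt a) (fun _ => d) = d * ((∑ i, a i : ℕ) : ℝ) := by
  simp only [dot, natPt, ← Finset.sum_mul, Nat.cast_sum]
  ring

theorem ChartSystem.chartExp_eq_lval (D : ChartSystem A) (σ : D.ι) (j : Fin n) :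
    lval (upHull A) (natPt (D.gen σ j)) = chartExp (D.gen σ) (D.vtx σ) j :=
  lval_upHull (D.vtx_mem σ) (D.vtx_le σ j)

theorem ChartSystem.chartExp_le (D : ChartSystem A) (hq : (fun _ => d) ∈ upHull A) (σ : D.ι)
    (j : Fin n) : (chartExp (D.gen σ) (D.vtx σ) j : ℝ) ≤ d * wtSum (D.gen σ) j := by
  rw [← D.chartExp_eq_lval, wtSum, ← dot_const]
  exact lval_le_dot hq

theorem add_mem_upHull {x y : Fin n → ℝ} (hx : x ∈ upHull A) (hy : ∀ i, 0 ≤ y i) :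
    x + y ∈ upHull A := by
  have h : upHull A ⊆ (fun z => z + y) ⁻¹' upHull A := by
    refine convexHull_min ?_ ((convex_convexHull ℝ _).translate_preimage_left y)
    rintro z ⟨α, hα, hz⟩
    exact subset_convexHull ℝ _ ⟨α, hα, fun i => (hz i).trans (le_add_of_nonneg_right (hy i))⟩
  exact h hx

theorem interior_upHull_nonempty (hA : A.Nonempty) : (interior (upHull A)).Nonempty := by
  obtain ⟨α, hα⟩ := hA
  refine ⟨fun i => α i + 1, mem_interior.2 ⟨Set.pi univ fun i => Ioi (α i : ℝ), fun x hx => ?_,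
    isOpen_set_pi finite_univ fun _ _ => isOpen_Ioi, fun i _ => by simp⟩⟩
  exact subset_convexHull ℝ _ ⟨α, hα, fun i => le_of_lt (hx i (mem_univ i))⟩

theorem convex_upHull (A : Set (Fin n → ℕ)) : Convex ℝ (upHull A) := convex_convexHull ℝ _

theorem notMem_interior_upHull (hmin : ∀ t, (fun _ => t) ∈ upHull A → d ≤ t) :
    (fun _ => d) ∉ interior (upHull A) := by
  intro h
  have hc : Continuous fun t : ℝ => (fun _ => t : Fin n → ℝ) := by fun_prop
  have h1 := hc.continuousAt.preimage_mem_nhds (mem_interior_iff_mem_nhds.1 h)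
  obtain ⟨ε, hε, hb⟩ := Metric.mem_nhds_iff.1 h1
  have := hmin (d - ε / 2) (hb (by
    rw [Metric.mem_ball, Real.dist_eq, abs_lt]
    constructor <;> linarith))
  linarith

theorem exists_supporting_form (hA : A.Nonempty)
    (hmin : ∀ t, (fun _ => t) ∈ upHull A → d ≤ t) :
    ∃ u : Fin n → ℝ, u ∈ octant n ∧ u ≠ 0 ∧ ∀ x ∈ upHull A, dot u (fun _ => d) ≤ dot u x := by
  obtain ⟨ψ, hψ⟩ := geometric_hahn_banach_point_open (convex_upHull A).interior
    isOpen_interior (notMem_interior_upHull hmin)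
  set u : Fin n → ℝ := fun i => ψ (Pi.single i 1) with hu
  have hψu : ∀ x, ψ x = dot u x := fun x => by
    conv_lhs => rw [pi_eq_sum_univ' x]
    rw [map_sum]
    refine Finset.sum_congr rfl fun i _ => ?_
    rw [map_smul, smul_eq_mul, mul_comm, hu]
  have hle : ∀ x ∈ upHull A, dot u (fun _ => d) ≤ dot u x := by
    intro x hx
    have hcl : x ∈ closure (interior (upHull A)) := by
      rw [(convex_upHull A).closure_interior_eq_closure_of_nonempty_interior
        (interior_upHull_nonempty hA)]
      exact subset_closure hx
    rw [← hψu, ← hψu]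
    exact closure_minimal (t := {x | ψ (fun _ => d) ≤ ψ x}) (fun y hy => (hψ y hy).le)
      (isClosed_le continuous_const ψ.continuous) hcl
  refine ⟨u, fun i => ?_, fun h0 => ?_, hle⟩
  · obtain ⟨x, hx⟩ := (interior_upHull_nonempty hA).mono interior_subset
    by_contra hneg
    push Not at hneg
    obtain ⟨t, ht⟩ : ∃ t : ℝ, 0 ≤ t ∧ dot u x + t * u i < dot u (fun _ => d) := by
      refine ⟨max 0 ((dot u (fun _ => d) - dot u x - 1) / u i), le_max_left _ _, ?_⟩
      have h1 := mul_le_mul_of_nonpos_right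
        (le_max_right 0 ((dot u (fun _ => d) - dot u x - 1) / u i)) hneg.le
      rw [div_mul_cancel₀ _ hneg.ne] at h1
      linarith
    have h2 := hle _ (add_mem_upHull (y := Pi.single i t) hx fun j => by
      by_cases h : j = i
      · subst h
        simpa using ht.1
      · simp [h])
    rw [dot_add] at h2
    have h3 : dot u (Pi.single i t) = t * u i := by
      simp [dot, Pi.single_apply, mul_comm]
    rw [h3] at h2
    linarith [ht.2]
  · obtain ⟨x, hx⟩ := interior_upHull_nonempty hA
    have := hψ x hx
    rw [hψu, hψu, h0] at this
    simp [dot] at this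

theorem ChartSystem.exists_chartExp_eq (D : ChartSystem A) (hA : A.Nonempty)
    (hq : (fun _ => d) ∈ upHull A) (hmin : ∀ t, (fun _ => t) ∈ upHull A → d ≤ t) :
    ∃ σ j, (chartExp (D.gen σ) (D.vtx σ) j : ℝ) = d * wtSum (D.gen σ) j := by
  obtain ⟨u, huo, hu0, hu⟩ := exists_supporting_form hA hmin
  obtain ⟨σ, c, hc, -, rfl⟩ := D.covers u huo
  obtain ⟨j, hj⟩ : ∃ j, c j ≠ 0 := by
    by_contra hcon
    push Not at hcon
    exact hu0 (by simp [hcon])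
  refine ⟨σ, j, (D.chartExp_le hq σ j).antisymm ?_⟩
  have hdot : ∀ x, dot (∑ j, c j • genR (D.gen σ) j) x = ∑ j, c j * dot (natPt (D.gen σ j)) x := by
    intro x
    simp only [dot, Finset.sum_apply, Pi.smul_apply, smul_eq_mul, Finset.sum_mul, Finset.mul_sum]
    rw [Finset.sum_comm]
    refine Finset.sum_congr rfl fun j _ => Finset.sum_congr rfl fun i _ => ?_
    rw [genR]
    ring
  have h1 := hu _ (natPt_mem_upHull (D.vtx_mem σ))
  rw [hdot, hdot] at h1
  by_contra hlt
  refine absurd h1 (not_le.2 (Finset.sum_lt_sum (fun k _ => ?_) ⟨j, Finset.mem_univ j, ?_⟩))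
  · rw [dot_natPt, dot_const]
    exact mul_le_mul_of_nonneg_left (D.chartExp_le hq σ k) (hc k)
  · rw [dot_natPt, dot_const]
    exact mul_lt_mul_of_pos_left (not_le.1 hlt) ((hc j).lt_of_ne' hj)

end Distance

section Dimension

variable {A : Set (Fin n → ℕ)} {τ : Set (Fin n → ℝ)}

theorem dot_eq_of_mem_intrinsicInterior {a q : Fin n → ℝ} (hq : q ∈ intrinsicInterior ℝ τ)
    (h : ∀ x ∈ τ, dot a q ≤ dot a x) {x : Fin n → ℝ} (hx : x ∈ τ) : dot a x = dot a q := by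
  obtain ⟨y, hy, rfl⟩ := mem_intrinsicInterior.1 hq
  have hxs : x ∈ affineSpan ℝ τ := subset_affineSpan ℝ τ hx
  set p : ℝ → affineSpan ℝ τ := fun t =>
    ⟨AffineMap.lineMap (y : Fin n → ℝ) x t, AffineMap.lineMap_mem t y.2 hxs⟩ with hp
  have hpc : Continuous p := Continuous.subtype_mk (AffineMap.lineMap_continuous) _
  have hp0 : p 0 = y := Subtype.ext (by simp [hp])
  have h1 : ∀ᶠ t in 𝓝 (0 : ℝ), p t ∈ ((↑) : affineSpan ℝ τ → Fin n → ℝ) ⁻¹' τ :=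
    hpc.continuousAt.eventually_mem (by rw [hp0]; exact mem_interior_iff_mem_nhds.1 hy)
  obtain ⟨ε, hε, hb⟩ := Metric.eventually_nhds_iff.1 h1
  have h2 := h _ (hb (y := -(ε / 2)) (by
    rw [Real.dist_eq, sub_zero, abs_neg, abs_of_pos (by linarith)]; linarith))
  have h3 : ((p (-(ε / 2)) : affineSpan ℝ τ) : Fin n → ℝ) =
      (1 + ε / 2) • (y : Fin n → ℝ) + (-(ε / 2)) • x := by
    simp only [hp, AffineMap.lineMap_apply_module]
    ring_nf
  rw [h3, dot_add, dot_smul, dot_smul] at h2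
  refine le_antisymm ?_ (h x hx)
  have : 0 ≤ (ε / 2) * (dot a y - dot a x) := by linarith
  linarith [nonneg_of_mul_nonneg_right this (by linarith)]

theorem card_add_setDim_le {a : Fin n → Fin n → ℕ} (ha : (Matrix.of (genR a)).det ≠ 0)
    {q : Fin n → ℝ} (J : Finset (Fin n))
    (h : ∀ j ∈ J, ∀ x ∈ τ, dot (natPt (a j)) x = dot (natPt (a j)) q) :
    J.card + setDim τ ≤ n := by
  set L : (Fin n → ℝ) →ₗ[ℝ] (J → ℝ) :=
    (LinearMap.funLeft ℝ ℝ (Subtype.val : J → Fin n)).comp (Matrix.of (genR a)).mulVecLin with hL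
  have hLa : ∀ x j, L x j = dot (natPt (a j)) x := fun x j => rfl
  have hsurj : Function.Surjective L := by
    rw [hL, LinearMap.coe_comp]
    refine (LinearMap.funLeft_surjective_of_injective ℝ ℝ _ Subtype.val_injective).comp fun y => ?_
    refine ⟨(Matrix.of (genR a))⁻¹.mulVec y, ?_⟩
    rw [Matrix.mulVecLin_apply, Matrix.mulVec_mulVec,
      Matrix.mul_nonsing_inv _ (isUnit_iff_ne_zero.2 ha), Matrix.one_mulVec]
  have hker : (affineSpan ℝ τ).direction ≤ LinearMap.ker L := by
    rw [direction_affineSpan, vectorSpan_def, Submodule.span_le]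
    rintro _ ⟨x, hx, y, hy, rfl⟩
    show L (x - y) = 0
    rw [map_sub]
    ext j
    rw [Pi.sub_apply, hLa, hLa, h j j.2 x hx, h j j.2 y hy, sub_self, Pi.zero_apply]
  have h1 := L.finrank_range_add_finrank_ker
  rw [LinearMap.range_eq_top.2 hsurj, finrank_top, Module.finrank_fintype_fun_eq_card,
    Module.finrank_fintype_fun_eq_card, Fintype.card_coe, Fintype.card_fin] at h1
  have h2 := Submodule.finrank_mono hker
  rw [setDim]
  omega

end Dimension

section Continuation

variable {A : Set (Fin n → ℕ)} {F : (Fin n → ℝ) → ℝ} {lam e d : ℝ} {φ : (Fin n → ℝ) → ℂ}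
  {τ : Set (Fin n → ℝ)}

/-- The diagonal point `(d, …, d)` lies on the boundary of the Newton polyhedron of `A` and in the
relative interior of the subset `τ`. -/
structure IsPrincipal (A : Set (Fin n → ℕ)) (d : ℝ) (τ : Set (Fin n → ℝ)) : Prop where
  pos : 0 < d
  le_of_mem : ∀ t, (fun _ => t) ∈ upHull A → d ≤ t
  subset : τ ⊆ upHull A
  mem : (fun _ => d) ∈ intrinsicInterior ℝ τ

theorem IsPrincipal.diag_mem (h : IsPrincipal A d τ) : (fun _ => d) ∈ upHull A :=
  h.subset (intrinsicInterior_subset h.mem)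

open Classical in
theorem ChartSystem.card_add_setDim_le (D : ChartSystem A) (h : IsPrincipal A d τ) (σ : D.ι) :
    (Finset.univ.filter fun j => 0 < chartExp (D.gen σ) (D.vtx σ) j ∧
      1 / d * chartExp (D.gen σ) (D.vtx σ) j = wtSum (D.gen σ) j).card + setDim τ ≤ n := by
  refine KN.card_add_setDim_le (D.det_ne σ) (q := fun _ => d) _ fun j hj x hx =>
    dot_eq_of_mem_intrinsicInterior h.mem (fun y hy => ?_) hx
  have h1 : (chartExp (D.gen σ) (D.vtx σ) j : ℝ) = d * wtSum (D.gen σ) j := by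
    rw [← (Finset.mem_filter.1 hj).2.2, ← mul_assoc, mul_one_div_cancel h.pos.ne', one_mul]
  rw [dot_const, ← wtSum, ← h1, ← D.chartExp_eq_lval]
  exact lval_le_dot (h.subset hy)

theorem ChartSystem.inv_mul_chartExp_le (D : ChartSystem A) (h : IsPrincipal A d τ) (σ : D.ι)
    (j : Fin n) : 1 / d * chartExp (D.gen σ) (D.vtx σ) j ≤ wtSum (D.gen σ) j := by
  rw [one_div_mul_eq_div, div_le_iff₀ h.pos, mul_comm]
  exact D.chartExp_le h.diag_mem σ j

open Classical in
theorem ChartSystem.meroExt_principal (D : ChartSystem A) (hF : IsGood A F lam) (he : 0 < e)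
    (hb : GradientBound A F lam e) (hφ : ContDiff ℝ (⊤ : ℕ∞) φ) (hφc : HasCompactSupport φ)
    (hφe : ∀ x ∈ tsupport φ, ∀ i, |x i| < e * lam) (hφl : ∀ x ∈ tsupport φ, ∀ i, |x i| ≤ lam)
    (h : IsPrincipal A d τ) (M : ℕ) {P : Set ℂ}
    (hP : ∀ σ j, 0 < chartExp (D.gen σ) (D.vtx σ) j → ∀ ν : ℕ,
      -((wtSum (D.gen σ) j : ℂ) + ν) / chartExp (D.gen σ) (D.vtx σ) j ∈ P)
    (hP' : ∀ m : ℕ, -((m : ℂ) + 1) ∈ P) :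
    MeroExt M P ((-(1 / d) : ℝ) : ℂ)
      (if ∃ k : ℤ, 1 / d = k then min (n - setDim τ + 1) n else n - setDim τ)
      (zetaPlus F φ) := by
  refine D.meroExt_zetaPlus hF he hb hφ hφc hφe hφl M hP hP' (D.inv_mul_chartExp_le h) fun σ => ?_
  have h1 := D.card_add_setDim_le h σ
  set J := Finset.univ.filter fun j => 0 < chartExp (D.gen σ) (D.vtx σ) j ∧
    1 / d * chartExp (D.gen σ) (D.vtx σ) j = wtSum (D.gen σ) j with hJ
  split_ifs
  · by_cases hJn : J.card = n
    · refine Or.inr ⟨fun j => ?_, by omega⟩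
      have : J = Finset.univ := (Finset.card_eq_iff_eq_univ J).1 (by rw [hJn, Fintype.card_fin])
      exact (Finset.mem_filter.1 (this ▸ Finset.mem_univ j : j ∈ J)).2.2
    · exact Or.inl (by omega)
  · exact Or.inl (by omega)

open Classical in
theorem exists_continuation (hA : A.Nonempty) (hF : IsGood A F lam) :
    ∃ e : ℝ, 0 < e ∧ ∀ φ : (Fin n → ℝ) → ℂ, ContDiff ℝ (⊤ : ℕ∞) φ → HasCompactSupport φ →
      (∀ x ∈ tsupport φ, ∀ i, |x i| < e) →
      ∃ Z : ℂ → ℂ, MeromorphicOn Z univ ∧ (∀ s : ℂ, 0 < s.re → Z s = zetaPlus F φ s) ∧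
        ∀ d τ, IsPrincipal A d τ → ∀ S : SimplicialSubdivision n (upHull A),
          (∀ s : ℂ, (∀ r ∈ expSet (upHull A) S, (r : ℂ) ≠ s) → AnalyticAt ℂ Z s) ∧
          PoleOrderAtMost Z ((-(1 / d) : ℝ) : ℂ)
            (if ∃ k : ℤ, 1 / d = k then min (n - setDim τ + 1) n else n - setDim τ) := by
  obtain ⟨e, he, hb⟩ := hF.exists_gradientBound hA
  have hl := hF.lam_pos
  refine ⟨min (e * lam) lam, lt_min (mul_pos he hl) hl, fun φ hφ hφc hφ0 => ?_⟩
  have hφe : ∀ x ∈ tsupport φ, ∀ i, |x i| < e * lam := fun x hx i =>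
    (hφ0 x hx i).trans_le (min_le_left _ _)
  have hφl : ∀ x ∈ tsupport φ, ∀ i, |x i| ≤ lam := fun x hx i =>
    ((hφ0 x hx i).trans_le (min_le_right _ _)).le
  obtain ⟨D₀⟩ := nonempty_chartSystem hA
  obtain ⟨Z, hZm, hZe, hZ⟩ := exists_global_meroExt (F := zetaPlus F φ) (P := {s | s.re ≤ 0})
    (s₀ := ((-0 : ℝ) : ℂ)) (p := n + 1) (fun M => by
      refine D₀.meroExt_zetaPlus hF he hb hφ hφc hφe hφl M (fun σ j _ ν => ?_) (fun m => ?_)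
        (fun σ j => ?_) fun σ => Or.inl ?_
      · have : (-((wtSum (D₀.gen σ) j : ℂ) + ν) / chartExp (D₀.gen σ) (D₀.vtx σ) j) =
            ((-((wtSum (D₀.gen σ) j : ℝ) + ν) / chartExp (D₀.gen σ) (D₀.vtx σ) j : ℝ) : ℂ) := by
          push_cast
          rfl
        rw [this, mem_ofPred_eq, Complex.ofReal_re]
        exact div_nonpos_of_nonpos_of_nonneg (neg_nonpos.2 (by positivity)) (by positivity)
      · have : (-((m : ℂ) + 1)) = ((-((m : ℝ) + 1) : ℝ) : ℂ) := by push_cast; rfl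
        rw [this, mem_ofPred_eq, Complex.ofReal_re]
        exact neg_nonpos.2 (by positivity)
      · rw [zero_mul]
        positivity
      · refine Nat.add_le_add ((Finset.card_le_univ _).trans_eq (Fintype.card_fin n)) ?_
        split_ifs <;> simp) fun s hs => hs
  refine ⟨Z, hZm, hZe, fun d τ h S => ?_⟩
  set D := chartSystemOf S with hD
  have hmem : ∀ s : ℂ, ∃ M : ℕ, s ∈ halfPlane M := fun s => by
    obtain ⟨M, hM⟩ := exists_nat_gt (-s.re)
    exact ⟨M, show -(M : ℝ) < s.re by linarith⟩
  have hext := fun M => hZ M {s | ∃ r ∈ expSet (upHull A) S, (r : ℂ) = s} _ _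
    (D.meroExt_principal hF he hb hφ hφc hφe hφl h M (fun σ j hj ν => ?_) fun m => ?_)
  · refine ⟨fun s hs => ?_, ?_⟩
    · obtain ⟨M, hM⟩ := hmem s
      exact (hext M).1 s hM fun ⟨r, hr, hrs⟩ => hs r hr hrs
    · obtain ⟨M, hM⟩ := hmem ((-(1 / d) : ℝ) : ℂ)
      exact (hext M).2 hM
  · refine ⟨_, Or.inl ⟨D.gen σ j, ⟨σ, j, rfl⟩, ?_, ν, rfl⟩, ?_⟩
    · rw [D.chartExp_eq_lval]
      exact_mod_cast hj
    · rw [D.chartExp_eq_lval, wtSum]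
      push_cast
      rfl
  · refine ⟨-((m : ℝ) + 1), Or.inr ⟨m, rfl⟩, ?_⟩
    push_cast
    rfl

theorem isGreatest_expSetMain (hA : A.Nonempty) (h : IsPrincipal A d τ)
    (S : SimplicialSubdivision n (upHull A)) :
    IsGreatest (expSetMain (upHull A) S) (-(1 / d)) := by
  set D := chartSystemOf S with hD
  constructor
  · obtain ⟨σ, j, hj⟩ := D.exists_chartExp_eq hA h.diag_mem h.le_of_mem
    have hb : (0 : ℝ) < wtSum (D.gen σ) j := by exact_mod_cast one_le_wtSum (D.det_ne σ) j
    refine ⟨D.gen σ j, ⟨σ, j, rfl⟩, ?_, 0, ?_⟩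
    · rw [D.chartExp_eq_lval, hj]
      exact mul_pos h.pos hb
    · rw [D.chartExp_eq_lval, hj, Nat.cast_zero, add_zero, ← Nat.cast_sum, ← wtSum, neg_div,
        div_mul_cancel_right₀ hb.ne', one_div]
  · rintro _ ⟨_, ⟨σ, j, rfl⟩, hpos, ν, rfl⟩
    have h1 := D.inv_mul_chartExp_le h σ j
    have h2 : lval (upHull A) (natPt (S.gen σ j)) = chartExp (D.gen σ) (D.vtx σ) j :=
      D.chartExp_eq_lval σ j
    rw [h2] at hpos ⊢
    rw [neg_div, neg_le_neg_iff, le_div_iff₀ hpos]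
    refine h1.trans ?_
    rw [wtSum, Nat.cast_sum]
    exact le_add_of_nonneg_right (Nat.cast_nonneg ν)

theorem zetaPlus_congr {f : (Fin n → ℝ) → ℝ} (h : ∀ x ∈ tsupport φ, F x = f x) (s : ℂ) :
    zetaPlus F φ s = zetaPlus f φ s := by
  refine integral_congr_ae (Eventually.of_forall fun x => ?_)
  simp only
  by_cases hx : x ∈ tsupport φ
  · rw [h x hx]
  · rw [image_eq_zero_of_notMem_tsupport hx, mul_zero, mul_zero]

theorem zetaAbs_eq_add {f : (Fin n → ℝ) → ℝ} (hF : Continuous F)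
    (h : ∀ x ∈ tsupport φ, F x = f x) (hφ : Continuous φ) (hφc : HasCompactSupport φ) {s : ℂ}
    (hs : 0 < s.re) : zetaAbs f φ s = zetaPlus F φ s + zetaPlus (fun x => -F x) φ s := by
  have hi : ∀ G : (Fin n → ℝ) → ℝ, Continuous G → Integrable fun x => posPow s (G x) * φ x :=
    fun G hG => (((continuous_posPow hs).comp hG).mul hφ).integrable_of_hasCompactSupport
      hφc.mul_left
  rw [zetaPlus, zetaPlus]
  refine Eq.trans ?_ (integral_add (hi F hF) (hi _ hF.neg))
  refine integral_congr_ae (Eventually.of_forall fun x => ?_)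
  simp only
  by_cases hx : x ∈ tsupport φ
  · rw [← h x hx, ← add_mul]
    congr 1
    show ((|F x| : ℝ) : ℂ) ^ s = posPow s (F x) + posPow s (-F x)
    have hs0 := ne_zero_of_re_pos hs
    rcases le_total (F x) 0 with h0 | h0
    · rw [posPow_of_nonpos h0 hs0, posPow, max_eq_left (neg_nonneg.2 h0), abs_of_nonpos h0,
        zero_add]
    · rw [posPow_of_nonpos (neg_nonpos.2 h0) hs0, posPow, max_eq_left h0, abs_of_nonneg h0,
        add_zero]
  · rw [image_eq_zero_of_notMem_tsupport hx]
    simp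

end Continuation

theorem IsPrincipalFace.isPrincipal {f : (Fin n → ℝ) → ℝ} {τ : Set (Fin n → ℝ)} (hf0 : f 0 = 0)
    (hτ : IsPrincipalFace f τ) :
    IsPrincipal {α | taylorCoeff f α ≠ 0} (newtonDist f) τ := by
  have hsub : τ ⊆ NewtonPolyhedron f := by
    obtain ⟨a, l, -, rfl⟩ := hτ.1
    exact inter_subset_left
  have hge : ∀ t, (fun _ => t) ∈ NewtonPolyhedron f → 1 ≤ t * (n : ℝ) := by
    intro t ht
    have h1 : (1 : ℝ) ≤ dot (natPt (fun _ : Fin n => 1)) fun _ => t := by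
      refine le_dot_of_mem_upHull (A := {α | taylorCoeff f α ≠ 0})
        (natPt_nonneg fun _ : Fin n => 1) (fun α hα => ?_) ht
      rw [dot_natPt]
      have : natDot (fun _ => 1) α ≠ 0 := fun h0 => by
        have hα0 : α = 0 := by
          ext i
          simpa using (Finset.sum_eq_zero_iff.1 h0) i (Finset.mem_univ i)
        refine hα ?_
        rw [hα0, taylorCoeff, mderiv_zero, hf0, zero_div]
      exact_mod_cast Nat.one_le_iff_ne_zero.2 this
    rw [dot_const] at h1
    simpa using h1
  have hpos : ∀ t, (fun _ => t) ∈ NewtonPolyhedron f → 0 < t := fun t ht => by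
    by_contra h0
    have := mul_nonpos_of_nonpos_of_nonneg (not_lt.1 h0) (Nat.cast_nonneg (α := ℝ) n)
    linarith [hge t ht]
  exact ⟨hpos _ (hsub (intrinsicInterior_subset hτ.2)), fun t ht =>
    csInf_le ⟨0, fun u hu => (hpos u hu).le⟩ ht, hsub, hτ.2⟩

/-- Theorem 9.1: if `f` satisfies condition (C) and the support of `φ` is
small enough, then `Z_±(s;φ)` and `Z(s;φ)` extend meromorphically to `ℂ` with poles in
`{-(⟨a⟩+ν)/l(a) : ν ∈ ℤ₊, a ∈ Σ̃^{(1)}} ∪ (-ℕ)`; the largest element of the first set is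
`-1/d(f)`, and the order of a pole at `-1/d(f)` is at most `m(f)` if `1/d(f)` is not an
integer, and at most `min(m(f)+1, n)` otherwise. -/
theorem statement3 {n : ℕ} (U : Set (Fin n → ℝ)) (hUopen : IsOpen U)
    (hU0 : (0 : Fin n → ℝ) ∈ U)
    (f : (Fin n → ℝ) → ℝ) (hf : ContDiffOn ℝ (⊤ : ℕ∞) f U)
    (hf0 : f 0 = 0) (hdf0 : fderiv ℝ f 0 = 0)
    (hΓ : (NewtonPolyhedron f).Nonempty)
    (hC : ConditionC U f)
    (τ : Set (Fin n → ℝ)) (hτ : IsPrincipalFace f τ) :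
    ∃ V ∈ 𝓝 (0 : Fin n → ℝ), ∀ φ : (Fin n → ℝ) → ℂ, IsAmplitude U V φ →
      ∃ Zp Zm Za : ℂ → ℂ,
        MeromorphicOn Zp Set.univ ∧ MeromorphicOn Zm Set.univ ∧
        MeromorphicOn Za Set.univ ∧
        (∀ s : ℂ, 0 < s.re →
          Zp s = zetaPlus f φ s ∧ Zm s = zetaMinus f φ s ∧ Za s = zetaAbs f φ s) ∧
        ∀ S : SimplicialSubdivision n (NewtonPolyhedron f),
          (∀ s : ℂ, (∀ r ∈ expSet (NewtonPolyhedron f) S, (r : ℂ) ≠ s) →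
            AnalyticAt ℂ Zp s ∧ AnalyticAt ℂ Zm s ∧ AnalyticAt ℂ Za s) ∧
          IsGreatest (expSetMain (NewtonPolyhedron f) S) (-(1 / newtonDist f)) ∧
          ((¬ ∃ k : ℤ, 1 / newtonDist f = (k : ℝ)) →
            PoleOrderAtMost Zp ((-(1 / newtonDist f) : ℝ) : ℂ) (n - setDim τ) ∧
            PoleOrderAtMost Zm ((-(1 / newtonDist f) : ℝ) : ℂ) (n - setDim τ) ∧
            PoleOrderAtMost Za ((-(1 / newtonDist f) : ℝ) : ℂ) (n - setDim τ)) ∧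
          ((∃ k : ℤ, 1 / newtonDist f = (k : ℝ)) →
            PoleOrderAtMost Zp ((-(1 / newtonDist f) : ℝ) : ℂ) (min (n - setDim τ + 1) n) ∧
            PoleOrderAtMost Zm ((-(1 / newtonDist f) : ℝ) : ℂ) (min (n - setDim τ + 1) n) ∧
            PoleOrderAtMost Za ((-(1 / newtonDist f) : ℝ) : ℂ) (min (n - setDim τ + 1) n)) := by
  classical
  obtain ⟨F, lam, hF, hFf⟩ := exists_isGood hUopen hU0 hf hΓ hC
  have hA : {α | taylorCoeff f α ≠ 0}.Nonempty := nonempty_of_upHull hΓ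
  have hpr := hτ.isPrincipal hf0
  obtain ⟨e₁, he₁, h₁⟩ := exists_continuation hA hF
  obtain ⟨e₂, he₂, h₂⟩ := exists_continuation hA hF.neg
  have hl := hF.lam_pos
  refine ⟨Metric.ball 0 (min lam (min e₁ e₂)),
    Metric.ball_mem_nhds _ (lt_min hl (lt_min he₁ he₂)), fun φ hφ => ?_⟩
  obtain ⟨hφs, hφc, hφV⟩ := hφ
  have hsmall : ∀ x ∈ tsupport φ, ∀ i, |x i| < min lam (min e₁ e₂) := fun x hx i =>
    (norm_le_pi_norm x i).trans_lt (mem_ball_zero_iff.1 (hφV hx).2)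
  have heq : ∀ x ∈ tsupport φ, F x = f x := fun x hx => hFf x fun i => by
    have := (hsmall x hx i).trans_le (min_le_left _ _)
    linarith
  obtain ⟨Zp, hpm, hpe, hp⟩ := h₁ φ hφs hφc fun x hx i =>
    (hsmall x hx i).trans_le ((min_le_right _ _).trans (min_le_left _ _))
  obtain ⟨Zm, hmm, hme, hm⟩ := h₂ φ hφs hφc fun x hx i =>
    (hsmall x hx i).trans_le ((min_le_right _ _).trans (min_le_right _ _))
  refine ⟨Zp, Zm, fun s => Zp s + Zm s, hpm, hmm, hpm.add hmm, fun s hs => ⟨?_, ?_, ?_⟩,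
    fun S => ⟨fun s hs => ?_, isGreatest_expSetMain hA hpr S, fun hk => ?_, fun hk => ?_⟩⟩
  · rw [hpe s hs, zetaPlus_congr heq]
  · rw [hme s hs, zetaPlus_congr (f := fun x => -f x) fun x hx => by rw [heq x hx]]
    rfl
  · show Zp s + Zm s = _
    rw [hpe s hs, hme s hs, zetaAbs_eq_add hF.smooth.continuous heq hφs.continuous hφc hs]
  · have h3 := (hp _ τ hpr S).1 s hs
    have h4 := (hm _ τ hpr S).1 s hs
    exact ⟨h3, h4, h3.add h4⟩
  · have h3 := (hp _ τ hpr S).2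
    have h4 := (hm _ τ hpr S).2
    rw [if_neg hk] at h3 h4
    exact ⟨h3, h4, h3.add h4⟩
  · have h3 := (hp _ τ hpr S).2
    have h4 := (hm _ τ hpr S).2
    rw [if_pos hk] at h3 h4
    exact ⟨h3, h4, h3.add h4⟩

end KN
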